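/- Let G be a graph and let Z ⊆ V(G) with |Z| = 4 be such that (G,Z) is internally 4-connected. If G has no Z-rooted K4-model then |E(G)| ≤ 3|V(G)| − 7. -/

import Mathlib

open SimpleGraph

/-- `K7vee` is the graph obtained from `K 7` by deleting two edges with a common end. -/
def K7vee : SimpleGraph (Fin 7) :=
  (completeGraph (Fin 7)).deleteEdges {s(0, 1), s(0, 2)}

/-- `K6vee` is the graph obtained from `K 6` by deleting two edges with a common end. -/
def K6vee : SimpleGraph (Fin 6) :=
  (completeGraph (Fin 6)).deleteEdges {s(0, 1), s(0, 2)}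

/-- The complete multipartite graph with four parts of size two. -/
def K2222 : SimpleGraph (Fin 4 × Fin 2) :=
  SimpleGraph.comap Prod.fst (completeGraph (Fin 4))

/-- `H` is a minor of `G`: there is a model of `H` in `G`, i.e. a family of pairwise disjoint
nonempty connected branch sets, one for each vertex of `H`, with edges of `G` between branch
sets corresponding to adjacent vertices of `H`. -/
def IsMinor {W V : Type} (H : SimpleGraph W) (G : SimpleGraph V) : Prop :=
  ∃ bag : W → Set V,
    (∀ w, (G.induce (bag w)).Connected) ∧
    (∀ w w', w ≠ w' → Disjoint (bag w) (bag w')) ∧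
    (∀ w w', H.Adj w w' → ∃ u ∈ bag w, ∃ v ∈ bag w', G.Adj u v)

/-- A graph is `k`-connected if it has more than `k` vertices and stays connected after
removing any set of fewer than `k` vertices. -/
def IsKConnected {V : Type} [Fintype V] (k : ℕ) (G : SimpleGraph V) : Prop :=
  k < Fintype.card V ∧ ∀ S : Set V, S.ncard < k → (G.induce (Sᶜ : Set V)).Connected

/-- A separation of `G`: `A ∪ B = V(G)` and no edge joins `A - B` to `B - A`. -/
def IsSeparation {V : Type} (G : SimpleGraph V) (A B : Set V) : Prop :=
  A ∪ B = Set.univ ∧ ∀ ⦃u v : V⦄, G.Adj u v → ¬(u ∈ A \ B ∧ v ∈ B \ A)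

/-- `(G, Z)` is internally `k`-connected: every separation `(A,B)` of `G` with `Z ⊆ A`
and `B - A ≠ ∅` has order at least `k`. -/
def InternallyConnected {V : Type} (G : SimpleGraph V) (Z : Set V) (k : ℕ) : Prop :=
  ∀ A B : Set V, IsSeparation G A B → Z ⊆ A → (B \ A).Nonempty →
    k ≤ (A ∩ B).ncard

/-- A `Z`-rooted `K₄`-model in `G`. -/
def HasRootedK4Model {V : Type} (G : SimpleGraph V) (Z : Set V) : Prop :=
  ∃ B : Fin 4 → Set V,
    (∀ i, (G.induce (B i)).Connected) ∧
    (∀ i j, i ≠ j → Disjoint (B i) (B j)) ∧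
    (∀ i, ∃! z : V, z ∈ Z ∧ z ∈ B i) ∧
    (∀ z ∈ Z, ∃ i, z ∈ B i) ∧
    (∀ i j, i ≠ j → ∃ u ∈ B i, ∃ v ∈ B j, G.Adj u v)

/-- A `Z`-rooted `K*₄,₂`-model in `G`. -/
def HasRootedK42starModel {V : Type} (G : SimpleGraph V) (Z : Set V) : Prop :=
  ∃ (B : Fin 4 → Set V) (C : Fin 2 → Set V),
    (∀ i, (G.induce (B i)).Connected) ∧
    (∀ j, (G.induce (C j)).Connected) ∧
    (∀ i j, i ≠ j → Disjoint (B i) (B j)) ∧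
    (∀ i j, i ≠ j → Disjoint (C i) (C j)) ∧
    (∀ i j, Disjoint (B i) (C j)) ∧
    (∀ i, ∃! z : V, z ∈ Z ∧ z ∈ B i) ∧
    (∀ z ∈ Z, ∃ i, z ∈ B i) ∧
    (∀ i j, ∃ u ∈ B i, ∃ v ∈ C j, G.Adj u v) ∧
    (∃ u ∈ C 0, ∃ v ∈ C 1, G.Adj u v)

/-- An enemy: a `4`-connected graph with `|E(G)| ≥ 4|V(G)| - 8`, with no `K7vee`-minor,
not isomorphic to `K_{2,2,2,2}`. -/
def Enemy {V : Type} [Fintype V] (G : SimpleGraph V) : Prop :=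
  IsKConnected 4 G ∧
    4 * (Fintype.card V : ℤ) - 8 ≤ (G.edgeSet.ncard : ℤ) ∧
    ¬ IsMinor K7vee G ∧
    IsEmpty (G ≃g K2222)

/-- A minor-minimal enemy: an enemy, no minor of which, other than itself, is an enemy. -/
def MinorMinimalEnemy {V : Type} [Fintype V] (G : SimpleGraph V) : Prop :=
  Enemy G ∧ ∀ (W : Type) [Fintype W] (H : SimpleGraph W),
    IsMinor H G → Enemy H → Nonempty (H ≃g G)

/-- The simple graph obtained from `G` by contracting the edge `uv`
(`v` is merged into `u`). -/
def contractEdge {V : Type} (G : SimpleGraph V) (u v : V) :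
    SimpleGraph {x : V // x ≠ v} :=
  SimpleGraph.fromRel (fun x y => G.Adj ↑x ↑y ∨ ((x : V) = u ∧ G.Adj v ↑y))

/-- A graph is `7`-contraction-critical if its chromatic number is `7` and
every minor of it, other than itself, has chromatic number less than `7`. -/
def ContractionCritical7 {V : Type} [Fintype V] (G : SimpleGraph V) : Prop :=
  G.chromaticNumber = 7 ∧
    ∀ (W : Type) [Fintype W] (H : SimpleGraph W),
      IsMinor H G → IsEmpty (H ≃g G) → H.chromaticNumber < 7

set_option linter.unusedSectionVars false

namespace RootedK4

open scoped Classical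
open Finset Relation

section

variable {V : Type}

/-- The complete graph on the vertex set `S`. -/
def cliq (S : Finset V) : SimpleGraph V where
  Adj a b := a ≠ b ∧ a ∈ S ∧ b ∈ S
  symm := ⟨fun _ _ h => ⟨h.1.symm, h.2.2, h.2.1⟩⟩
  loopless := ⟨fun _ h => h.1 rfl⟩

/-- The complete graph on `S` with the edge `st` removed. -/
def cm (S : Finset V) (s t : V) : SimpleGraph V where
  Adj a b := a ≠ b ∧ a ∈ S ∧ b ∈ S ∧ ¬(a = s ∧ b = t) ∧ ¬(a = t ∧ b = s)
  symm := ⟨fun _ _ h => ⟨h.1.symm, h.2.2.1, h.2.1, fun h' => h.2.2.2.2 ⟨h'.2, h'.1⟩,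
    fun h' => h.2.2.2.1 ⟨h'.2, h'.1⟩⟩⟩
  loopless := ⟨fun _ h => h.1 rfl⟩

/-- The star joining `z` to the vertices of `S`. -/
def star (z : V) (S : Finset V) : SimpleGraph V where
  Adj a b := a ≠ b ∧ ((a = z ∧ b ∈ S) ∨ (b = z ∧ a ∈ S))
  symm := ⟨fun _ _ h => ⟨h.1.symm, h.2.symm⟩⟩
  loopless := ⟨fun _ h => h.1 rfl⟩

/-- The edges of `G` meeting `X`. -/
def tch (G : SimpleGraph V) (X : Finset V) : SimpleGraph V where
  Adj a b := G.Adj a b ∧ (a ∈ X ∨ b ∈ X)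
  symm := ⟨fun _ _ h => ⟨h.1.symm, h.2.symm⟩⟩
  loopless := ⟨fun _ h => h.1.ne rfl⟩

/-- The edges of `G` avoiding `X`. -/
def del (G : SimpleGraph V) (X : Finset V) : SimpleGraph V where
  Adj a b := G.Adj a b ∧ a ∉ X ∧ b ∉ X
  symm := ⟨fun _ _ h => ⟨h.1.symm, h.2.symm⟩⟩
  loopless := ⟨fun _ h => h.1.ne rfl⟩

/-- The edges of `G` with both ends in `X`. -/
def ind (G : SimpleGraph V) (X : Finset V) : SimpleGraph V where
  Adj a b := G.Adj a b ∧ a ∈ X ∧ b ∈ X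
  symm := ⟨fun _ _ h => ⟨h.1.symm, h.2.symm⟩⟩
  loopless := ⟨fun _ h => h.1.ne rfl⟩

/-- The image of `G` under a permutation of its vertices. -/
def pm (π : Equiv.Perm V) (G : SimpleGraph V) : SimpleGraph V where
  Adj a b := G.Adj (π.symm a) (π.symm b)
  symm := ⟨fun _ _ h => G.adj_symm h⟩
  loopless := ⟨fun _ h => h.ne rfl⟩

/-- The fibres of `f` are the branch sets of a model of `H` in `G`. -/
abbrev IsMM (G H : SimpleGraph V) (f : V → V) : Prop :=
  (∀ x y, f x = f y → ReflTransGen (fun p q => G.Adj p q ∧ f p = f q) x y) ∧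
    ∀ a b, H.Adj a b → ∃ x y, f x = a ∧ f y = b ∧ G.Adj x y

/-- `H` is a minor of `G` rooted at `Z`: each `z ∈ Z` lies in its own branch set. -/
def RM (Z : Finset V) (G H : SimpleGraph V) : Prop :=
  ∃ f : V → V, (∀ z ∈ Z, f z = z) ∧ IsMM G H f

theorem rtg_lift {α β : Type*} {r : α → α → Prop} {s : β → β → Prop} (f : α → β)
    (h : ∀ a b, r a b → s (f a) (f b)) {x y : α} (hxy : ReflTransGen r x y) :
    ReflTransGen s (f x) (f y) := by
  induction hxy with
  | refl => exact .refl
  | tail _ hbc ih => exact ih.tail (h _ _ hbc)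

theorem rtg_mono {α : Type*} {r s : α → α → Prop} {x y : α} (hxy : ReflTransGen r x y)
    (h : ∀ a b, r a b → s a b) : ReflTransGen s x y := rtg_lift id h hxy

theorem rtg_symm {α : Type*} {r : α → α → Prop} (h : ∀ a b, r a b → r b a) {x y : α}
    (hxy : ReflTransGen r x y) : ReflTransGen r y x := by
  induction hxy with
  | refl => exact .refl
  | tail _ hbc ih => exact .head (h _ _ hbc) ih

theorem RM.of_le {Z : Finset V} {G H : SimpleGraph V} (h : H ≤ G) : RM Z G H :=
  ⟨id, fun _ _ => rfl, fun x y e => by cases (e : x = y); exact .refl,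
    fun a b hab => ⟨a, b, rfl, rfl, h hab⟩⟩

theorem RM.mono {Z Z' : Finset V} {G G' H H' : SimpleGraph V} (h : RM Z G H) (hG : G ≤ G')
    (hH : H' ≤ H) (hZ : Z' ⊆ Z) : RM Z' G' H' := by
  obtain ⟨f, h1, h2, h3⟩ := h
  refine ⟨f, fun z hz => h1 z (hZ hz), fun x y e => ?_, fun a b hab => ?_⟩
  · exact rtg_mono (h2 x y e) fun p q hpq => ⟨hG hpq.1, hpq.2⟩
  · obtain ⟨x, y, hx, hy, hxy⟩ := h3 a b (hH hab)
    exact ⟨x, y, hx, hy, hG hxy⟩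

theorem IsMM.comp {G H K : SimpleGraph V} {f g : V → V} (h : IsMM G H f) (h' : IsMM H K g) :
    IsMM G K (fun x => g (f x)) := by
  obtain ⟨h2, h3⟩ := h
  obtain ⟨g2, g3⟩ := h'
  have key : ∀ x b, ReflTransGen (fun p q => H.Adj p q ∧ g p = g q) (f x) b → ∀ y, f y = b →
      ReflTransGen (fun p q => G.Adj p q ∧ g (f p) = g (f q)) x y := by
    have fib : ∀ x y, f x = f y → 
        ReflTransGen (fun p q => G.Adj p q ∧ g (f p) = g (f q)) x y := fun x y e =>
      rtg_mono (h2 x y e) fun p q hpq => ⟨hpq.1, by rw [hpq.2]⟩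
    intro x b hb
    induction hb with
    | refl => exact fun y hy => fib x y hy.symm
    | tail _ hcb ih =>
      intro y hy
      obtain ⟨x', y', hx', hy', hadj⟩ := h3 _ _ hcb.1
      refine (ih x' hx').trans (ReflTransGen.head ⟨hadj, ?_⟩ (fib y' y (hy'.trans hy.symm)))
      rw [hx', hy', hcb.2]
  refine ⟨fun x y e => ?_, fun a b hab => ?_⟩
  · exact key x (f y) (g2 _ _ e) y rfl
  · obtain ⟨c, d, hc, hd, hcd⟩ := g3 a b hab
    obtain ⟨x, y, hx, hy, hxy⟩ := h3 c d hcd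
    exact ⟨x, y, by simp only [hx, hc], by simp only [hy, hd], hxy⟩

theorem RM.trans {Z : Finset V} {G H K : SimpleGraph V} (h : RM Z G H) (h' : RM Z H K) :
    RM Z G K := by
  obtain ⟨f, h1, hf⟩ := h
  obtain ⟨g, g1, hg⟩ := h'
  exact ⟨_, fun z hz => by simp only [h1 z hz, g1 z hz], hf.comp hg⟩

theorem RM.sdiff_cliq {Z : Finset V} {G H : SimpleGraph V} (h : RM Z G H) :
    RM Z (G \ cliq Z) (H \ cliq Z) := by
  obtain ⟨f, h1, h2, h3⟩ := h
  refine ⟨f, h1, fun x y e => rtg_mono (h2 x y e) fun p q hpq => ⟨⟨hpq.1, fun hc => ?_⟩, hpq.2⟩,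
    fun a b hab => ?_⟩
  · have := hpq.2
    rw [h1 p hc.2.1, h1 q hc.2.2] at this
    exact hc.1 this
  · obtain ⟨x, y, hx, hy, hxy⟩ := h3 a b hab.1
    refine ⟨x, y, hx, hy, hxy, fun hc => hab.2 ?_⟩
    rw [h1 x hc.2.1] at hx
    rw [h1 y hc.2.2] at hy
    subst hx hy
    exact hc

theorem RM.perm {Z S : Finset V} {G H : SimpleGraph V} (π : Equiv.Perm V) (h : RM S G H)
    (hZ : ∀ z ∈ Z, π.symm z ∈ S) : RM Z (pm π G) (pm π H) := by
  obtain ⟨f, h1, h2, h3⟩ := h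
  refine ⟨fun x => π (f (π.symm x)), fun z hz => ?_, fun x y e => ?_, fun a b hab => ?_⟩
  · simp [h1 _ (hZ z hz)]
  · have := h2 (π.symm x) (π.symm y) (π.injective e)
    have h' := rtg_lift (s := fun p q => (pm π G).Adj p q ∧
      π (f (π.symm p)) = π (f (π.symm q))) π
      (fun p q hpq => ⟨by simpa [pm] using hpq.1, by simp [hpq.2]⟩) this
    simpa using h'
  · obtain ⟨x, y, hx, hy, hxy⟩ := h3 _ _ hab
    exact ⟨π x, π y, by simp [hx], by simp [hy], by simpa [pm] using hxy⟩

theorem RM.subst {Z S X : Finset V} {A R K : SimpleGraph V} (h : RM S A R) (hR : R ≤ cliq S)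
    (hA : ∀ a b, A.Adj a b → a ∈ X ∨ a ∈ S) (hK : ∀ a b, K.Adj a b → a ∉ X)
    (hZ : Disjoint Z X) : RM Z (K ⊔ A) (K ⊔ R) := by
  obtain ⟨f, h1, h2, h3⟩ := h
  have fX : ∀ x v, v ∈ S → (x ∈ X ∨ x ∈ S) → f x = v →
      (if x ∈ X ∧ f x ∈ S then f x else x) = v := by
    intro x v hv hx hxv
    by_cases hX : x ∈ X
    · rw [if_pos ⟨hX, hxv ▸ hv⟩, hxv]
    · rw [if_neg (fun h => hX h.1)]
      rw [← hxv, h1 x (hx.resolve_left hX)]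
  have chain : ∀ x y, f x = f y → f x ∈ S → ReflTransGen (fun p q => (K ⊔ A).Adj p q ∧
      (if p ∈ X ∧ f p ∈ S then f p else p) = (if q ∈ X ∧ f q ∈ S then f q else q)) x y := by
    intro x y e hx
    have := h2 x y e
    clear e
    induction this using ReflTransGen.head_induction_on with
    | refl => exact .refl
    | head hab _ ih =>
      refine ReflTransGen.head ⟨Or.inr hab.1, ?_⟩ (ih (hab.2 ▸ hx))
      rw [fX _ _ hx (hA _ _ hab.1) rfl, fX _ _ hx (hA _ _ hab.1.symm) hab.2.symm]
  refine ⟨fun x => if x ∈ X ∧ f x ∈ S then f x else x, fun z hz => ?_, fun x y e => ?_,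
    fun a b hab => ?_⟩
  · simp [Finset.disjoint_left.1 hZ hz]
  · by_cases hx : x ∈ X ∧ f x ∈ S <;> by_cases hy : y ∈ X ∧ f y ∈ S
    · simp only [if_pos hx, if_pos hy] at e
      exact chain x y e hx.2
    · simp only [if_pos hx, if_neg hy] at e
      exact chain x y (by rw [← e, h1 _ hx.2]) hx.2
    · simp only [if_neg hx, if_pos hy] at e
      refine chain x y (by rw [e, h1 _ hy.2]) ?_
      rw [e, h1 _ hy.2]; exact hy.2
    · simp only [if_neg hx, if_neg hy] at e
      cases e; exact .refl
  · rcases hab with hab | hab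
    · refine ⟨a, b, ?_, ?_, Or.inl hab⟩
      · simp [hK _ _ hab]
      · simp [hK _ _ hab.symm]
    · obtain ⟨x, y, hx, hy, hxy⟩ := h3 a b hab
      exact ⟨x, y, fX x a (hR hab).2.1 (hA _ _ hxy) hx, fX y b (hR hab).2.2 (hA _ _ hxy.symm) hy,
        Or.inr hxy⟩

/-- `C` is nonempty and connected in `G`. -/
def Conn (G : SimpleGraph V) (C : Finset V) : Prop :=
  C.Nonempty ∧ ∀ D ⊆ C, D.Nonempty → D ≠ C → ∃ x ∈ D, ∃ y ∈ C, y ∉ D ∧ G.Adj x y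

theorem Conn.chain {G : SimpleGraph V} {C : Finset V} (h : Conn G C) {x y : V} (hx : x ∈ C)
    (hy : y ∈ C) : ReflTransGen (fun p q => G.Adj p q ∧ p ∈ C ∧ q ∈ C) x y := by
  set D := C.filter fun y => ReflTransGen (fun p q => G.Adj p q ∧ p ∈ C ∧ q ∈ C) x y with hD
  have hDC : D = C := by
    by_contra hne
    obtain ⟨a, ha, b, hb, hbD, hab⟩ := h.2 D (filter_subset _ _)
      ⟨x, mem_filter.2 ⟨hx, .refl⟩⟩ hne
    rw [hD, mem_filter] at ha
    exact hbD (mem_filter.2 ⟨hb, ha.2.tail ⟨hab, ha.1, hb⟩⟩)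
  rw [← hDC] at hy
  exact (mem_filter.1 hy).2

theorem Conn.of_chain {G : SimpleGraph V} {C : Finset V} {z : V} (hz : z ∈ C)
    (h : ∀ x ∈ C, ReflTransGen (fun p q => G.Adj p q ∧ p ∈ C ∧ q ∈ C) z x) : Conn G C := by
  refine ⟨⟨z, hz⟩, fun D hD hne hDC => ?_⟩
  by_contra! hno
  obtain ⟨d, hd⟩ := hne
  have sy : ∀ x ∈ C, ReflTransGen (fun p q => G.Adj p q ∧ p ∈ C ∧ q ∈ C) x z := fun x hx =>
    rtg_symm (fun p q hpq => ⟨hpq.1.symm, hpq.2.2, hpq.2.1⟩) (h x hx)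
  apply hDC
  refine subset_antisymm hD fun x hx => ?_
  have := (sy d (hD hd)).trans (h x hx)
  clear hx
  induction this with
  | refl => exact hd
  | tail _ hbc ih =>
    by_contra hcD
    exact hno _ ih _ hbc.2.2 hcD hbc.1

theorem Conn.mono {G H : SimpleGraph V} {C : Finset V} (h : Conn G C)
    (hH : ∀ x ∈ C, ∀ y ∈ C, G.Adj x y → H.Adj x y) : Conn H C := by
  refine ⟨h.1, fun D hD h1 h2 => ?_⟩
  obtain ⟨x, hx, y, hy, hyD, hxy⟩ := h.2 D hD h1 h2
  exact ⟨x, hx, y, hy, hyD, hH x (hD hx) y hy hxy⟩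

theorem Conn.singleton (G : SimpleGraph V) (v : V) : Conn G {v} :=
  ⟨⟨v, mem_singleton_self v⟩, fun _ hD h1 h2 =>
    absurd ((subset_singleton_iff.1 hD).resolve_left h1.ne_empty) h2⟩

theorem Conn.union {G : SimpleGraph V} {C D : Finset V} (hC : Conn G C) (hD : Conn G D)
    {x y : V} (hx : x ∈ C) (hy : y ∈ D) (hxy : G.Adj x y) : Conn G (C ∪ D) := by
  refine Conn.of_chain (mem_union_left _ hx) fun w hw => ?_
  rcases mem_union.1 hw with hw | hw
  · exact rtg_mono (hC.chain hx hw) fun p q h =>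
      ⟨h.1, mem_union_left _ h.2.1, mem_union_left _ h.2.2⟩
  · exact .head ⟨hxy, mem_union_left _ hx, mem_union_right _ hy⟩ (rtg_mono (hD.chain hy hw)
      fun p q h => ⟨h.1, mem_union_right _ h.2.1, mem_union_right _ h.2.2⟩)

theorem Conn.insert {G : SimpleGraph V} {C : Finset V} (hC : Conn G C) {x y : V} (hx : x ∈ C)
    (hxy : G.Adj y x) : Conn G (insert y C) := by
  rw [insert_eq]
  exact (Conn.singleton G y).union hC (mem_singleton_self y) hx hxy

/-- Disjoint connected bags, one for each root, give a rooted minor. -/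
theorem RM.of_bags {Z : Finset V} {G H : SimpleGraph V} (A : V → Finset V)
    (hA : ∀ z ∈ Z, z ∈ A z) (hC : ∀ z ∈ Z, Conn G (A z))
    (hd : ∀ z ∈ Z, ∀ z' ∈ Z, ∀ x, x ∈ A z → x ∈ A z' → z = z') (hH : H ≤ cliq Z)
    (he : ∀ a b, H.Adj a b → ∃ x ∈ A a, ∃ y ∈ A b, G.Adj x y) : RM Z G H := by
  set f : V → V := fun x => if h : ∃ z ∈ Z, x ∈ A z then h.choose else x with hf
  have f1 : ∀ z ∈ Z, ∀ x ∈ A z, f x = z := by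
    intro z hz x hx
    have h : ∃ z ∈ Z, x ∈ A z := ⟨z, hz, hx⟩
    simp only [hf, dif_pos h]
    exact hd _ h.choose_spec.1 _ hz x h.choose_spec.2 hx
  have f2 : ∀ x, (f x ∈ Z ∧ x ∈ A (f x)) ∨ (f x = x ∧ ∀ z ∈ Z, x ∉ A z) := by
    intro x
    by_cases h : ∃ z ∈ Z, x ∈ A z
    · obtain ⟨z, hz, hx⟩ := h
      left; rw [f1 z hz x hx]; exact ⟨hz, hx⟩
    · right; refine ⟨by simp only [hf, dif_neg h], ?_⟩
      push Not at h; exact h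
  refine ⟨f, fun z hz => f1 z hz z (hA z hz), fun x y e => ?_, fun a b hab => ?_⟩
  · rcases f2 x with h | h
    · rcases f2 y with h' | h'
      · refine rtg_mono ((hC _ h.1).chain h.2 (e ▸ h'.2)) fun p q hpq => ⟨hpq.1, ?_⟩
        rw [f1 _ h.1 p hpq.2.1, f1 _ h.1 q hpq.2.2]
      · rw [h'.1] at e
        rw [e] at h
        exact absurd (hA y h.1) (h'.2 y h.1)
    · rcases f2 y with h' | h'
      · rw [h.1] at e
        rw [← e] at h'
        exact absurd (hA x h'.1) (h.2 x h'.1)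
      · rw [h.1, h'.1] at e; cases e; exact .refl
  · obtain ⟨x, hx, y, hy, hxy⟩ := he a b hab
    exact ⟨x, y, f1 a (hH hab).2.1 x hx, f1 b (hH hab).2.2 y hy, hxy⟩

/-- A rooted minor map onto the complete graph on four roots gives a rooted model. -/
theorem RM.hasRootedK4Model {Z : Finset V} {G : SimpleGraph V} (hZ : Z.card = 4)
    (h : RM Z G (cliq Z)) : HasRootedK4Model G (Z : Set V) := by
  obtain ⟨f, h1, h2, h3⟩ := h
  let e : Fin 4 ≃ Z := (Z.equivFinOfCardEq hZ).symm
  refine ⟨fun i => {x | f x = e i}, fun i => ?_, fun i j hij => ?_, fun i => ?_, fun z hz => ?_,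
    fun i j hij => ?_⟩
  · have he : f (e i) = e i := h1 _ (e i).2
    have : Nonempty {x | f x = e i} := ⟨⟨e i, he⟩⟩
    refine SimpleGraph.Connected.mk fun x y => ?_
    have key : ∀ y, ReflTransGen (fun p q => G.Adj p q ∧ f p = f q) x.1 y →
        ∃ hy : f y = e i, (G.induce {x | f x = e i}).Reachable x ⟨y, hy⟩ := by
      intro y hy
      induction hy with
      | refl => exact ⟨x.2, .refl _⟩
      | tail _ hbc ih =>
        obtain ⟨hb, hr⟩ := ih
        refine ⟨hbc.2 ▸ hb, hr.trans (SimpleGraph.Adj.reachable ?_)⟩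
        exact hbc.1
    have hx : f x.1 = e i := x.2
    have hy : f y.1 = e i := y.2
    obtain ⟨_, hr⟩ := key y.1 (h2 x.1 y.1 (hx.trans hy.symm))
    exact hr
  · rw [Set.disjoint_left]
    intro x hx hx'
    exact hij (e.injective (Subtype.ext (hx.symm.trans hx')))
  · refine ⟨e i, ⟨(e i).2, h1 _ (e i).2⟩, fun y hy => ?_⟩
    rw [← h1 y hy.1]; exact hy.2
  · exact ⟨e.symm ⟨z, hz⟩, by simp [h1 z hz]⟩
  · obtain ⟨x, y, hx, hy, hxy⟩ := h3 (e i) (e j)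
      ⟨fun h => hij (e.injective (Subtype.ext h)), (e i).2, (e j).2⟩
    exact ⟨x, hx, y, hy, hxy⟩

variable [Fintype V]

/-- The neighbourhood of a set of vertices. -/
noncomputable def nb (G : SimpleGraph V) (X : Finset V) : Finset V :=
  univ.filter fun y => y ∉ X ∧ ∃ x ∈ X, G.Adj x y

/-- The neighbourhood of a vertex. -/
noncomputable def nbv (G : SimpleGraph V) (v : V) : Finset V := univ.filter fun y => G.Adj v y

theorem mem_nb {G : SimpleGraph V} {X : Finset V} {y : V} :
    y ∈ nb G X ↔ y ∉ X ∧ ∃ x ∈ X, G.Adj x y := by simp [nb]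

theorem mem_nbv {G : SimpleGraph V} {v y : V} : y ∈ nbv G v ↔ G.Adj v y := by simp [nbv]

/-- The graph obtained from `G` by contracting `U` onto `z ∈ U`. -/
noncomputable def mrg (G : SimpleGraph V) (U : Finset V) (z : V) : SimpleGraph V :=
  del G U ⊔ star z (nb G U)

theorem isMM_mrg {U : Finset V} {G : SimpleGraph V} {z : V} (hU : Conn G U) (hz : z ∈ U) :
    IsMM G (mrg G U z) (fun x => if x ∈ U then z else x) := by
  refine ⟨fun x y e => ?_, fun a b hab => ?_⟩
  · by_cases h : x ∈ U <;> by_cases h' : y ∈ U <;> simp only [h, h', if_true, if_false] at e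
    · refine rtg_mono (hU.chain h h') fun p q hpq => ⟨hpq.1, ?_⟩
      simp [hpq.2.1, hpq.2.2]
    · exact absurd (e ▸ hz) h'
    · exact absurd (e ▸ hz) h
    · cases e; exact .refl
  · rcases hab with hab | ⟨hne, ⟨rfl, hb⟩ | ⟨rfl, ha⟩⟩
    · exact ⟨a, b, by simp [hab.2.1], by simp [hab.2.2], hab.1⟩
    · obtain ⟨hb, x, hx, hxb⟩ := mem_nb.1 hb
      exact ⟨x, b, by simp [hx], by simp [hb], hxb⟩
    · obtain ⟨hb, x, hx, hxb⟩ := mem_nb.1 ha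
      exact ⟨a, x, by simp [hb], by simp [hx], hxb.symm⟩

theorem RM.mrg {Z U : Finset V} {G : SimpleGraph V} {z : V} (hU : Conn G U) (hz : z ∈ U)
    (hZ : ∀ x ∈ U, x ∈ Z → x = z) : RM Z G (mrg G U z) :=
  ⟨_, fun x hx => by
    by_cases h : x ∈ U
    · rw [hZ x h hx, if_pos hz]
    · rw [if_neg h], isMM_mrg hU hz⟩

end

section

variable {V : Type} [Fintype V]

/-- The number of edges. -/
noncomputable def ed (G : SimpleGraph V) : ℕ := G.edgeSet.ncard

/-- The number of edges meeting `X`. -/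
noncomputable def rho (G : SimpleGraph V) (X : Finset V) : ℕ := ed (tch G X)

/-- The excess of the number of edges meeting `X` over `3|X|`. -/
noncomputable def dd (G : SimpleGraph V) (X : Finset V) : ℤ := rho G X - 3 * X.card

theorem ed_mono {G H : SimpleGraph V} (h : G ≤ H) : ed G ≤ ed H :=
  Set.ncard_le_ncard (edgeSet_mono h) (Set.toFinite _)

theorem ed_sup_add_inf (G H : SimpleGraph V) : ed (G ⊔ H) + ed (G ⊓ H) = ed G + ed H := by
  unfold ed
  rw [edgeSet_sup, edgeSet_inf]
  exact Set.ncard_union_add_ncard_inter _ _ (Set.toFinite _) (Set.toFinite _)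

theorem ed_bot : ed (⊥ : SimpleGraph V) = 0 := by simp [ed]

theorem ed_sup_le (G H : SimpleGraph V) : ed (G ⊔ H) ≤ ed G + ed H := by
  have := ed_sup_add_inf G H
  omega

theorem ed_sup_disj {G H : SimpleGraph V} (h : ∀ a b, G.Adj a b → ¬ H.Adj a b) :
    ed (G ⊔ H) = ed G + ed H := by
  have := ed_sup_add_inf G H
  have h0 : G ⊓ H = ⊥ := by
    ext a b
    simp only [inf_adj, bot_adj, iff_false, not_and]
    exact h a b
  rw [h0, ed_bot] at this
  exact this

theorem ed_delEdge {G H : SimpleGraph V} {u v : V} (h : G.Adj u v)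
    (hH : ∀ a b, H.Adj a b ↔ G.Adj a b ∧ ¬(a = u ∧ b = v) ∧ ¬(a = v ∧ b = u)) :
    ed H + 1 = ed G := by
  have he : H.edgeSet = G.edgeSet \ {s(u, v)} := by
    ext e
    induction e with
    | h a b =>
      simp only [mem_edgeSet, hH, Set.mem_sdiff, Set.mem_singleton_iff, Sym2.eq_iff]
      tauto
  unfold ed
  rw [he, Set.ncard_sdiff_singleton_add_one (by simpa using h) (Set.toFinite _)]

theorem ed_eq_rho_add (G : SimpleGraph V) (X : Finset V) : ed G = rho G X + ed (del G X) := by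
  rw [rho, ← ed_sup_disj (fun a b h h' => by
    rcases h.2 with h | h
    exacts [h'.2.1 h, h'.2.2 h])]
  congr 1
  ext a b
  simp only [sup_adj, tch, del]
  tauto

theorem rho_union (G : SimpleGraph V) (X Y : Finset V) :
    rho G (X ∪ Y) = rho G X + rho (del G X) Y := by
  rw [rho, rho, rho, ← ed_sup_disj (fun a b h h' => by
    rcases h.2 with h | h
    exacts [h'.1.2.1 h, h'.1.2.2 h])]
  congr 1
  ext a b
  simp only [sup_adj, tch, del, mem_union]
  tauto

theorem two_mul_ed (G : SimpleGraph V) : 2 * ed G = ∑ v, (nbv G v).card := by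
  have := G.sum_degrees_eq_twice_card_edges
  rw [ed, Set.ncard_eq_toFinset_card', ← edgeFinset]
  rw [← this]
  refine Finset.sum_congr rfl fun v _ => ?_
  rw [← card_neighborFinset_eq_degree]
  congr 1
  ext y; simp [mem_nbv]

theorem ed_star {z : V} {S : Finset V} (h : z ∉ S) : ed (star z S) = S.card := by
  have h2 := two_mul_ed (star z S)
  have h3 : ∀ v, (nbv (star z S) v).card = if v = z then S.card else if v ∈ S then 1 else 0 := by
    intro v
    split_ifs with h1 h2
    · subst h1; congr 1; ext y; simp only [mem_nbv, star]
      constructor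
      · rintro ⟨h1, ⟨-, h2⟩ | ⟨h2, -⟩⟩
        exacts [h2, absurd h2.symm h1]
      · exact fun hy => ⟨fun e => h (e ▸ hy), .inl ⟨by simp, hy⟩⟩
    · rw [card_eq_one]; refine ⟨z, ?_⟩
      ext y; simp only [mem_nbv, star, mem_singleton]
      exact ⟨fun hy => by tauto, fun hy => ⟨fun e => h1 (e.trans hy), .inr ⟨hy, h2⟩⟩⟩
    · rw [card_eq_zero]; ext y; simp only [mem_nbv, star]; simp; tauto
  rw [Finset.sum_congr rfl fun v _ => h3 v] at h2
  rw [← Finset.add_sum_erase _ _ (mem_univ z)] at h2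
  rw [if_pos rfl, Finset.sum_congr rfl (g := fun v => if v ∈ S then 1 else 0) (fun v hv => by
    rw [if_neg (ne_of_mem_erase hv)])] at h2
  rw [← Finset.sum_filter, Finset.sum_const] at h2
  have : (univ.erase z).filter (· ∈ S) = S := by
    ext y; simp; intro hy e; exact h (e ▸ hy)
  rw [this] at h2
  simp at h2; omega

theorem rho_singleton (G : SimpleGraph V) (v : V) : rho G {v} = (nbv G v).card := by
  rw [← ed_star (z := v) (by simp [mem_nbv]), rho]
  congr 1
  ext a b
  simp only [tch, star, mem_singleton, mem_nbv]
  constructor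
  · rintro ⟨h, rfl | rfl⟩
    exacts [⟨h.ne, .inl ⟨rfl, h⟩⟩, ⟨h.ne, .inr ⟨rfl, h.symm⟩⟩]
  · rintro ⟨-, ⟨rfl, h⟩ | ⟨rfl, h⟩⟩
    exacts [⟨h, .inl rfl⟩, ⟨h.symm, .inr rfl⟩]

theorem rho_empty (G : SimpleGraph V) : rho G ∅ = 0 := by
  rw [rho, ← ed_bot (V := V)]; congr 1; ext a b; simp [tch]

theorem dd_empty (G : SimpleGraph V) : dd G ∅ = 0 := by simp [dd, rho_empty]

theorem dd_singleton (G : SimpleGraph V) (v : V) : dd G {v} = (nbv G v).card - 3 := by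
  simp [dd, rho_singleton]

theorem rho_mono {G H : SimpleGraph V} {X Y : Finset V} (h : G ≤ H) (hXY : X ⊆ Y) :
    rho G X ≤ rho H Y :=
  ed_mono fun _ _ hab => ⟨h hab.1, hab.2.imp (fun h => hXY h) (fun h => hXY h)⟩

theorem dd_insert (G : SimpleGraph V) {v : V} {Y : Finset V} (hv : v ∉ Y) :
    dd G (insert v Y) = dd G Y + (nbv G v \ Y).card - 3 := by
  have h1 : insert v Y = Y ∪ {v} := by rw [insert_eq, union_comm]
  have h2 : nbv (del G Y) v = nbv G v \ Y := by
    ext y; simp [mem_nbv, del, hv]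
  rw [dd, dd, h1, rho_union, rho_singleton, h2, ← h1, card_insert_of_notMem hv]
  push_cast; ring

theorem dd_union {G : SimpleGraph V} {X Y : Finset V} (hd : Disjoint X Y)
    (h : ∀ x ∈ X, ∀ y ∈ Y, ¬ G.Adj x y) : dd G (X ∪ Y) = dd G X + dd G Y := by
  have h1 : rho (del G X) Y = rho G Y := by
    rw [rho, rho]; congr 1; ext a b
    simp only [tch, del]
    constructor
    · tauto
    · rintro ⟨hab, ha | hb⟩
      · exact ⟨⟨hab, fun h' => Finset.disjoint_left.1 hd h' ha, fun h' => h b h' a ha hab.symm⟩,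
          .inl ha⟩
      · exact ⟨⟨hab, fun h' => h a h' b hb hab, fun h' => Finset.disjoint_left.1 hd h' hb⟩, .inr hb⟩
  rw [dd, dd, dd, rho_union, h1, card_union_of_disjoint hd]
  push_cast; ring

theorem two_mul_ed_cliq (S : Finset V) : 2 * ed (cliq S) = S.card * (S.card - 1) := by
  rw [two_mul_ed]
  have : ∀ v, (nbv (cliq S) v).card = if v ∈ S then S.card - 1 else 0 := by
    intro v
    split_ifs with h
    · rw [← card_erase_of_mem h]; congr 1; ext y; simp [mem_nbv, cliq, h]; tauto
    · rw [card_eq_zero]; ext y; simp [mem_nbv, cliq, h]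
  rw [Finset.sum_congr rfl fun v _ => this v, ← Finset.sum_filter, Finset.sum_const]
  simp

theorem ed_cliq {S : Finset V} (h : S.card = 4) : ed (cliq S) = 6 := by
  have := two_mul_ed_cliq S
  rw [h] at this; omega

theorem ed_cm {S : Finset V} (h : S.card = 4) {s t : V} (hs : s ∈ S) (ht : t ∈ S) (hst : s ≠ t) :
    ed (cm S s t) = 5 := by
  have h1 := ed_cliq h
  have : ed (cm S s t) + 1 = ed (cliq S) := ed_delEdge (u := s) (v := t) ⟨hst, hs, ht⟩
    (fun a b => by simp only [cm, cliq]; tauto)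
  omega

/-- Every edge of `G` has both ends in the disjoint union of `W` and `Z`. -/
def Adm (G : SimpleGraph V) (W Z : Finset V) : Prop :=
  Disjoint W Z ∧ ∀ u v, G.Adj u v → u ∈ W ∨ u ∈ Z

/-- Every subset of `W` with at most three neighbours is sparse. -/
def Sp (G : SimpleGraph V) (W : Finset V) : Prop :=
  ∀ X ⊆ W, (nb G X).card ≤ 3 → dd G X ≤ 0

theorem Adm.del_eq {G : SimpleGraph V} {W Z : Finset V} (h : Adm G W Z) : del G W = ind G Z := by
  ext a b
  simp only [del, ind]
  constructor
  · rintro ⟨h1, h2, h3⟩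
    exact ⟨h1, (h.2 _ _ h1).resolve_left h2, (h.2 _ _ h1.symm).resolve_left h3⟩
  · rintro ⟨h1, h2, h3⟩
    exact ⟨h1, Finset.disjoint_right.1 h.1 h2, Finset.disjoint_right.1 h.1 h3⟩

theorem Adm.ed_eq {G : SimpleGraph V} {W Z : Finset V} (h : Adm G W Z) :
    (ed G : ℤ) - 3 * W.card = dd G W + ed (ind G Z) := by
  rw [ed_eq_rho_add G W, h.del_eq, dd]; push_cast; ring

theorem Adm.sum_deg {G : SimpleGraph V} {W Z : Finset V} (h : Adm G W Z) :
    2 * ed G = ∑ v ∈ W, (nbv G v).card + ∑ v ∈ Z, (nbv G v).card := by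
  rw [two_mul_ed, ← Finset.sum_union h.1]
  symm
  refine Finset.sum_subset (subset_univ _) fun v _ hv => ?_
  rw [card_eq_zero]; ext y
  simp only [mem_nbv, notMem_empty, iff_false]
  intro hy; exact hv (mem_union.2 (h.2 _ _ hy))

theorem exists_comp_of_dd {G : SimpleGraph V} (W : Finset V) (h : 1 ≤ dd G W) :
    ∃ C ⊆ W, Conn G C ∧ (∀ x ∈ C, ∀ y ∈ W, y ∉ C → ¬ G.Adj x y) ∧ 1 ≤ dd G C := by
  induction W using Finset.strongInduction with
  | H W ih =>
    by_cases hW : Conn G W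
    · exact ⟨W, subset_rfl, hW, fun x _ y hy hy' => absurd hy hy', h⟩
    have hne : W.Nonempty := by
      rw [nonempty_iff_ne_empty]; rintro rfl; rw [dd_empty] at h; omega
    simp only [Conn, hne, true_and] at hW
    push Not at hW
    obtain ⟨D, hD, hDn, hDW, hno⟩ := hW
    have hsum : dd G W = dd G D + dd G (W \ D) := by
      rw [← dd_union disjoint_sdiff, union_sdiff_of_subset hD]
      intro x hx y hy; rw [mem_sdiff] at hy; exact hno x hx y hy.1 hy.2
    by_cases h1 : 1 ≤ dd G D
    · obtain ⟨C, hC, h2, h3, h4⟩ := ih D (hD.ssubset_of_ne hDW) h1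
      refine ⟨C, hC.trans hD, h2, fun x hx y hy hyC => ?_, h4⟩
      by_cases hyD : y ∈ D
      · exact h3 x hx y hyD hyC
      · exact hno x (hC hx) y hy hyD
    · obtain ⟨C, hC, h2, h3, h4⟩ := ih (W \ D) (sdiff_ssubset hD hDn) (by omega)
      refine ⟨C, hC.trans sdiff_subset, h2, fun x hx y hy hyC hxy => ?_, h4⟩
      by_cases hyD : y ∈ D
      · have := mem_sdiff.1 (hC hx)
        exact hno y hyD x this.1 this.2 hxy.symm
      · exact h3 x hx y (mem_sdiff.2 ⟨hy, hyD⟩) hyC hxy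

theorem exists_comp (G : SimpleGraph V) {S : Finset V} {y : V} (hy : y ∈ S) :
    ∃ E ⊆ S, y ∈ E ∧ Conn G E ∧ ∀ x ∈ E, ∀ w ∈ S, w ∉ E → ¬ G.Adj x w := by
  set E := S.filter fun x => ReflTransGen (fun p q => G.Adj p q ∧ p ∈ S ∧ q ∈ S) y x with hE
  have hyE : y ∈ E := mem_filter.2 ⟨hy, .refl⟩
  refine ⟨E, filter_subset _ _, hyE, Conn.of_chain hyE fun x hx => ?_, fun x hx w hw hwE hxw => ?_⟩
  · have := (mem_filter.1 hx).2
    clear hx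
    induction this with
    | refl => exact .refl
    | tail hb hbc ih => exact ih.tail ⟨hbc.1, mem_filter.2 ⟨hbc.2.1, hb⟩,
        mem_filter.2 ⟨hbc.2.2, hb.tail hbc⟩⟩
  · have := mem_filter.1 hx
    exact hwE (mem_filter.2 ⟨hw, this.2.tail ⟨hxw, this.1, hw⟩⟩)

theorem Conn.sdiff {G : SimpleGraph V} {S E : Finset V} {p : V} (hS : Conn G S) (hp : p ∈ S)
    (hpE : p ∉ E) (h : ∀ x ∈ E, ∀ y ∈ S, y ∉ E → y ≠ p → ¬ G.Adj x y) :
    Conn G (S \ E) := by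
  refine ⟨⟨p, mem_sdiff.2 ⟨hp, hpE⟩⟩, fun D hD hDn hDS => ?_⟩
  by_cases hpD : p ∈ D
  · obtain ⟨x, hx, y, hy, hyD, hxy⟩ := hS.2 (D ∪ S ∩ E)
      (union_subset (hD.trans sdiff_subset) inter_subset_left) (hDn.mono subset_union_left) (by
        intro e; apply hDS; refine subset_antisymm hD fun x hx => ?_
        rw [mem_sdiff, ← e, mem_union, mem_inter] at hx; tauto)
    simp only [mem_union, mem_inter, not_or, not_and] at hx hyD
    have hyE : y ∉ E := hyD.2 hy
    rcases hx with hx | hx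
    · exact ⟨x, hx, y, mem_sdiff.2 ⟨hy, hyE⟩, hyD.1, hxy⟩
    · exact absurd hxy (h x hx.2 y hy hyE (fun e => hyD.1 (e ▸ hpD)))
  · obtain ⟨x, hx, y, hy, hyD, hxy⟩ := hS.2 D (hD.trans sdiff_subset) hDn (by
      rintro rfl; exact hpD hp)
    refine ⟨x, hx, y, mem_sdiff.2 ⟨hy, fun hyE => ?_⟩, hyD, hxy⟩
    have := mem_sdiff.1 (hD hx)
    exact h y hyE x this.1 this.2 (fun e => hpD (e ▸ hx)) hxy.symm

/-- The edges of `G` meeting `Y` are not affected by a replacement away from `Y`. -/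
theorem tch_replace {G R : SimpleGraph V} {X Y : Finset V} (hXY : Disjoint X Y)
    (hX : Disjoint (nb G X) Y) (hR : ∀ a b, R.Adj a b → a ∉ Y) :
    tch (del G X ⊔ R) Y = tch G Y := by
  ext a b
  simp only [tch, del, sup_adj]
  have key : ∀ a b, G.Adj a b → a ∈ Y → a ∉ X ∧ b ∉ X := fun a b hab ha =>
    ⟨Finset.disjoint_right.1 hXY ha, fun hb => Finset.disjoint_right.1 hX ha
      (mem_nb.2 ⟨Finset.disjoint_right.1 hXY ha, b, hb, hab.symm⟩)⟩
  constructor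
  · rintro ⟨h1 | h1, h2⟩
    · exact ⟨h1.1, h2⟩
    · rcases h2 with h2 | h2
      · exact absurd h2 (hR _ _ h1)
      · exact absurd h2 (hR _ _ h1.symm)
  · rintro ⟨h1, h2⟩
    refine ⟨.inl ⟨h1, ?_⟩, h2⟩
    rcases h2 with h2 | h2
    · exact key a b h1 h2
    · exact (key b a h1.symm h2).symm

theorem nb_eq_of_tch {G H : SimpleGraph V} {Y : Finset V} (h : tch G Y = tch H Y) :
    nb G Y = nb H Y := by
  ext y
  simp only [mem_nb]
  have : ∀ x ∈ Y, (G.Adj x y ↔ H.Adj x y) := by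
    intro x hx
    have : (tch G Y).Adj x y ↔ (tch H Y).Adj x y := by rw [h]
    simpa [tch, hx] using this
  constructor
  · rintro ⟨h1, x, hx, h2⟩; exact ⟨h1, x, hx, (this x hx).1 h2⟩
  · rintro ⟨h1, x, hx, h2⟩; exact ⟨h1, x, hx, (this x hx).2 h2⟩

theorem dd_eq_of_tch {G H : SimpleGraph V} {Y : Finset V} (h : tch G Y = tch H Y) :
    dd G Y = dd H Y := by
  rw [dd, dd, rho, rho, h]

end

section

variable {V : Type} [Fintype V]

/-- Some edge of `G` joins `P` to `Q`. -/
def Tw (G : SimpleGraph V) (P Q : Finset V) : Prop := ∃ x ∈ P, ∃ y ∈ Q, G.Adj x y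

theorem nb_disj {G : SimpleGraph V} {X : Finset V} : Disjoint X (nb G X) :=
  Finset.disjoint_left.2 fun _ h h' => (mem_nb.1 h').1 h

theorem Conn.tch {G : SimpleGraph V} {C Y : Finset V} (h : Conn G C) (hC : C ⊆ Y) :
    Conn (tch G Y) C := h.mono fun _ hx _ _ hxy => ⟨hxy, .inl (hC hx)⟩

/-- Three (possibly trivial) connected bags inside `Y` attached to three roots. -/
theorem RM.of_bags3 {Z Y P Q R : Finset V} {G H : SimpleGraph V} {a b c : V}
    (hab : a ≠ b) (hac : a ≠ c) (hbc : b ≠ c) (hYZ : Disjoint Y Z)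
    (hPY : P ⊆ Y) (hQY : Q ⊆ Y) (hRY : R ⊆ Y)
    (hPQ : Disjoint P Q) (hPR : Disjoint P R) (hQR : Disjoint Q R)
    (hP : P = ∅ ∨ Conn G P ∧ a ∈ nb G P) (hQ : Q = ∅ ∨ Conn G Q ∧ b ∈ nb G Q)
    (hR : R = ∅ ∨ Conn G R ∧ c ∈ nb G R) (hH : H ≤ cliq Z)
    (he : ∀ u v, H.Adj u v → ∃ s t, (s = u ∧ t = v ∨ s = v ∧ t = u) ∧
      ((s = a ∧ t ∈ nb G P) ∨ (s = b ∧ t ∈ nb G Q) ∨ (s = c ∧ t ∈ nb G R) ∨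
        (s = a ∧ t = b ∧ Tw G P Q) ∨ (s = a ∧ t = c ∧ Tw G P R) ∨
        (s = b ∧ t = c ∧ Tw G Q R))) : RM Z (tch G Y) H := by
  set B : V → Finset V := fun z => if z = a then P else if z = b then Q else
    if z = c then R else ∅ with hB
  have Ba : B a = P := by simp [hB]
  have Bb : B b = Q := by simp [hB, hab.symm]
  have Bc : B c = R := by simp [hB, hac.symm, hbc.symm]
  have Bo : ∀ z, z ≠ a → z ≠ b → z ≠ c → B z = ∅ := fun z h1 h2 h3 => by simp [hB, h1, h2, h3]
  have BY : ∀ z, B z ⊆ Y := by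
    intro z
    simp only [hB]; split_ifs <;> first | assumption | exact empty_subset _
  have BC : ∀ z, B z = ∅ ∨ Conn G (B z) ∧ z ∈ nb G (B z) := by
    intro z
    by_cases h1 : z = a
    · subst h1; rwa [Ba]
    by_cases h2 : z = b
    · subst h2; rwa [Bb]
    by_cases h3 : z = c
    · subst h3; rwa [Bc]
    exact .inl (Bo z h1 h2 h3)
  have Bd : ∀ z z' x, x ∈ B z → x ∈ B z' → z = z' := by
    intro z z' x hx hx'
    rw [Finset.disjoint_left] at hPQ hPR hQR
    simp only [hB] at hx hx'
    split_ifs at hx hx' <;> simp_all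
  have hZB : ∀ z ∈ Z, ∀ z', z ∉ B z' := fun z hz z' h => Finset.disjoint_left.1 hYZ (BY _ h) hz
  have main : ∀ s t, ((s = a ∧ t ∈ nb G P) ∨ (s = b ∧ t ∈ nb G Q) ∨ (s = c ∧ t ∈ nb G R) ∨
        (s = a ∧ t = b ∧ Tw G P Q) ∨ (s = a ∧ t = c ∧ Tw G P R) ∨
        (s = b ∧ t = c ∧ Tw G Q R)) →
        ∃ x ∈ insert s (B s), ∃ y ∈ insert t (B t), (RootedK4.tch G Y).Adj x y := by
    intro s t h
    rcases h with ⟨rfl, h⟩ | ⟨rfl, h⟩ | ⟨rfl, h⟩ | ⟨rfl, rfl, x, hx, y, hy, h⟩ |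
      ⟨rfl, rfl, x, hx, y, hy, h⟩ | ⟨rfl, rfl, x, hx, y, hy, h⟩
    · obtain ⟨-, x, hx, h⟩ := mem_nb.1 h
      exact ⟨x, by simp [Ba, hx], t, by simp, h, .inl (hPY hx)⟩
    · obtain ⟨-, x, hx, h⟩ := mem_nb.1 h
      exact ⟨x, by simp [Bb, hx], t, by simp, h, .inl (hQY hx)⟩
    · obtain ⟨-, x, hx, h⟩ := mem_nb.1 h
      exact ⟨x, by simp [Bc, hx], t, by simp, h, .inl (hRY hx)⟩
    · exact ⟨x, by simp [Ba, hx], y, by simp [Bb, hy], h, .inl (hPY hx)⟩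
    · exact ⟨x, by simp [Ba, hx], y, by simp [Bc, hy], h, .inl (hPY hx)⟩
    · exact ⟨x, by simp [Bb, hx], y, by simp [Bc, hy], h, .inl (hQY hx)⟩
  refine RM.of_bags (fun z => insert z (B z)) (fun z _ => mem_insert_self _ _)
    (fun z hz => ?_) (fun z hz z' hz' x hx hx' => ?_) hH (fun u v huv => ?_)
  · rcases BC z with h | ⟨h, h'⟩
    · rw [h]; exact Conn.singleton _ _
    · obtain ⟨-, x, hx, hxz⟩ := mem_nb.1 h'
      exact (h.tch (BY z)).insert hx ⟨hxz.symm, .inr (BY z hx)⟩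
  · rw [mem_insert] at hx hx'
    rcases hx with rfl | hx
    · rcases hx' with rfl | hx'
      · rfl
      · exact absurd hx' (hZB _ hz _)
    · rcases hx' with rfl | hx'
      · exact absurd hx (hZB _ hz' _)
      · exact Bd _ _ _ hx hx'
  · obtain ⟨s, t, ⟨rfl, rfl⟩ | ⟨rfl, rfl⟩, h⟩ := he u v huv
    · exact main s t h
    · obtain ⟨x, hx, y, hy, hxy⟩ := main s t h
      exact ⟨y, hy, x, hx, hxy.symm⟩

/-- The triangle version of `RM.of_bags3`. -/
theorem RM.triangle {Y P Q R : Finset V} {G : SimpleGraph V} {a b c : V}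
    (hab : a ≠ b) (hac : a ≠ c) (hbc : b ≠ c) (hYZ : Disjoint Y {a, b, c})
    (hPY : P ⊆ Y) (hQY : Q ⊆ Y) (hRY : R ⊆ Y)
    (hPQ : Disjoint P Q) (hPR : Disjoint P R) (hQR : Disjoint Q R)
    (hP : P = ∅ ∨ Conn G P ∧ a ∈ nb G P) (hQ : Q = ∅ ∨ Conn G Q ∧ b ∈ nb G Q)
    (hR : R = ∅ ∨ Conn G R ∧ c ∈ nb G R)
    (h1 : Tw G P Q ∨ b ∈ nb G P ∨ a ∈ nb G Q) (h2 : Tw G P R ∨ c ∈ nb G P ∨ a ∈ nb G R)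
    (h3 : Tw G Q R ∨ c ∈ nb G Q ∨ b ∈ nb G R) :
    RM {a, b, c} (tch G Y) (cliq {a, b, c}) := by
  refine RM.of_bags3 hab hac hbc hYZ hPY hQY hRY hPQ hPR hQR hP hQ hR le_rfl fun u v huv => ?_
  obtain ⟨huv, hu, hv⟩ := huv
  simp only [mem_insert, mem_singleton] at hu hv
  have k1 : ∃ s t, (s = a ∧ t = b ∨ s = b ∧ t = a) ∧
      ((s = a ∧ t ∈ nb G P) ∨ (s = b ∧ t ∈ nb G Q) ∨ (s = c ∧ t ∈ nb G R) ∨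
        (s = a ∧ t = b ∧ Tw G P Q) ∨ (s = a ∧ t = c ∧ Tw G P R) ∨
        (s = b ∧ t = c ∧ Tw G Q R)) := by
    rcases h1 with h | h | h
    exacts [⟨a, b, by simp, by simp [h]⟩, ⟨a, b, by simp, by simp [h]⟩,
      ⟨b, a, by simp, by simp [h]⟩]
  have k2 : ∃ s t, (s = a ∧ t = c ∨ s = c ∧ t = a) ∧
      ((s = a ∧ t ∈ nb G P) ∨ (s = b ∧ t ∈ nb G Q) ∨ (s = c ∧ t ∈ nb G R) ∨
        (s = a ∧ t = b ∧ Tw G P Q) ∨ (s = a ∧ t = c ∧ Tw G P R) ∨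
        (s = b ∧ t = c ∧ Tw G Q R)) := by
    rcases h2 with h | h | h
    exacts [⟨a, c, by simp, by simp [h]⟩, ⟨a, c, by simp, by simp [h]⟩,
      ⟨c, a, by simp, by simp [h]⟩]
  have k3 : ∃ s t, (s = b ∧ t = c ∨ s = c ∧ t = b) ∧
      ((s = a ∧ t ∈ nb G P) ∨ (s = b ∧ t ∈ nb G Q) ∨ (s = c ∧ t ∈ nb G R) ∨
        (s = a ∧ t = b ∧ Tw G P Q) ∨ (s = a ∧ t = c ∧ Tw G P R) ∨
        (s = b ∧ t = c ∧ Tw G Q R)) := by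
    rcases h3 with h | h | h
    exacts [⟨b, c, by simp, by simp [h]⟩, ⟨b, c, by simp, by simp [h]⟩,
      ⟨c, b, by simp, by simp [h]⟩]
  have sw : ∀ x y, (∃ s t, (s = x ∧ t = y ∨ s = y ∧ t = x) ∧
      ((s = a ∧ t ∈ nb G P) ∨ (s = b ∧ t ∈ nb G Q) ∨ (s = c ∧ t ∈ nb G R) ∨
        (s = a ∧ t = b ∧ Tw G P Q) ∨ (s = a ∧ t = c ∧ Tw G P R) ∨
        (s = b ∧ t = c ∧ Tw G Q R))) → (∃ s t, (s = y ∧ t = x ∨ s = x ∧ t = y) ∧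
      ((s = a ∧ t ∈ nb G P) ∨ (s = b ∧ t ∈ nb G Q) ∨ (s = c ∧ t ∈ nb G R) ∨
        (s = a ∧ t = b ∧ Tw G P Q) ∨ (s = a ∧ t = c ∧ Tw G P R) ∨
        (s = b ∧ t = c ∧ Tw G Q R))) := fun x y ⟨s, t, h, h'⟩ => ⟨s, t, h.symm, h'⟩
  rcases hu with rfl | rfl | rfl <;> rcases hv with rfl | rfl | rfl <;>
    first | exact absurd rfl huv | assumption | exact sw _ _ (by assumption)

theorem nb_sub_of_closed {G : SimpleGraph V} {C X : Finset V} (hC : C ⊆ X)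
    (h : ∀ x ∈ C, ∀ y ∈ X, y ∉ C → ¬ G.Adj x y) : nb G C ⊆ nb G X := by
  intro y hy
  obtain ⟨h1, x, hx, hxy⟩ := mem_nb.1 hy
  exact mem_nb.2 ⟨fun hyX => h x hx y hyX h1 hxy, x, hC hx, hxy⟩

theorem Conn.subset_of_closed {G : SimpleGraph V} {C E : Finset V} (hE : Conn G E)
    (hne : (E ∩ C).Nonempty) (h : ∀ x ∈ C, ∀ y ∈ E, y ∉ C → ¬ G.Adj x y) : E ⊆ C := by
  by_contra hEC
  obtain ⟨x, hx, y, hy, hyD, hxy⟩ := hE.2 (E ∩ C) inter_subset_left hne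
    (fun e => hEC (e ▸ inter_subset_right))
  exact h x (mem_inter.1 hx).2 y hy (fun hyC => hyD (mem_inter.2 ⟨hy, hyC⟩)) hxy

theorem nb_union {G : SimpleGraph V} {P Q : Finset V} {x : V} (h : x ∈ nb G (P ∪ Q)) :
    x ∈ nb G P ∨ x ∈ nb G Q := by
  obtain ⟨h1, y, hy, h2⟩ := mem_nb.1 h
  simp only [mem_union, not_or] at h1 hy
  exact hy.imp (fun hy => mem_nb.2 ⟨h1.1, y, hy, h2⟩) (fun hy => mem_nb.2 ⟨h1.2, y, hy, h2⟩)

set_option maxHeartbeats 1600000 in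
theorem exists_triangle {G : SimpleGraph V} {Y N : Finset V} (hN : nb G Y = N) (hY : Conn G Y)
    (hN3 : N.card = 3)
    (hF : ∀ p ∈ Y, ∃ C ⊆ Y, p ∉ C ∧ Conn G C ∧ (∀ x ∈ C, ∀ y ∈ Y, y ∉ C → y ≠ p → ¬ G.Adj x y) ∧
      2 ≤ (nb G C ∩ N).card) : RM N (tch G Y) (cliq N) := by
  have dYN : Disjoint Y N := hN ▸ nb_disj
  have tri : ∀ a b c : V, a ∈ N → b ∈ N → c ∈ N → a ≠ b → a ≠ c → b ≠ c → N = {a, b, c} := by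
    intro a b c ha hb hc hab hac hbc
    symm
    apply Finset.eq_of_subset_of_card_le
    · intro x hx; simp only [mem_insert, mem_singleton] at hx
      rcases hx with rfl | rfl | rfl <;> assumption
    · rw [hN3, card_eq_three.2 ⟨a, b, c, hab, hac, hbc, rfl⟩]
  have hex : ∃ P, P ⊆ Y ∧ Conn G P ∧ (Y \ P = ∅ ∨ Conn G (Y \ P)) ∧ 2 ≤ (nb G P ∩ N).card :=
    ⟨Y, subset_rfl, hY, .inl (by simp), by rw [hN, inter_self, hN3]; omega⟩
  obtain ⟨P, ⟨hPY, hPc, hQ, hPl⟩, hmin⟩ := exists_minimalFor_of_wellFoundedLT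
    (fun P => P ⊆ Y ∧ Conn G P ∧ (Y \ P = ∅ ∨ Conn G (Y \ P)) ∧ 2 ≤ (nb G P ∩ N).card)
    Finset.card hex
  have hmin : ∀ P', P' ⊆ Y → Conn G P' → (Y \ P' = ∅ ∨ Conn G (Y \ P')) →
      2 ≤ (nb G P' ∩ N).card → P.card ≤ P'.card := by
    intro P' h1 h2 h3 h4
    by_contra hlt
    have := hmin (j := P') ⟨h1, h2, h3, h4⟩ (by omega)
    omega
  have hsd : ∀ p ∈ Y, ∀ C : Finset V, p ∉ C → (∀ x ∈ C, ∀ y ∈ Y, y ∉ C → y ≠ p → ¬ G.Adj x y) →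
      Conn G (Y \ C) := fun p hp C hpC h => hY.sdiff hp hpC h
  rcases hQ with hQ | hQ
  · obtain ⟨p, hp⟩ := hY.1
    obtain ⟨C, hCY, hpC, hC, hcl, hl⟩ := hF p hp
    have h1 := hmin C hCY hC (.inr (hsd p hp C hpC hcl)) hl
    have h2 : Y ⊆ P := sdiff_eq_empty_iff_subset.1 hQ
    have h3 : C ⊂ Y := ⟨hCY, fun h => hpC (h hp)⟩
    have := card_lt_card h3
    have := card_le_card h2
    omega
  set Q := Y \ P with hQdef
  have hQY : Q ⊆ Y := sdiff_subset
  have dPQ : Disjoint P Q := disjoint_sdiff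
  have hPQ : P ∪ Q = Y := union_sdiff_of_subset hPY
  obtain ⟨p, hp, q, hqY, hqP, hpq⟩ := hY.2 P hPY hPc.1 (by
    rintro rfl; obtain ⟨x, hx⟩ := hQ.1; simp [hQdef] at hx)
  have hq : q ∈ Q := mem_sdiff.2 ⟨hqY, hqP⟩
  have hpQ : p ∉ Q := Finset.disjoint_left.1 dPQ hp
  have hlab : ∀ x ∈ N, x ∈ nb G P ∨ x ∈ nb G Q := by
    intro x hx; rw [← hN, ← hPQ] at hx; exact nb_union hx
  obtain ⟨C, hCY, hpC, hC, hcl, hl⟩ := hF p (hPY hp)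
  have hQC : Q ⊆ C := by
    apply hQ.subset_of_closed
    · by_contra hne
      rw [not_nonempty_iff_eq_empty] at hne
      have h1 := hmin C hCY hC (.inr (hsd p (hPY hp) C hpC hcl)) hl
      have h3 : C ⊂ P := ⟨fun x hx => by
        by_contra hxP
        have : x ∈ Q ∩ C := mem_inter.2 ⟨mem_sdiff.2 ⟨hCY hx, hxP⟩, hx⟩
        rw [hne] at this; simp at this, fun h => hpC (h hp)⟩
      have := card_lt_card h3
      omega
    · exact fun x hx y hy hyC => hcl x hx y (hQY hy) hyC (fun e => hpQ (e ▸ hy))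
  by_cases hlQ : 2 ≤ (nb G Q ∩ N).card
  · obtain ⟨b, hb⟩ : ((nb G P ∩ N) ∩ (nb G Q ∩ N)).Nonempty := by
      rw [← card_pos]
      have := card_union_add_card_inter (nb G P ∩ N) (nb G Q ∩ N)
      have h2 := card_le_card (union_subset (inter_subset_right : nb G P ∩ N ⊆ N)
        (inter_subset_right : nb G Q ∩ N ⊆ N))
      omega
    simp only [mem_inter] at hb
    obtain ⟨u, v, huv, he⟩ := card_eq_two.1 (show (N.erase b).card = 2 by
      rw [card_erase_of_mem hb.1.2, hN3])
    have hu : u ∈ N.erase b := by simp [he]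
    have hv : v ∈ N.erase b := by simp [he]
    rw [mem_erase] at hu hv
    have hP' : u ∈ nb G P ∨ v ∈ nb G P := by
      obtain ⟨w, hw, hwb⟩ := exists_mem_ne (by omega : 1 < (nb G P ∩ N).card) b
      rw [mem_inter] at hw
      have : w ∈ N.erase b := mem_erase.2 ⟨hwb, hw.2⟩
      rw [he, mem_insert, mem_singleton] at this
      rcases this with rfl | rfl
      exacts [.inl hw.1, .inr hw.1]
    have hQ' : u ∈ nb G Q ∨ v ∈ nb G Q := by
      obtain ⟨w, hw, hwb⟩ := exists_mem_ne (by omega : 1 < (nb G Q ∩ N).card) b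
      rw [mem_inter] at hw
      have : w ∈ N.erase b := mem_erase.2 ⟨hwb, hw.2⟩
      rw [he, mem_insert, mem_singleton] at this
      rcases this with rfl | rfl
      exacts [.inl hw.1, .inr hw.1]
    obtain ⟨a, c, hac, ha, hc, haN, hcN, hab, hcb⟩ : ∃ a c, a ≠ c ∧ a ∈ nb G P ∧ c ∈ nb G Q ∧
        a ∈ N ∧ c ∈ N ∧ a ≠ b ∧ c ≠ b := by
      have l1 := hlab u hu.2
      have l2 := hlab v hv.2
      by_cases h : u ∈ nb G P ∧ v ∈ nb G Q
      · exact ⟨u, v, huv, h.1, h.2, hu.2, hv.2, hu.1, hv.1⟩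
      · exact ⟨v, u, huv.symm, by tauto, by tauto, hv.2, hu.2, hv.1, hu.1⟩
    have hNe := tri a c b haN hcN hb.1.2 hac hab hcb
    rw [hNe] at dYN ⊢
    refine RM.triangle (P := P) (Q := Q) (R := ∅) hac hab hcb dYN hPY hQY (empty_subset _) dPQ
      (disjoint_empty_right _)
      (disjoint_empty_right _) (.inr ⟨hPc, ha⟩) (.inr ⟨hQ, hc⟩) (.inl rfl)
      (.inl ⟨p, hp, q, hq, hpq⟩) (.inr (.inl hb.1.1)) (.inr (.inl hb.2.1))
  have ext1 : ∀ x ∈ nb G C ∩ N, x ∉ nb G Q → ∃ E ⊆ P, p ∉ E ∧ Conn G E ∧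
      (∀ w ∈ E, ∀ z ∈ P, z ∉ E → z ≠ p → ¬ G.Adj w z) ∧ nb G E ∩ N = {x} ∧ Tw G E Q ∧
      p ∈ nb G E := by
    intro x hx hxQ
    rw [mem_inter] at hx
    obtain ⟨hxC, y, hy, hyx⟩ := mem_nb.1 hx.1
    have hxY : x ∉ Y := Finset.disjoint_right.1 dYN hx.2
    have hyP : y ∈ P := by
      by_contra hyP
      exact hxQ (mem_nb.2 ⟨fun h => hxY (hQY h), y, mem_sdiff.2 ⟨hCY hy, hyP⟩, hyx⟩)
    have hyp : y ≠ p := fun e => hpC (e ▸ hy)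
    obtain ⟨E, hE, hyE, hEc, hEcl⟩ := exists_comp G (mem_erase.2 ⟨hyp, hyP⟩)
    have hEP : E ⊆ P := hE.trans (erase_subset _ _)
    have hpE : p ∉ E := fun h => by simpa using hE h
    have hEcl' : ∀ w ∈ E, ∀ z ∈ P, z ∉ E → z ≠ p → ¬ G.Adj w z := fun w hw z hz hzE hzp =>
      hEcl w hw z (mem_erase.2 ⟨hzp, hz⟩) hzE
    have hEC : E ⊆ C := hEc.subset_of_closed ⟨y, mem_inter.2 ⟨hyE, hy⟩⟩ fun a ha b hb hbC =>
      hcl a ha b (hPY (hEP hb)) hbC fun e => hpE (e ▸ hb)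
    have hxE : x ∈ nb G E := mem_nb.2 ⟨fun h => hxY (hPY (hEP h)), y, hyE, hyx⟩
    refine ⟨E, hEP, hpE, hEc, hEcl', ?_, ?_, ?_⟩
    · have hle : ¬ 2 ≤ (nb G E ∩ N).card := by
        intro h2
        have hcon : Conn G (Y \ E) := by
          have e1 : Y \ E = (P \ E) ∪ Q := by
            ext z; simp only [mem_sdiff, mem_union, hQdef]
            constructor
            · tauto
            · rintro (h | h)
              exacts [⟨hPY h.1, h.2⟩, ⟨h.1, fun h' => h.2 (hEP h')⟩]
          rw [e1]
          exact (hPc.sdiff hp hpE hEcl').union hQ (mem_sdiff.2 ⟨hp, hpE⟩) hq hpq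
        have h1 := hmin E (hEP.trans hPY) hEc (.inr hcon) h2
        have h3 : E ⊂ P := ⟨hEP, fun h => hpE (h hp)⟩
        have := card_lt_card h3
        omega
      have hsub : {x} ⊆ nb G E ∩ N := singleton_subset_iff.2 (mem_inter.2 ⟨hxE, hx.2⟩)
      exact (Finset.eq_of_subset_of_card_le hsub (by rw [card_singleton]; omega)).symm
    · obtain ⟨a, ha, b, hb, hbE, hab⟩ := hC.2 E hEC hEc.1 (by
        rintro rfl; exact Finset.disjoint_left.1 dPQ (hEP (hQC hq)) hq)
      refine ⟨a, ha, b, ?_, hab⟩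
      by_contra hbQ
      have hbP : b ∈ P := by
        by_contra hbP; exact hbQ (mem_sdiff.2 ⟨hCY hb, hbP⟩)
      exact hEcl' a ha b hbP hbE (fun e => hpC (e ▸ hb)) hab
    · obtain ⟨a, ha, b, hb, hbE, hab⟩ := hPc.2 E hEP hEc.1 (by rintro rfl; exact hpE hp)
      have : b = p := by
        by_contra hbp; exact hEcl' a ha b hb hbE hbp hab
      subst this
      exact mem_nb.2 ⟨hbE, a, ha, hab⟩
  obtain ⟨x, hx, hxQ⟩ : ∃ x ∈ nb G C ∩ N, x ∉ nb G Q := by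
    by_contra! hno
    have := card_le_card (fun x hx => mem_inter.2 ⟨hno x hx, (mem_inter.1 hx).2⟩ :
      nb G C ∩ N ⊆ nb G Q ∩ N)
    omega
  obtain ⟨E, hEP, hpE, hEc, hEcl, hEl, ⟨e1, he1, q1, hq1, heq⟩, hpnE⟩ := ext1 x hx hxQ
  have hxE : x ∈ nb G E ∩ N := by rw [hEl]; simp
  rw [mem_inter] at hxE
  have hP1 : Conn G (P \ E) := hPc.sdiff hp hpE hEcl
  have dEQ : Disjoint E Q := dPQ.mono_left hEP
  obtain ⟨-, e2, he2, hep⟩ := mem_nb.1 hpnE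
  rcases (nb G Q ∩ N).eq_empty_or_nonempty with hQ0 | ⟨y, hy⟩
  · have hnQ : ∀ z ∈ N, z ∉ nb G Q := fun z hz hzQ => by
      have : z ∈ nb G Q ∩ N := mem_inter.2 ⟨hzQ, hz⟩
      rw [hQ0] at this; simp at this
    obtain ⟨y, hy, hyx⟩ := exists_mem_ne (by omega : 1 < (nb G C ∩ N).card) x
    obtain ⟨F, hFP, hpF, hFc, hFcl, hFl, ⟨f1, hf1, q2, hq2, hfq⟩, hpnF⟩ :=
      ext1 y hy (hnQ y (mem_inter.1 hy).2)
    have hyF : y ∈ nb G F ∩ N := by rw [hFl]; simp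
    rw [mem_inter] at hyF
    have dEF : Disjoint E F := by
      rw [disjoint_iff_inter_eq_empty]
      by_contra hne
      have hFE : F ⊆ E := hFc.subset_of_closed
        (by rw [inter_comm]; exact nonempty_iff_ne_empty.2 hne)
        fun a ha b hb hbE => hEcl a ha b (hFP hb) hbE fun e => hpF (e ▸ hb)
      have hyE : y ∈ nb G E ∩ N := by
        obtain ⟨-, w, hw, hwy⟩ := mem_nb.1 hyF.1
        exact mem_inter.2 ⟨mem_nb.2 ⟨fun h => Finset.disjoint_right.1 dYN hyF.2 (hPY (hEP h)),
          w, hFE hw, hwy⟩, hyF.2⟩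
      rw [hEl, mem_singleton] at hyE
      exact hyx hyE
    have hP2 : Conn G ((P \ E) \ F) := hP1.sdiff (mem_sdiff.2 ⟨hp, hpE⟩) hpF
      fun a ha b hb hbF hbp => hFcl a ha b (mem_sdiff.1 hb).1 hbF hbp
    obtain ⟨t, ht, htx, hty⟩ : ∃ t ∈ N, t ≠ x ∧ t ≠ y := by
      have : ((N.erase x).erase y).Nonempty := by
        rw [← card_pos, card_erase_of_mem (mem_erase.2 ⟨hyx, hyF.2⟩), card_erase_of_mem hxE.2]
        omega
      obtain ⟨t, ht⟩ := this
      simp only [mem_erase] at ht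
      exact ⟨t, ht.2.2, ht.2.1, ht.1⟩
    have htP : t ∈ nb G ((P \ E) \ F) := by
      have h1 := (hlab t ht).resolve_right (hnQ t ht)
      rw [← union_sdiff_of_subset hEP] at h1
      have h2 := (nb_union h1).resolve_left fun h => by
        have : t ∈ nb G E ∩ N := mem_inter.2 ⟨h, ht⟩
        rw [hEl, mem_singleton] at this; exact htx this
      have hF' : F ⊆ P \ E := fun z hz => mem_sdiff.2 ⟨hFP hz, Finset.disjoint_right.1 dEF hz⟩
      rw [← union_sdiff_of_subset hF'] at h2
      exact (nb_union h2).resolve_left fun h => by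
        have : t ∈ nb G F ∩ N := mem_inter.2 ⟨h, ht⟩
        rw [hFl, mem_singleton] at this; exact hty this
    have hpP2 : p ∈ (P \ E) \ F := by simp [hp, hpE, hpF]
    have hNe := tri x y t hxE.2 hyF.2 ht hyx.symm htx.symm hty.symm
    rw [hNe] at dYN ⊢
    refine RM.triangle (P := E) (Q := F ∪ Q) (R := (P \ E) \ F) hyx.symm htx.symm hty.symm dYN
      (hEP.trans hPY) (union_subset (hFP.trans hPY) hQY)
      ((sdiff_subset.trans sdiff_subset).trans hPY) (disjoint_union_right.2 ⟨dEF, dEQ⟩) ?_ ?_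
      (.inr ⟨hEc, hxE.1⟩) (.inr ⟨hFc.union hQ hf1 hq2 hfq, ?_⟩) (.inr ⟨hP2, htP⟩)
      (.inl ⟨e1, he1, q1, mem_union_right _ hq1, heq⟩) (.inl ⟨e2, he2, p, hpP2, hep⟩)
      (.inl ⟨q, mem_union_right _ hq, p, hpP2, hpq.symm⟩)
    · rw [Finset.disjoint_left]; intro z hz; simp [hz]
    · rw [disjoint_union_left]; constructor
      · rw [Finset.disjoint_left]; intro z hz; simp [hz]
      · exact (dPQ.mono_left (sdiff_subset.trans sdiff_subset)).symm
    · obtain ⟨hyF', w, hw, hwy⟩ := mem_nb.1 hyF.1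
      refine mem_nb.2 ⟨fun h => ?_, w, mem_union_left _ hw, hwy⟩
      have : y ∈ Y := union_subset (hFP.trans hPY) hQY h
      exact Finset.disjoint_left.1 dYN this (by simp)
  · have hQl : nb G Q ∩ N = {y} :=
      (Finset.eq_of_subset_of_card_le (singleton_subset_iff.2 hy)
        (by rw [card_singleton]; omega)).symm
    rw [mem_inter] at hy
    have hyx : y ≠ x := fun e => hxQ (e ▸ hy.1)
    obtain ⟨t, ht, htx, hty⟩ : ∃ t ∈ N, t ≠ x ∧ t ≠ y := by
      have : ((N.erase x).erase y).Nonempty := by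
        rw [← card_pos, card_erase_of_mem (mem_erase.2 ⟨hyx, hy.2⟩), card_erase_of_mem hxE.2]
        omega
      obtain ⟨t, ht⟩ := this
      simp only [mem_erase] at ht
      exact ⟨t, ht.2.2, ht.2.1, ht.1⟩
    have htP : t ∈ nb G (P \ E) := by
      have h1 := (hlab t ht).resolve_right fun h => by
        have : t ∈ nb G Q ∩ N := mem_inter.2 ⟨h, ht⟩
        rw [hQl, mem_singleton] at this; exact hty this
      rw [← union_sdiff_of_subset hEP] at h1
      exact (nb_union h1).resolve_left fun h => by
        have : t ∈ nb G E ∩ N := mem_inter.2 ⟨h, ht⟩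
        rw [hEl, mem_singleton] at this; exact htx this
    have hpP1 : p ∈ P \ E := mem_sdiff.2 ⟨hp, hpE⟩
    have hNe := tri x y t hxE.2 hy.2 ht hyx.symm htx.symm hty.symm
    rw [hNe] at dYN ⊢
    exact RM.triangle (P := E) (Q := Q) (R := P \ E) hyx.symm htx.symm hty.symm dYN
      (hEP.trans hPY) hQY (sdiff_subset.trans hPY) dEQ disjoint_sdiff
      (dPQ.mono_left sdiff_subset).symm
      (.inr ⟨hEc, hxE.1⟩) (.inr ⟨hQ, hy.1⟩) (.inr ⟨hP1, htP⟩)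
      (.inl ⟨e1, he1, q1, hq1, heq⟩) (.inl ⟨e2, he2, p, hpP1, hep⟩)
      (.inl ⟨q, hq, p, hpP1, hpq.symm⟩)

theorem exists_viol {G : SimpleGraph V} {W : Finset V} (h : ¬ Sp G W) :
    ∃ Y ⊆ W, Conn G Y ∧ (nb G Y).card ≤ 3 ∧ 1 ≤ dd G Y ∧
      RM (nb G Y) (tch G Y) (cliq (nb G Y)) := by
  simp only [Sp] at h
  push Not at h
  obtain ⟨X0, hX0, hc0, hd0⟩ := h
  obtain ⟨X, ⟨hXW, hXd⟩, hmin⟩ := exists_minimalFor_of_wellFoundedLT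
    (fun X => X ⊆ W ∧ 0 < dd G X) (fun X => (nb G X).card) ⟨X0, hX0, hd0⟩
  have hmin : ∀ Y, Y ⊆ W → 0 < dd G Y → (nb G X).card ≤ (nb G Y).card := by
    intro Y h1 h2
    by_contra hlt
    have := hmin (j := Y) ⟨h1, h2⟩ (by simp only; omega)
    simp only at this; omega
  obtain ⟨Y, hYX, hYc, hcl, hYd⟩ := exists_comp_of_dd (G := G) X (by omega)
  have hnY := nb_sub_of_closed hYX hcl
  have hY3 : (nb G Y).card ≤ 3 := (card_le_card hnY).trans ((hmin X0 hX0 hd0).trans hc0)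
  have hYW := hYX.trans hXW
  have hminY : ∀ Y', Y' ⊆ W → 0 < dd G Y' → (nb G Y).card ≤ (nb G Y').card :=
    fun Y' h1 h2 => (card_le_card hnY).trans (hmin Y' h1 h2)
  refine ⟨Y, hYW, hYc, hY3, hYd, ?_⟩
  by_cases h3 : (nb G Y).card = 3
  · refine exists_triangle rfl hYc h3 fun p hp => ?_
    have h1 := dd_insert G (notMem_erase p Y)
    rw [insert_erase hp] at h1
    have h2 : (nbv G p \ Y.erase p).card ≤ (nb G Y).card := card_le_card fun z hz => by
      simp only [mem_sdiff, mem_nbv, mem_erase, not_and] at hz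
      exact mem_nb.2 ⟨hz.2 hz.1.ne', p, hp, hz.1⟩
    obtain ⟨C, hCY, hC, hCcl, hCd⟩ := exists_comp_of_dd (G := G) (Y.erase p) (by omega)
    have hCY' := hCY.trans (erase_subset _ _)
    have hpC : p ∉ C := fun h => by simpa using hCY h
    refine ⟨C, hCY', hpC, hC,
      fun x hx y hy hyC hyp => hCcl x hx y (mem_erase.2 ⟨hyp, hy⟩) hyC, ?_⟩
    have h4 := hminY C (hCY'.trans hYW) (by omega)
    have h5 : nb G C ⊆ insert p (nb G C ∩ nb G Y) := by
      intro z hz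
      rw [mem_insert, mem_inter]
      by_cases hzp : z = p
      · exact .inl hzp
      · obtain ⟨h6, x, hx, hxz⟩ := mem_nb.1 hz
        exact .inr ⟨hz, mem_nb.2 ⟨fun hzY => hCcl x hx z (mem_erase.2 ⟨hzp, hzY⟩) h6 hxz,
          x, hCY' hx, hxz⟩⟩
    have := (card_le_card h5).trans (card_insert_le _ _)
    omega
  · by_cases h0 : nb G Y = ∅
    · rw [h0]
      exact RM.of_le fun a b h => absurd h.2.1 (notMem_empty _)
    obtain ⟨a, ha⟩ := nonempty_iff_ne_empty.2 h0
    have hsub : ((nb G Y).erase a).card ≤ 1 := by rw [card_erase_of_mem ha]; omega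
    refine RM.of_bags (fun z => if z = a then insert a Y else {z}) (fun z _ => ?_) (fun z hz => ?_)
      (fun z hz z' hz' x hx hx' => ?_) le_rfl (fun u v huv => ?_)
    · split_ifs with h <;> simp [h]
    · split_ifs with h
      · obtain ⟨-, x, hx, hxa⟩ := mem_nb.1 ha
        exact (hYc.tch subset_rfl).insert hx ⟨hxa.symm, .inr hx⟩
      · exact Conn.singleton _ _
    · have k1 := (mem_nb.1 hz).1
      have k2 := (mem_nb.1 hz').1
      split_ifs at hx hx' with h1 h2 h2 <;> simp only [mem_insert, mem_singleton] at hx hx'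
      · rw [h1, h2]
      · subst hx'
        exact absurd (hx.resolve_left h2) k2
      · subst hx
        exact absurd (hx'.resolve_left h1) k1
      · rw [← hx, hx']
    · obtain ⟨hne, hu, hv⟩ := huv
      have key : ∀ v, v ∈ nb G Y → v ≠ a → ∃ x ∈ insert a Y, (tch G Y).Adj x v := by
        intro v hv _
        obtain ⟨-, x, hx, hxv⟩ := mem_nb.1 hv
        exact ⟨x, mem_insert_of_mem hx, hxv, .inl hx⟩
      by_cases hua : u = a
      · have hva : v ≠ a := fun e => hne (hua.trans e.symm)
        obtain ⟨x, hx, hxv⟩ := key v hv hva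
        exact ⟨x, by rw [if_pos hua]; exact hx, v, by simp [hva], hxv⟩
      · by_cases hva : v = a
        · obtain ⟨x, hx, hxv⟩ := key u hu hua
          exact ⟨u, by simp [hua], x, by rw [if_pos hva]; exact hx, hxv.symm⟩
        · exact absurd (card_le_one.1 hsub u (mem_erase.2 ⟨hua, hu⟩) v (mem_erase.2 ⟨hva, hv⟩)) hne

end

section

variable {V : Type} [Fintype V]

theorem pm_cliq (π : Equiv.Perm V) (T : Finset V) : pm π (cliq (T.image π.symm)) = cliq T := by
  ext a b
  simp [pm, cliq]

set_option maxHeartbeats 800000 in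
/-- A form of Menger's theorem: if `W` minimises the boundary among the sets between `X` and `W`,
then the boundary of `X` can be contracted onto that of `W`. -/
theorem exists_link (n : ℕ) : ∀ (G : SimpleGraph V) (W X : Finset V), (W \ X).card = n → X ⊆ W →
    (∀ Y, X ⊆ Y → Y ⊆ W → (nb G W).card ≤ (nb G Y).card) →
    ∃ f : V → V, (∀ p, f p = p ∨ (p ∈ W ∧ p ∉ X ∧ f p ∈ nb G W)) ∧
      (∀ x y, f x = f y → ReflTransGen (fun p q => G.Adj p q ∧ f p = f q) x y) ∧
      ∀ q ∈ nb G W, ∃ s ∈ nb G X, f s = q ∧ ∀ s' ∈ nb G X, f s' = q → s' = s := by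
  induction n using Nat.strong_induction_on with
  | _ n ih =>
  intro G W X hn hXW hmin
  by_cases hY : ∃ Y, X ⊂ Y ∧ Y ⊂ W ∧ (nb G Y).card = (nb G W).card
  · obtain ⟨Y, hXY, hYW, hYc⟩ := hY
    obtain ⟨f1, a1, a2, a3⟩ := ih _ (by
      rw [← hn]; exact card_lt_card ⟨sdiff_subset_sdiff subset_rfl hXY.1, fun h => by
        obtain ⟨x, hx, hxX⟩ := exists_of_ssubset hXY
        have := h (mem_sdiff.2 ⟨hYW.1 hx, hxX⟩)
        exact (mem_sdiff.1 this).2 hx⟩) G W Y rfl hYW.1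
      (fun Y' h1 h2 => hmin Y' (hXY.1.trans h1) h2)
    obtain ⟨f2, b1, b2, b3⟩ := ih _ (by
      rw [← hn]; exact card_lt_card ⟨sdiff_subset_sdiff hYW.1 subset_rfl, fun h => by
        obtain ⟨x, hx, hxX⟩ := exists_of_ssubset hYW
        have := h (mem_sdiff.2 ⟨hx, fun h => hxX (hXY.1 h)⟩)
        exact hxX (mem_sdiff.1 this).1⟩) G Y X rfl hXY.1
      (fun Y' h1 h2 => hYc ▸ hmin Y' h1 (h2.trans hYW.1))
    have himg : ∀ s ∈ nb G Y, f1 s ∈ nb G W := by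
      choose! g g1 g2 g3 using a3
      have e : (nb G W).image g = nb G Y := by
        apply Finset.eq_of_subset_of_card_le
        · intro x hx; obtain ⟨q, hq, rfl⟩ := mem_image.1 hx; exact g1 q hq
        · rw [card_image_of_injOn, hYc]
          intro q hq q' hq' e
          rw [← g2 q hq, ← g2 q' hq', e]
      intro s hs
      rw [← e, mem_image] at hs
      obtain ⟨q, hq, rfl⟩ := hs
      rw [g2 q hq]; exact hq
    have nbW : ∀ s ∈ nb G W, s ∉ W := fun s hs => (mem_nb.1 hs).1
    have f1Y : ∀ p ∈ Y, f1 p = p := fun p hp => (a1 p).resolve_right fun h => h.2.1 hp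
    have f2Y : ∀ p, p ∉ Y → f2 p = p := fun p hp => (b1 p).resolve_right fun h => hp h.1
    have f2nb : ∀ x, f2 (f2 x) = f2 x := by
      intro x
      rcases b1 x with h | h
      · rw [h, h]
      · exact f2Y _ (mem_nb.1 h.2.2).1
    have st : ∀ p q, f1 p = f1 q → p ≠ q → p ∉ Y := by
      intro p q e hne hp
      rw [f1Y p hp] at e
      rcases a1 q with h | h
      · exact hne (e.trans h)
      · exact nbW _ h.2.2 (e ▸ hYW.1 hp)
    have ch : ∀ x, ReflTransGen (fun p q => G.Adj p q ∧ f1 (f2 p) = f1 (f2 q)) x (f2 x) :=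
      fun x => rtg_mono (b2 x (f2 x) (f2nb x).symm) fun p q h => ⟨h.1, by rw [h.2]⟩
    refine ⟨fun x => f1 (f2 x), fun p => ?_, fun x y e => ?_, fun q hq => ?_⟩
    · rcases b1 p with h | h
      · simp only [h]
        exact (a1 p).imp_right fun h' => ⟨h'.1, fun hp => h'.2.1 (hXY.1 hp), h'.2.2⟩
      · exact .inr ⟨hYW.1 h.1, h.2.1, himg _ h.2.2⟩
    · refine (ch x).trans (ReflTransGen.trans ?_ (rtg_symm (fun a b h => ⟨h.1.symm, h.2.symm⟩)
        (ch y)))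
      refine rtg_mono (a2 _ _ e) fun p q h => ⟨h.1, ?_⟩
      rw [f2Y p (st p q h.2 h.1.ne), f2Y q (st q p h.2.symm h.1.ne'), h.2]
    · obtain ⟨t, ht, htq, htu⟩ := a3 q hq
      obtain ⟨s, hs, hst, hsu⟩ := b3 t ht
      refine ⟨s, hs, by simp only [hst, htq], fun s' hs' e => hsu s' hs' (htu _ ?_ e)⟩
      dsimp only at e
      rcases b1 s' with h | h
      · rw [h] at e ⊢
        obtain ⟨-, x, hx, hxs⟩ := mem_nb.1 hs'
        refine mem_nb.2 ⟨fun hY => ?_, x, hXY.1 hx, hxs⟩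
        rw [f1Y _ hY] at e
        exact nbW q hq (e ▸ hYW.1 hY)
      · exact h.2.2
  by_cases hsub : nb G W ⊆ nb G X
  · exact ⟨id, fun p => .inl rfl, fun x y e => by cases (e : x = y); exact .refl,
      fun q hq => ⟨q, hsub hq, rfl, fun _ _ e => e⟩⟩
  obtain ⟨q, hqW, hqX⟩ := not_subset.1 hsub
  obtain ⟨hq, w, hw, hwq⟩ := mem_nb.1 hqW
  have hqX' : q ∉ X := fun h => hq (hXW h)
  have hwX : w ∉ X := fun h => hqX (mem_nb.2 ⟨hqX', w, h, hwq⟩)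
  have hwq' : w ≠ q := hwq.ne
  set W' := W.erase w with hW'
  have hXW' : X ⊆ W' := fun x hx => mem_erase.2 ⟨fun e => hwX (e ▸ hx), hXW hx⟩
  have hW'W : W' ⊂ W := erase_ssubset hw
  have hsubN : nb G W' ⊆ insert w (nb G W) := by
    intro y hy
    obtain ⟨h1, x, hx, hxy⟩ := mem_nb.1 hy
    rw [mem_insert]
    by_cases hyw : y = w
    · exact .inl hyw
    · exact .inr (mem_nb.2 ⟨fun h => h1 (mem_erase.2 ⟨hyw, h⟩), x, hW'W.1 hx, hxy⟩)
  have hwN : w ∉ nb G W := fun h => (mem_nb.1 h).1 hw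
  by_cases hWX : W' = X
  · have hXe : nb G X = (insert w (nb G W)).erase q := by
      apply Finset.eq_of_subset_of_card_le
      · rw [← hWX]; intro x hx
        exact mem_erase.2 ⟨fun e => hqX (by rw [← hWX]; exact e ▸ hx), hsubN hx⟩
      · rw [card_erase_of_mem (mem_insert_of_mem hqW), card_insert_of_notMem hwN]
        exact hmin X subset_rfl hXW
    refine ⟨fun p => if p = w then q else p, fun p => ?_, fun x y e => ?_, fun z hz => ?_⟩
    · by_cases hp : p = w
      · subst hp; exact .inr ⟨hw, hwX, by simpa using hqW⟩
      · simp [hp]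
    · have hs : ReflTransGen (fun p q' => G.Adj p q' ∧
        (if p = w then q else p) = (if q' = w then q else q')) w q :=
        .single ⟨hwq, by simp⟩
      by_cases hx : x = w <;> by_cases hy : y = w <;> simp only [hx, hy, if_true, if_false] at e ⊢
      · exact .refl
      · rw [← e]; exact hs
      · rw [e]; exact rtg_symm (fun a b h => ⟨h.1.symm, h.2.symm⟩) hs
      · rw [e]
    · by_cases hzq : z = q
      · refine ⟨w, by rw [hXe]; simp [hwq'], by simp [hzq], fun s' hs' e => ?_⟩
        dsimp only at e
        by_contra hne
        rw [if_neg hne, hzq] at e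
        exact hqX (e ▸ hs')
      · have hzw : z ≠ w := fun e => hwN (e ▸ hz)
        refine ⟨z, by rw [hXe]; simp [hzq, hz], by simp [hzw], fun s' hs' e => ?_⟩
        dsimp only at e
        split_ifs at e with h
        · exact absurd e.symm hzq
        · exact e
  have hXs : X ⊂ W' := hXW'.ssubset_of_ne (Ne.symm hWX)
  have nontight : ∀ Y, X ⊂ Y → Y ⊂ W → (nb G W).card < (nb G Y).card := fun Y h1 h2 =>
    lt_of_le_of_ne (hmin Y h1.1 h2.1) fun e => hY ⟨Y, h1, h2, e.symm⟩
  have hNe : nb G W' = insert w (nb G W) :=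
    Finset.eq_of_subset_of_card_le hsubN (by
      rw [card_insert_of_notMem hwN]; exact nontight W' hXs hW'W)
  set G' := mrg G {w, q} q with hG'
  have adj' : ∀ x y, x ≠ w → x ≠ q → (G'.Adj x y ↔ y ≠ w ∧ (y ≠ q → G.Adj x y) ∧
      (y = q → G.Adj x w ∨ G.Adj x q)) := by
    intro x y hxw hxq
    simp only [hG', mrg, del, star, sup_adj, mem_nb, mem_insert, mem_singleton]
    by_cases hyq : y = q
    · subst hyq
      simp only [hxw, hxq, hwq'.symm]
      simp only [G.adj_comm x]
      simp
      exact fun _ => ⟨fun _ => hwq'.symm, fun _ => hxq⟩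
    · by_cases hyw : y = w
      · simp [hyw, hwq', hxq]
      · simp [hyq, hyw, hxw, hxq]
  have nb' : ∀ Y ⊆ W', ∀ y, y ∈ nb G' Y ↔ y ∉ Y ∧ y ≠ w ∧ ((y ≠ q ∧ y ∈ nb G Y) ∨
      (y = q ∧ (w ∈ nb G Y ∨ q ∈ nb G Y))) := by
    intro Y hYW' y
    have hw0 : w ∉ Y := fun h => (mem_erase.1 (hYW' h)).1 rfl
    have hq0 : q ∉ Y := fun h => hq (hW'W.1 (hYW' h))
    have e : ∀ x ∈ Y, (G'.Adj x y ↔ y ≠ w ∧ (y ≠ q → G.Adj x y) ∧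
      (y = q → G.Adj x w ∨ G.Adj x q)) := fun x hx => adj' x y
        (fun e => hw0 (e ▸ hx)) (fun e => hq0 (e ▸ hx))
    simp only [mem_nb]
    constructor
    · rintro ⟨h1, x, hx, h2⟩
      rw [e x hx] at h2
      refine ⟨h1, h2.1, ?_⟩
      by_cases hyq : y = q
      · rcases h2.2.2 hyq with h | h
        · exact .inr ⟨hyq, .inl ⟨hw0, x, hx, h⟩⟩
        · exact .inr ⟨hyq, .inr ⟨hq0, x, hx, h⟩⟩
      · exact .inl ⟨hyq, h1, x, hx, h2.2.1 hyq⟩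
    · rintro ⟨h1, h2, ⟨h3, -, x, hx, h4⟩ | ⟨h3, ⟨-, x, hx, h4⟩ | ⟨-, x, hx, h4⟩⟩⟩
      · exact ⟨h1, x, hx, (e x hx).2 ⟨h2, fun _ => h4, fun h => absurd h h3⟩⟩
      · exact ⟨h1, x, hx, (e x hx).2 ⟨h2, fun h => absurd h3 h, fun _ => .inl h4⟩⟩
      · exact ⟨h1, x, hx, (e x hx).2 ⟨h2, fun h => absurd h3 h, fun _ => .inr h4⟩⟩
  have hN' : nb G' W' = nb G W := by
    ext y
    rw [nb' W' subset_rfl, hNe]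
    have h0 : y ∈ nb G W → y ∉ W' ∧ y ≠ w := fun h =>
      ⟨fun h' => (mem_nb.1 h).1 (hW'W.1 h'), fun e => hwN (e ▸ h)⟩
    simp only [mem_insert, true_or, and_true]
    by_cases hyq : y = q
    · subst hyq; simp [hqW, h0 hqW]
    · simp only [hyq, not_false_eq_true, ne_eq, true_and, or_false]
      tauto
  obtain ⟨f, c1, c2, c3⟩ := ih _ (by
      rw [← hn]; exact card_lt_card ⟨sdiff_subset_sdiff hW'W.1 subset_rfl, fun h => by
        have := h (mem_sdiff.2 ⟨hw, hwX⟩)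
        exact (mem_erase.1 (mem_sdiff.1 this).1).1 rfl⟩) G' W' X rfl hXW' (fun Y h1 h2 => by
    rw [hN']
    have hw0 : w ∉ Y := fun h => (mem_erase.1 (h2 h)).1 rfl
    have hq0 : q ∉ Y := fun h => hq (hW'W.1 (h2 h))
    by_cases hwn : w ∈ nb G Y
    · by_cases hqn : q ∈ nb G Y
      · have hXY : X ⊂ Y := h1.ssubset_of_ne (by rintro rfl; exact hqX hqn)
        have hlt := nontight Y hXY (h2.trans_ssubset hW'W)
        have : (nb G Y).erase w ⊆ nb G' Y := by
          intro y hy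
          rw [mem_erase] at hy
          refine (nb' Y h2 y).2 ⟨(mem_nb.1 hy.2).1, hy.1, ?_⟩
          by_cases hyq : y = q
          · exact .inr ⟨hyq, .inl hwn⟩
          · exact .inl ⟨hyq, hy.2⟩
        have := card_le_card this
        rw [card_erase_of_mem hwn] at this
        omega
      · have : insert q ((nb G Y).erase w) ⊆ nb G' Y := by
          intro y hy
          rw [mem_insert, mem_erase] at hy
          rcases hy with rfl | hy
          · exact (nb' Y h2 y).2 ⟨hq0, hwq'.symm, .inr ⟨rfl, .inl hwn⟩⟩
          · exact (nb' Y h2 y).2 ⟨(mem_nb.1 hy.2).1, hy.1,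
              .inl ⟨fun e => hqn (e ▸ hy.2), hy.2⟩⟩
        have := card_le_card this
        rw [card_insert_of_notMem (by simp [hqn]), card_erase_of_mem hwn] at this
        have := hmin Y h1 (h2.trans hW'W.1)
        omega
    · refine (hmin Y h1 (h2.trans hW'W.1)).trans (card_le_card fun y hy => ?_)
      refine (nb' Y h2 y).2 ⟨(mem_nb.1 hy).1, fun e => hwn (e ▸ hy), ?_⟩
      by_cases hyq : y = q
      · exact .inr ⟨hyq, .inr (hyq ▸ hy)⟩
      · exact .inl ⟨hyq, hy⟩)
  rw [hN'] at c1 c3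
  have hcU : Conn G {w, q} := (Conn.singleton G q).insert (mem_singleton_self q) hwq
  have hmm := isMM_mrg hcU (show q ∈ ({w, q} : Finset V) by simp)
  have hfib := (hmm.comp (K := ⊥) (g := f) ⟨c2, fun _ _ h => h.elim⟩).1
  have hcv : ∀ x : V, (if x ∈ ({w, q} : Finset V) then q else x) = if x = w then q else x := by
    intro x; by_cases hx : x = w <;> by_cases hx' : x = q <;> simp [hx, hx']
  simp only [hcv] at hfib
  have fq : f q = q := (c1 q).resolve_right fun h => hq (hW'W.1 h.1)
  refine ⟨fun x => f (if x = w then q else x), fun p => ?_, hfib, fun z hz => ?_⟩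
  · by_cases hp : p = w
    · subst hp; exact .inr ⟨hw, hwX, by simpa [fq] using hqW⟩
    · simp only [hp, if_false]
      exact (c1 p).imp_right fun h => ⟨hW'W.1 h.1, h.2⟩
  · obtain ⟨s, hs, hsz, hsu⟩ := c3 z hz
    have hu : ∀ s' ∈ nb G X, f (if s' = w then q else s') = z → (if s' = w then q else s') = s := by
      intro s' hs' e
      refine hsu _ ((nb' X hXW' _).2 ?_) e
      by_cases hs'w : s' = w
      · simp only [hs'w, if_true]
        exact ⟨hqX', hwq'.symm, .inr ⟨by simp, .inl (hs'w ▸ hs')⟩⟩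
      · simp only [hs'w, if_false]
        exact ⟨(mem_nb.1 hs').1, hs'w, .inl ⟨fun e => hqX (e ▸ hs'), hs'⟩⟩
    rw [nb' X hXW'] at hs
    by_cases hsq : s = q
    · have hwn : w ∈ nb G X := by tauto
      refine ⟨w, hwn, by simpa [← hsq] using hsz, fun s' hs' e => ?_⟩
      have := hu s' hs' e
      split_ifs at this with h
      · exact h
      · exact absurd hs' (by rw [this, hsq]; exact hqX)
    · refine ⟨s, by tauto, by simpa [hs.2.1] using hsz, fun s' hs' e => ?_⟩
      have := hu s' hs' e
      split_ifs at this with h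
      · exact absurd this.symm hsq
      · exact this

theorem RM.of_link {G : SimpleGraph V} {W X : Finset V} (hXW : X ⊆ W)
    (hmin : ∀ Y, X ⊆ Y → Y ⊆ W → (nb G W).card ≤ (nb G Y).card) :
    ∃ π : Equiv.Perm V, (∀ z ∈ nb G W, π.symm z ∈ nb G X) ∧
      ∀ A : SimpleGraph V, tch G W ≤ A → RM (nb G W) A (pm π (ind A (X ∪ nb G X))) := by
  obtain ⟨f, h1, h2, h3⟩ := exists_link _ G W X rfl hXW hmin
  have nbW : ∀ s ∈ nb G W, s ∉ W := fun s hs => (mem_nb.1 hs).1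
  have inj : ∀ x ∈ X ∪ nb G X, ∀ y ∈ X ∪ nb G X, f x = f y → f x ≠ x → x = y := by
    intro x hx y hy e hne
    have hx' := (h1 x).resolve_left hne
    obtain ⟨s, hs, hs', hu⟩ := h3 _ hx'.2.2
    have hxs := hu x ((mem_union.1 hx).resolve_left hx'.2.1) rfl
    have hyX : y ∉ X := by
      intro hyX
      have hy' := (h1 y).resolve_right fun h => h.2.1 hyX
      rw [hy'] at e
      exact nbW _ hx'.2.2 (e ▸ hXW hyX)
    have hys := hu y ((mem_union.1 hy).resolve_left hyX) e.symm
    rw [hxs, hys]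
  obtain ⟨π, hπ⟩ : ∃ π : Equiv.Perm V, ∀ x ∈ X ∪ nb G X, π x = f x := by
    obtain ⟨g, hg⟩ := Finset.exists_equiv_extend_of_card_eq (α := V) (t := (univ : Finset V))
      (by simp) (s := X ∪ nb G X) (f := f) (subset_univ _) (by
        intro x hx y hy e
        by_cases h : f x = x
        · by_cases h' : f y = y
          · rw [← h, e, h']
          · exact (inj y hy x hx e.symm h').symm
        · exact inj x hx y hy e h)
    exact ⟨g.trans (Equiv.subtypeUnivEquiv (by simp)), fun x hx => hg x hx⟩
  refine ⟨π, fun z hz => ?_, fun A hA => ⟨f, fun z hz => ?_, fun x y e => ?_, fun a b hab => ?_⟩⟩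
  · obtain ⟨s, hs, hsz, -⟩ := h3 z hz
    rw [← hsz, ← hπ s (mem_union_right _ hs)]
    simpa using hs
  · exact (h1 z).resolve_right fun h => nbW z hz h.1
  · refine rtg_mono (h2 x y e) fun p q h => ⟨hA ⟨h.1, ?_⟩, h.2⟩
    by_contra! hno
    rcases h1 p with hp | hp
    · rcases h1 q with hq | hq
      · exact h.1.ne (by rw [← hp, h.2, hq])
      · exact hno.2 hq.1
    · exact hno.1 hp.1
  · refine ⟨π.symm a, π.symm b, ?_, ?_, hab.1⟩
    · rw [← hπ _ hab.2.1]; simp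
    · rw [← hπ _ hab.2.2]; simp

/-- `X` together with its neighbourhood contracts to a complete graph on the neighbourhood. -/
def Rig (G : SimpleGraph V) (X : Finset V) : Prop :=
  RM (nb G X) (ind G (X ∪ nb G X)) (cliq (nb G X))

theorem Adm.nb_sub {G : SimpleGraph V} {W Z : Finset V} (h : Adm G W Z) : nb G W ⊆ Z := by
  intro y hy
  obtain ⟨h1, x, hx, hxy⟩ := mem_nb.1 hy
  exact (h.2 _ _ hxy.symm).resolve_left h1

theorem link_lemma {G : SimpleGraph V} {W Z X : Finset V} (hA : Adm G W Z) (hZ : Z.card = 4)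
    (F1 : ∀ X ⊆ W, X.Nonempty → (nb G X).card ≤ 3 → ¬ Rig G X) (hX : X ⊆ W) (hne : X.Nonempty)
    (tri : ∀ S ⊆ nb G X, S.card ≤ 3 → RM S (ind G (X ∪ nb G X)) (cliq S)) :
    ∃ π : Equiv.Perm V, (∀ z ∈ Z, π.symm z ∈ nb G X) ∧
      ∀ A : SimpleGraph V, tch G W ≤ A → RM Z A (pm π (ind A (X ∪ nb G X))) := by
  obtain ⟨Y, ⟨hXY, hYW⟩, hmin⟩ := exists_minimalFor_of_wellFoundedLT
    (fun Y => X ⊆ Y ∧ Y ⊆ W) (fun Y => (nb G Y).card) ⟨X, subset_rfl, hX⟩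
  have hmin : ∀ Y', X ⊆ Y' → Y' ⊆ W → (nb G Y).card ≤ (nb G Y').card := by
    intro Y' h1 h2
    by_contra hlt
    have := hmin (j := Y') ⟨h1, h2⟩ (by simp only; omega)
    simp only at this; omega
  by_cases h3 : (nb G Y).card ≤ 3
  · exfalso
    obtain ⟨π, p1, p2⟩ := RM.of_link hXY fun Y' h1 h2 => hmin Y' h1 (h2.trans hYW)
    have hsub : X ∪ nb G X ⊆ Y ∪ nb G Y := by
      intro x hx
      rcases mem_union.1 hx with hx | hx
      · exact mem_union_left _ (hXY hx)
      · obtain ⟨-, y, hy, hyx⟩ := mem_nb.1 hx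
        by_cases hxY : x ∈ Y
        · exact mem_union_left _ hxY
        · exact mem_union_right _ (mem_nb.2 ⟨hxY, y, hXY hy, hyx⟩)
    refine F1 Y hYW (hne.mono hXY) h3 ?_
    have key : ∀ a b, G.Adj a b → a ∈ Y → a ∈ Y ∪ nb G Y ∧ b ∈ Y ∪ nb G Y := by
      intro a b hab ha
      refine ⟨mem_union_left _ ha, ?_⟩
      by_cases hb : b ∈ Y
      · exact mem_union_left _ hb
      · exact mem_union_right _ (mem_nb.2 ⟨hb, a, ha, hab⟩)
    have q1 := p2 (ind G (Y ∪ nb G Y)) (fun a b hab => ⟨hab.1, by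
      rcases hab.2 with h | h
      · exact key a b hab.1 h
      · exact (key b a hab.1.symm h).symm⟩)
    have q2 := tri ((nb G Y).image π.symm) (by
      intro x hx; obtain ⟨z, hz, rfl⟩ := mem_image.1 hx; exact p1 z hz)
      (card_image_le.trans h3)
    have q3 := q2.perm (Z := nb G Y) π fun z hz => mem_image_of_mem _ hz
    rw [pm_cliq] at q3
    refine q1.trans (q3.mono ?_ le_rfl subset_rfl)
    exact fun a b h => ⟨⟨h.1, hsub h.2.1, hsub h.2.2⟩, h.2⟩
  · have h4 := hmin W hX subset_rfl
    have hW : nb G W = Z := Finset.eq_of_subset_of_card_le hA.nb_sub (by omega)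
    have h5 := congrArg Finset.card hW
    rw [hZ] at h5
    have := RM.of_link (G := G) hX fun Y' h1 h2 => (by have := hmin Y' h1 h2; omega)
    rwa [hW] at this

end

section

variable {V : Type} [Fintype V]

theorem Adm.nb_mem {G : SimpleGraph V} {W Z X : Finset V} (h : Adm G W Z) {y : V}
    (hy : y ∈ nb G X) : y ∈ W ∨ y ∈ Z := by
  obtain ⟨-, x, -, hxy⟩ := mem_nb.1 hy
  exact h.2 _ _ hxy.symm

theorem RM.replace {G R : SimpleGraph V} {X Z : Finset V}
    (h : RM (nb G X) (ind G (X ∪ nb G X)) R) (hR : R ≤ cliq (nb G X)) (hZ : Disjoint Z X) :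
    RM Z G (del G X ⊔ R) := by
  refine (RM.subst (K := del G X) h hR (fun a b hab => mem_union.1 hab.2.1)
    (fun a b hab => hab.2.1) hZ).mono ?_ le_rfl subset_rfl
  exact sup_le (fun a b hab => hab.1) fun a b hab => hab.1

theorem Adm.replace {G R : SimpleGraph V} {W Z X : Finset V} (h : Adm G W Z)
    (hR : R ≤ cliq (nb G X)) : Adm (del G X ⊔ R) (W \ X) Z := by
  refine ⟨h.1.mono_left sdiff_subset, fun u v huv => ?_⟩
  rcases huv with huv | huv
  · exact (h.2 u v huv.1).imp_left fun hu => mem_sdiff.2 ⟨hu, huv.2.1⟩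
  · have hu := (hR huv).2.1
    exact (h.nb_mem hu).imp_left fun h' => mem_sdiff.2 ⟨h', (mem_nb.1 hu).1⟩

/-- If the neighbours of `X` avoid `Y`, then replacing `X` does not affect `Y`. -/
theorem Sp.replace_false {G R : SimpleGraph V} {W X Y : Finset V} (h : Sp G W)
    (hR : R ≤ cliq (nb G X)) (hY : Y ⊆ W \ X) (hd : Disjoint (nb G X) Y)
    (h3 : (nb (del G X ⊔ R) Y).card ≤ 3) (h1 : 1 ≤ dd (del G X ⊔ R) Y) : False := by
  have e : tch (del G X ⊔ R) Y = tch G Y :=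
    tch_replace (disjoint_right.2 fun y hy => (mem_sdiff.1 (hY hy)).2) hd
      fun a b hab ha => disjoint_left.1 hd (hR hab).2.1 ha
  rw [nb_eq_of_tch e] at h3
  rw [dd_eq_of_tch e] at h1
  have := h Y (hY.trans sdiff_subset) h3
  omega

theorem rig_replace {G R : SimpleGraph V} {X Y N : Finset V}
    (h : RM (nb G X) (ind G (X ∪ nb G X)) R) (hR : R ≤ cliq (nb G X))
    (hN : nb (del G X ⊔ R) Y = N) (hS : nb G X ⊆ Y ∪ N)
    (hr : RM N (tch (del G X ⊔ R) Y) (cliq N)) :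
    nb G (X ∪ Y) = N ∧ Rig G (X ∪ Y) := by
  have hNX : Disjoint N X := by
    rw [← hN]
    refine disjoint_left.2 fun y hy hyX => ?_
    obtain ⟨-, x, hx, hxy | hxy⟩ := mem_nb.1 hy
    · exact hxy.2.2 hyX
    · exact (mem_nb.1 (hR hxy).2.2).1 hyX
  have e : nb G (X ∪ Y) = N := by
    ext y
    constructor
    · intro hy
      obtain ⟨h1, x, hx, hxy⟩ := mem_nb.1 hy
      rw [mem_union, not_or] at h1
      by_cases hxX : x ∈ X
      · exact (mem_union.1 (hS (mem_nb.2 ⟨h1.1, x, hxX, hxy⟩))).resolve_left h1.2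
      · rw [← hN]
        exact mem_nb.2 ⟨h1.2, x, (mem_union.1 hx).resolve_left hxX, .inl ⟨hxy, hxX, h1.1⟩⟩
    · intro hy
      have hyX := disjoint_left.1 hNX hy
      rw [← hN] at hy
      obtain ⟨h1, x, hx, hxy⟩ := mem_nb.1 hy
      have h2 : y ∉ X ∪ Y := by rw [mem_union, not_or]; exact ⟨hyX, h1⟩
      rcases hxy with hxy | hxy
      · exact mem_nb.2 ⟨h2, x, mem_union_right _ hx, hxy.1⟩
      · obtain ⟨-, z, hz, hzy⟩ := mem_nb.1 (hR hxy).2.2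
        exact mem_nb.2 ⟨h2, z, mem_union_left _ hz, hzy⟩
  refine ⟨e, ?_⟩
  unfold Rig
  rw [e]
  have h1 := RM.subst (Z := N) (K := ind (del G X) (Y ∪ N)) h hR
    (fun a b hab => mem_union.1 hab.2.1) (fun a b hab => hab.1.2.1) hNX
  refine (h1.trans (hr.mono ?_ le_rfl subset_rfl)).mono ?_ le_rfl subset_rfl
  · rintro a b ⟨hab | hab, h2⟩
    · left
      refine ⟨hab, ?_⟩
      have key : ∀ a b, (del G X).Adj a b → a ∈ Y → a ∈ Y ∪ N ∧ b ∈ Y ∪ N := fun a b hab ha => by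
        refine ⟨mem_union_left _ ha, ?_⟩
        by_cases hb : b ∈ Y
        · exact mem_union_left _ hb
        · exact mem_union_right _ (by rw [← hN]; exact mem_nb.2 ⟨hb, a, ha, .inl hab⟩)
      rcases h2 with h2 | h2
      · exact key a b hab h2
      · exact (key b a hab.symm h2).symm
    · exact .inr hab
  · have h2 : Y ∪ N ⊆ X ∪ Y ∪ N := by
      rw [union_assoc]; exact subset_union_right
    have h3 : X ∪ nb G X ⊆ X ∪ Y ∪ N :=
      union_subset (by rw [union_assoc]; exact subset_union_left) (hS.trans h2)
    rintro a b (hab | hab)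
    · exact ⟨hab.1.1, h2 hab.2.1, h2 hab.2.2⟩
    · exact ⟨hab.1, h3 hab.2.1, h3 hab.2.2⟩

/-- The set-up of a minimal counterexample: `G` has the prescribed excess `θ` but not the property
`P`, whereas all smaller graphs of that excess have it. -/
structure Crit (θ : ℤ) (P : SimpleGraph V → Prop) (K G : SimpleGraph V) (W Z : Finset V) :
    Prop where
  adm : Adm G W Z
  hZ : Z.card = 4
  sp : Sp G W
  hK : K ≤ G
  hKZ : K ≤ cliq Z
  hE : θ ≤ ed G - 3 * (W.card : ℤ)
  hZθ : (ed (ind G Z) : ℤ) < θ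
  hP : ¬ P G
  pull : ∀ G', RM Z G G' → P G' → P G
  ih : ∀ G' W', (W'.card < W.card ∨ W'.card = W.card ∧ ed G' < ed G) → Adm G' W' Z → Sp G' W' →
    K ≤ G' → θ ≤ ed G' - 3 * (W'.card : ℤ) → P G'

variable {θ : ℤ} {P : SimpleGraph V → Prop} {K G : SimpleGraph V} {W Z : Finset V}

theorem Crit.viol (c : Crit θ P K G W Z) {G' : SimpleGraph V} {W' : Finset V}
    (hlt : W'.card < W.card ∨ W'.card = W.card ∧ ed G' < ed G) (hA : Adm G' W' Z) (hK : K ≤ G')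
    (hE : θ ≤ ed G' - 3 * (W'.card : ℤ)) (hr : RM Z G G') :
    ∃ Y ⊆ W', Conn G' Y ∧ (nb G' Y).card ≤ 3 ∧ 1 ≤ dd G' Y ∧
      RM (nb G' Y) (tch G' Y) (cliq (nb G' Y)) := by
  by_cases hs : Sp G' W'
  · exact absurd (c.pull G' hr (c.ih G' W' hlt hA hs hK hE)) c.hP
  · exact exists_viol hs

theorem Crit.hK_del (c : Crit θ P K G W Z) {X : Finset V} (hX : X ⊆ W) : K ≤ del G X :=
  fun _ _ h => ⟨c.hK h, fun hx => disjoint_left.1 c.adm.1 (hX hx) (c.hKZ h).2.1,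
    fun hx => disjoint_left.1 c.adm.1 (hX hx) (c.hKZ h).2.2⟩

theorem Crit.not_rig (c : Crit θ P K G W Z) {X : Finset V} (hX : X ⊆ W) (hne : X.Nonempty)
    (h3 : (nb G X).card ≤ 3) : ¬ Rig G X := by
  intro hr
  obtain ⟨X, ⟨hX, hne, h3, hr⟩, hmax⟩ := (Set.toFinite {X : Finset V | X ⊆ W ∧ X.Nonempty ∧
    (nb G X).card ≤ 3 ∧ Rig G X}).exists_maximalFor (fun X => X.card) _ ⟨X, hX, hne, h3, hr⟩
  have hlt : (W \ X).card < W.card := card_lt_card ⟨sdiff_subset, fun h => by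
    obtain ⟨x, hx⟩ := hne
    exact (mem_sdiff.1 (h (hX hx))).2 hx⟩
  have hdX := c.sp X hX h3
  have h1 := ed_eq_rho_add G X
  have h2 := ed_mono (show del G X ≤ del G X ⊔ cliq (nb G X) from le_sup_left)
  have h4 := card_sdiff_add_card_eq_card hX
  obtain ⟨Y, hY, hYc, hY3, hY1, hYr⟩ := c.viol (.inl hlt) (c.adm.replace le_rfl)
    ((c.hK_del hX).trans le_sup_left) (by have := c.hE; unfold dd at hdX; omega)
    (RM.replace hr le_rfl (c.adm.1.symm.mono_right hX))
  have hXY : Disjoint X Y := disjoint_right.2 fun y hy => (mem_sdiff.1 (hY hy)).2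
  by_cases hd : Disjoint (nb G X) Y
  · exact c.sp.replace_false le_rfl hY hd hY3 hY1
  obtain ⟨s, hs, hsY⟩ := not_disjoint_iff.1 hd
  obtain ⟨e1, e2⟩ := rig_replace hr le_rfl rfl (fun t ht => by
    by_cases htY : t ∈ Y
    · exact mem_union_left _ htY
    · exact mem_union_right _ (mem_nb.2 ⟨htY, s, hsY,
        .inr ⟨fun e => htY (e ▸ hsY), hs, ht⟩⟩)) hYr
  have := hmax (j := X ∪ Y) ⟨union_subset hX (hY.trans sdiff_subset),
    hne.mono subset_union_left, by rw [e1]; exact hY3, e2⟩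
    (card_le_card subset_union_left)
  simp only [card_union_of_disjoint hXY] at this
  have := card_pos.2 ⟨s, hsY⟩
  omega

end

section

variable {V : Type} [Fintype V]
variable {θ : ℤ} {P : SimpleGraph V → Prop} {K G : SimpleGraph V} {W Z : Finset V}

/-- A connected proper subset of `W` with at least two vertices and exactly four neighbours. -/
def Cut (G : SimpleGraph V) (W X : Finset V) : Prop :=
  X ⊆ W ∧ X ≠ W ∧ Conn G X ∧ (nb G X).card = 4 ∧ 2 ≤ X.card

theorem Cut.exists_max {X : Finset V} (h : Cut G W X) :
    ∃ X, Cut G W X ∧ ∀ X', X ⊂ X' → ¬ Cut G W X' := by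
  obtain ⟨X, hX, hmax⟩ := (Set.toFinite {X : Finset V | Cut G W X}).exists_maximal ⟨X, h⟩
  exact ⟨X, hX, fun X' hlt hX' => hlt.2 (hmax hX' hlt.1)⟩

theorem dd_insert_le (G : SimpleGraph V) {v : V} {Y N : Finset V} (hv : v ∉ Y)
    (hN : ∀ y, G.Adj v y → y ∉ Y → y ∈ N) : dd G (insert v Y) ≤ dd G Y + N.card - 3 := by
  rw [dd_insert G hv]
  have : (nbv G v \ Y).card ≤ N.card := card_le_card fun y hy => by
    rw [mem_sdiff, mem_nbv] at hy
    exact hN y hy.1 hy.2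
  omega

/-- The part of a set `Y` away from the boundary of `X`. -/
theorem nb_sdiff_sub {G G' : SimpleGraph V} {X Y : Finset V} (hXY : Disjoint X Y)
    (hG : del G X ≤ G') : nb G (Y \ nb G X) ⊆ (Y ∩ nb G X) ∪ (nb G' Y \ X) := by
  intro y hy
  obtain ⟨h1, x, hx, hxy⟩ := mem_nb.1 hy
  rw [mem_sdiff] at hx
  have hxX : x ∉ X := disjoint_right.1 hXY hx.1
  have hyX : y ∉ X := fun h => hx.2 (mem_nb.2 ⟨hxX, y, h, hxy.symm⟩)
  by_cases hyY : y ∈ Y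
  · exact mem_union_left _ (mem_inter.2 ⟨hyY, by
      by_contra h; exact h1 (mem_sdiff.2 ⟨hyY, h⟩)⟩)
  · exact mem_union_right _ (mem_sdiff.2 ⟨mem_nb.2 ⟨hyY, x, hx.1, hG ⟨hxy, hxX, hyX⟩⟩, hyX⟩)

theorem dd_replace_sdiff {G R : SimpleGraph V} {X Y : Finset V} (hXY : Disjoint X Y)
    (hR : ∀ a b, R.Adj a b → a ∈ Y → a ∈ nb G X) :
    dd (del G X ⊔ R) (Y \ nb G X) = dd G (Y \ nb G X) :=
  dd_eq_of_tch (tch_replace (hXY.mono_right sdiff_subset) disjoint_sdiff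
    fun a b hab ha => (mem_sdiff.1 ha).2 (hR a b hab (mem_sdiff.1 ha).1))

/-- If `Y` meets the boundary of `X` in one vertex, it is not a violator after replacing `X`. -/
theorem Sp.dd_one {R : SimpleGraph V} {X Y : Finset V} {s : V} (h : Sp G W) (hYW : Y ⊆ W)
    (hXY : Disjoint X Y) (hR : ∀ a b, R.Adj a b → a ∈ Y → a ∈ nb G X)
    (h3 : (nb (del G X ⊔ R) Y).card ≤ 3) (hT : Y ∩ nb G X = {s})
    (h2 : (nb (del G X ⊔ R) Y \ X).card ≤ 2) : dd (del G X ⊔ R) Y ≤ 0 := by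
  have hs : s ∈ Y ∩ nb G X := hT ▸ mem_singleton_self s
  have e : insert s (Y \ nb G X) = Y := by
    rw [insert_eq, ← hT, union_comm, sdiff_union_inter]
  have h0 : (nb G (Y \ nb G X)).card ≤ 3 := by
    have h4 := card_le_card (nb_sdiff_sub hXY (show del G X ≤ del G X ⊔ R from le_sup_left))
    have h5 := card_union_le (Y ∩ nb G X) (nb (del G X ⊔ R) Y \ X)
    rw [hT, card_singleton] at h5
    rw [hT] at h4
    omega
  have h1 := h _ (sdiff_subset.trans hYW) h0
  rw [← dd_replace_sdiff hXY hR] at h1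
  have h4 := dd_insert_le (del G X ⊔ R) (v := s) (Y := Y \ nb G X)
    (N := nb (del G X ⊔ R) Y) (fun h' => (mem_sdiff.1 h').2 (mem_inter.1 hs).2) (fun y hy hyY =>
      mem_nb.2 ⟨fun hy' => by
        rcases mem_insert.1 (show y ∈ insert s (Y \ nb G X) by rw [e]; exact hy') with rfl | h'
        · exact hy.ne rfl
        · exact hyY h', s, (mem_inter.1 hs).1, hy⟩)
  rw [e] at h4
  omega

theorem Sp.dd_two {R : SimpleGraph V} {X Y : Finset V} (h : Sp G W) (hYW : Y ⊆ W)
    (hXY : Disjoint X Y) (hR : ∀ a b, R.Adj a b → a ∈ Y → a ∈ nb G X)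
    (h3 : (nb (del G X ⊔ R) Y).card ≤ 2) (hT : (Y ∩ nb G X).card = 2)
    (h2 : (nb (del G X ⊔ R) Y \ X).card ≤ 1) : dd (del G X ⊔ R) Y ≤ 0 := by
  obtain ⟨s, t, hst, hT⟩ := card_eq_two.1 hT
  have hs : s ∈ Y ∩ nb G X := hT ▸ mem_insert_self s _
  have ht : t ∈ Y ∩ nb G X := hT ▸ mem_insert_of_mem (mem_singleton_self t)
  have e : insert s (insert t (Y \ nb G X)) = Y := by
    rw [insert_eq, insert_eq, ← union_assoc, ← insert_eq, ← hT, union_comm, sdiff_union_inter]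
  have h0 : (nb G (Y \ nb G X)).card ≤ 3 := by
    have h4 := card_le_card (nb_sdiff_sub hXY (show del G X ≤ del G X ⊔ R from le_sup_left))
    have h5 := card_union_le (Y ∩ nb G X) (nb (del G X ⊔ R) Y \ X)
    rw [hT, card_pair hst] at h5
    rw [hT] at h4
    omega
  have h1 := h _ (sdiff_subset.trans hYW) h0
  rw [← dd_replace_sdiff hXY hR] at h1
  have key : ∀ y, y ∈ Y → y = s ∨ y = t ∨ y ∈ Y \ nb G X := fun y hy => by
    rw [← e, mem_insert, mem_insert] at hy; exact hy
  have h4 := dd_insert_le (del G X ⊔ R) (v := t) (Y := Y \ nb G X)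
    (N := insert s (nb (del G X ⊔ R) Y)) (fun h' => (mem_sdiff.1 h').2 (mem_inter.1 ht).2)
    (fun y hy hyY => by
      rw [mem_insert]
      by_cases hys : y = s
      · exact .inl hys
      · refine .inr (mem_nb.2 ⟨fun hy' => ?_, t, (mem_inter.1 ht).1, hy⟩)
        rcases key y hy' with h | rfl | h
        exacts [hys h, hy.ne rfl, hyY h])
  have h5 := dd_insert_le (del G X ⊔ R) (v := s) (Y := insert t (Y \ nb G X))
    (N := nb (del G X ⊔ R) Y) (fun h' => (mem_insert.1 h').elim hst
      fun h' => (mem_sdiff.1 h').2 (mem_inter.1 hs).2) (fun y hy hyY => by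
      refine mem_nb.2 ⟨fun hy' => ?_, s, (mem_inter.1 hs).1, hy⟩
      rw [mem_insert, not_or] at hyY
      rcases key y hy' with rfl | h | h
      exacts [hy.ne rfl, hyY.1 h, hyY.2 h])
  rw [e] at h5
  have := card_insert_le s (nb (del G X ⊔ R) Y)
  omega

theorem tch_le_mrg {X Y M : Finset V} {w : V} (hw : w ∈ X) (hXY : ∀ y ∈ Y, y ∈ X → y = w)
    (hM : ∀ y ∈ nb (mrg G X w) Y, y ≠ w → y ∈ M) :
    tch (mrg G X w) Y ≤ mrg (ind G (X ∪ Y ∪ M)) X w := by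
  have hsub : ∀ a b, (mrg G X w).Adj a b → a ∈ Y → b ≠ w → b ∈ X ∪ Y ∪ M := by
    intro a b hab ha hb
    by_cases hbY : b ∈ Y
    · exact mem_union_left _ (mem_union_right _ hbY)
    · exact mem_union_right _ (hM b (mem_nb.2 ⟨hbY, a, ha, hab⟩) hb)
  have hnb : ∀ b, b ∈ nb G X → b ∈ X ∪ Y ∪ M → b ∈ nb (ind G (X ∪ Y ∪ M)) X := by
    intro b hb hb'
    obtain ⟨h1, x, hx, hxb⟩ := mem_nb.1 hb
    exact mem_nb.2 ⟨h1, x, hx, hxb, mem_union_left _ (mem_union_left _ hx), hb'⟩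
  have key : ∀ a b, (mrg G X w).Adj a b → a ∈ Y → (mrg (ind G (X ∪ Y ∪ M)) X w).Adj a b := by
    intro a b hab ha
    rcases id hab with h | ⟨hne, ⟨rfl, hb⟩ | ⟨rfl, ha'⟩⟩
    · exact .inl ⟨⟨h.1, mem_union_left _ (mem_union_right _ ha),
        hsub a b hab ha fun e => h.2.2 (e ▸ hw)⟩, h.2⟩
    · exact .inr ⟨hne, .inl ⟨rfl, hnb b hb (hsub a b hab ha hne.symm)⟩⟩
    · exact .inr ⟨hne, .inr ⟨rfl, hnb a ha' (mem_union_left _ (mem_union_right _ ha))⟩⟩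
  rintro a b ⟨hab, h | h⟩
  · exact key a b hab h
  · exact (key b a hab.symm h).symm

theorem Conn.ind (h : Conn G W) {U : Finset V} (hU : W ⊆ U) : Conn (ind G U) W :=
  h.mono fun _ hx _ hy hxy => ⟨hxy, hU hx, hU hy⟩

/-- Transfer of a complete minor on the boundary when `X` has been contracted to `w`. -/
theorem rig_of_mrg {X Y M : Finset V} {w : V} (hX : Conn G X) (hw : w ∈ X)
    (hXY : ∀ y ∈ Y, y ∈ X → y = w) (hMX : Disjoint M X)
    (hM : ∀ y ∈ nb (mrg G X w) Y, y ≠ w → y ∈ M) (hMN : M ⊆ nb (mrg G X w) Y)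
    (hr : RM (nb (mrg G X w) Y) (tch (mrg G X w) Y) (cliq (nb (mrg G X w) Y))) :
    RM M (ind G (X ∪ Y ∪ M)) (cliq M) := by
  refine (RM.mrg (hX.ind ?_) hw fun x hx hxM => absurd hx (disjoint_left.1 hMX hxM)).trans
    (hr.mono (tch_le_mrg hw hXY hM) (fun a b h => ⟨h.1, hMN h.2.1, hMN h.2.2⟩) hMN)
  rw [union_assoc]; exact subset_union_left

theorem rig_of_mrg_swap {X Y M : Finset V} {w u : V} (hX : Conn G X) (hw : w ∈ X)
    (hXY : Disjoint X Y) (hMX : Disjoint M X) (huS : u ∈ nb G X) (huY : u ∉ Y)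
    (huN : u ∉ nb (mrg G X w) Y) (hwN : w ∈ nb (mrg G X w) Y)
    (hM : ∀ y, y ∈ M ↔ y = u ∨ y ∈ nb (mrg G X w) Y ∧ y ≠ w)
    (hr : RM (nb (mrg G X w) Y) (tch (mrg G X w) Y) (cliq (nb (mrg G X w) Y))) :
    RM M (ind G (X ∪ Y ∪ M)) (cliq M) := by
  obtain ⟨huX, x0, hx0, hxu⟩ := mem_nb.1 huS
  have hwu : w ≠ u := fun e => huX (e ▸ hw)
  have hXU : X ⊆ X ∪ Y ∪ M := by rw [union_assoc]; exact subset_union_left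
  have huU : u ∈ X ∪ Y ∪ M := mem_union_right _ ((hM u).2 (.inl rfl))
  set H := ind G (X ∪ Y ∪ M) with hH
  have hc : Conn H (insert u X) := (hX.ind hXU).insert hx0 ⟨hxu.symm, huU, hXU hx0⟩
  have hN : ∀ z ∈ M, (Equiv.swap u w).symm z ∈ nb (mrg G X w) Y := by
    intro z hz
    rw [Equiv.symm_swap]
    rcases (hM z).1 hz with rfl | h
    · rw [Equiv.swap_apply_left]; exact hwN
    · rw [Equiv.swap_apply_of_ne_of_ne (fun e : z = u => huN (e ▸ h.1)) h.2]; exact h.1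
  have hN' : ∀ a ∈ M.image (Equiv.swap u w).symm, a ∈ nb (mrg G X w) Y := fun a ha => by
    obtain ⟨z, hz, e⟩ := mem_image.1 ha
    exact e ▸ hN z hz
  have q := (hr.mono le_rfl (show cliq (M.image (Equiv.swap u w).symm) ≤ _ from fun a b h =>
    ⟨h.1, hN' a h.2.1, hN' b h.2.2⟩) subset_rfl).perm (Z := M) (Equiv.swap u w) hN
  · rw [pm_cliq] at q
    refine (RM.mrg hc (mem_insert_self u X) fun x hx hxM => (mem_insert.1 hx).resolve_right
      fun h => disjoint_left.1 hMX hxM h).trans (q.mono ?_ le_rfl subset_rfl)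
    have key : ∀ a b, (mrg G X w).Adj a b → a ∈ Y → (mrg H (insert u X) u).Adj
        (Equiv.swap u w a) (Equiv.swap u w b) := by
      intro a b hab ha
      have hau : a ≠ u := fun e => huY (e ▸ ha)
      have haX : a ∉ X := disjoint_right.1 hXY ha
      have haw : a ≠ w := fun e => haX (e ▸ hw)
      have haU : a ∈ X ∪ Y ∪ M := mem_union_left _ (mem_union_right _ ha)
      have hai : a ∉ insert u X := fun h => (mem_insert.1 h).elim hau haX
      have hbu : b ≠ u := fun e => huN (mem_nb.2 ⟨huY, a, ha, e ▸ hab⟩)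
      rw [Equiv.swap_apply_of_ne_of_ne hau haw]
      by_cases hbw : b = w
      · rw [hbw, Equiv.swap_apply_right]
        have haS : a ∈ nb G X := by
          rcases hab with h | ⟨-, h | h⟩
          · exact absurd hw (hbw ▸ h.2.2)
          · exact absurd h.1 haw
          · exact h.2
        obtain ⟨-, x, hx, hxa⟩ := mem_nb.1 haS
        exact .inr ⟨hau, .inr ⟨rfl, mem_nb.2 ⟨hai, x, mem_insert_of_mem hx, hxa, hXU hx, haU⟩⟩⟩
      · rw [Equiv.swap_apply_of_ne_of_ne hbu hbw]
        rcases id hab with h | ⟨-, h | h⟩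
        · refine .inl ⟨⟨h.1, haU, ?_⟩, hai, fun h' => (mem_insert.1 h').elim hbu h.2.2⟩
          by_cases hbY : b ∈ Y
          · exact mem_union_left _ (mem_union_right _ hbY)
          · exact mem_union_right _ ((hM b).2 (.inr ⟨mem_nb.2 ⟨hbY, a, ha, hab⟩, hbw⟩))
        · exact absurd h.1 haw
        · exact absurd h.1 hbw
    have key' : ∀ a b, (tch (mrg G X w) Y).Adj a b → (mrg H (insert u X) u).Adj
        (Equiv.swap u w a) (Equiv.swap u w b) := by
      rintro a b ⟨hab, h | h⟩
      · exact key a b hab h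
      · exact (key b a hab.symm h).symm
    intro a b hab
    have := key' _ _ (show (tch (mrg G X w) Y).Adj ((Equiv.swap u w).symm a)
      ((Equiv.swap u w).symm b) from hab)
    simpa using this

end

section

variable {V : Type} [Fintype V]
variable {θ : ℤ} {P : SimpleGraph V → Prop} {K G : SimpleGraph V} {W Z : Finset V}

theorem Adm.mrg {X : Finset V} {w : V} (h : Adm G W Z) (hX : X ⊆ W) (hw : w ∈ X) :
    Adm (mrg G X w) (insert w (W \ X)) Z := by
  refine ⟨h.1.mono_left (insert_subset (hX hw) sdiff_subset), fun u v huv => ?_⟩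
  have key : u = w ∨ u ∉ X ∧ (u ∈ W ∨ u ∈ Z) := by
    rcases huv with huv | ⟨-, huv | huv⟩
    · exact .inr ⟨huv.2.1, h.2 u v huv.1⟩
    · exact .inl huv.1
    · exact .inr ⟨(mem_nb.1 huv.2).1, h.nb_mem huv.2⟩
  rcases key with rfl | ⟨h1, h2⟩
  · exact .inl (mem_insert_self _ _)
  · exact h2.imp_left fun h2 => mem_insert_of_mem (mem_sdiff.2 ⟨h2, h1⟩)

theorem ed_mrg {X : Finset V} {w : V} (hw : w ∈ X) :
    ed (mrg G X w) + rho G X = ed G + (nb G X).card := by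
  have h1 := ed_eq_rho_add G X
  have h2 : ed (mrg G X w) = ed (del G X) + ed (star w (nb G X)) :=
    ed_sup_disj fun a b h h' => by
      rcases h'.2 with h' | h'
      · exact h.2.1 (h'.1 ▸ hw)
      · exact h.2.2 (h'.1 ▸ hw)
  rw [ed_star fun h => (mem_nb.1 h).1 hw] at h2
  omega

theorem nb_mrg_mem {X Y : Finset V} {w y : V} (hy : y ∈ nb (mrg G X w) Y) (hyX : y ∈ X) :
    y = w := by
  obtain ⟨-, x, hx, h | ⟨-, h | h⟩⟩ := mem_nb.1 hy
  · exact absurd hyX h.2.2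
  · exact absurd hyX (mem_nb.1 h.2).1
  · exact h.1

theorem nb_union_mrg {X Y : Finset V} {w : V} (hw : w ∈ X) :
    nb G (X ∪ Y) = ((nb (mrg G X w) Y).erase w) ∪ (nb G X \ Y) := by
  ext y
  rw [mem_union, mem_erase, mem_sdiff]
  constructor
  · intro hy
    obtain ⟨h1, x, hx, hxy⟩ := mem_nb.1 hy
    rw [mem_union, not_or] at h1
    by_cases hxX : x ∈ X
    · exact .inr ⟨mem_nb.2 ⟨h1.1, x, hxX, hxy⟩, h1.2⟩
    · exact .inl ⟨fun e => h1.1 (e ▸ hw), mem_nb.2 ⟨h1.2, x, (mem_union.1 hx).resolve_left hxX,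
        .inl ⟨hxy, hxX, h1.1⟩⟩⟩
  · rintro (⟨hyw, hyN⟩ | ⟨hyS, hyY⟩)
    · have hyX : y ∉ X := fun h => hyw (nb_mrg_mem hyN h)
      obtain ⟨h1, x, hx, h⟩ := mem_nb.1 hyN
      have h2 : y ∉ X ∪ Y := by rw [mem_union, not_or]; exact ⟨hyX, h1⟩
      rcases h with h | ⟨-, h | h⟩
      · exact mem_nb.2 ⟨h2, x, mem_union_right _ hx, h.1⟩
      · obtain ⟨-, z, hz, hzy⟩ := mem_nb.1 h.2
        exact mem_nb.2 ⟨h2, z, mem_union_left _ hz, hzy⟩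
      · exact absurd h.1 hyw
    · obtain ⟨h1, x, hx, h⟩ := mem_nb.1 hyS
      exact mem_nb.2 ⟨by rw [mem_union, not_or]; exact ⟨h1, hyY⟩, x, mem_union_left _ hx, h⟩

theorem nb_union_mrg_of_mem {X Y : Finset V} {w : V} (hw : w ∈ X) (hwY : w ∈ Y) :
    nb G (X ∪ Y) = nb (mrg G X w) Y := by
  have hwN : w ∉ nb (mrg G X w) Y := fun h => (mem_nb.1 h).1 hwY
  rw [nb_union_mrg hw, erase_eq_of_notMem hwN]
  apply union_eq_left.2
  intro y hy
  rw [mem_sdiff] at hy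
  exact mem_nb.2 ⟨hy.2, w, hwY, .inr ⟨fun e => hy.2 (e ▸ hwY), .inl ⟨rfl, hy.1⟩⟩⟩

/-- The edge count used when the boundaries of `X` and `Y` interlock. -/
theorem ed_le_of_cover {A B C D : SimpleGraph V} (h : G ≤ A ⊔ B ⊔ C ⊔ D) :
    ed G ≤ ed A + ed B + ed C + ed D := by
  have h1 := ed_mono h
  have h2 := ed_sup_le (A ⊔ B ⊔ C) D
  have h3 := ed_sup_le (A ⊔ B) C
  have h4 := ed_sup_le A B
  omega

theorem Crit.star_false (c : Crit θ P K G W Z)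
    (hY : ∀ Y ⊆ W, Y ≠ W → (nb G Y).card = 4 → dd G Y + ed (ind G (nb G Y)) < θ)
    {X : Finset V} (hX : Cut G W X) (hmax : ∀ X', X ⊂ X' → ¬ Cut G W X') (hd : dd G X ≤ 1) :
    False := by
  obtain ⟨hXW, hXne, hXc, hX4, hX2⟩ := hX
  obtain ⟨w, hw⟩ := hXc.1
  have hwd : w ∉ W \ X := fun h => (mem_sdiff.1 h).2 hw
  have hcW := card_sdiff_add_card_eq_card hXW
  have hcW' := card_insert_of_notMem hwd
  have hed := ed_mrg (G := G) hw
  have hwZ : w ∉ Z := disjoint_left.1 c.adm.1 (hXW hw)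
  obtain ⟨Y, hYW, hYc, hY3, hY1, hYr⟩ := c.viol (G' := mrg G X w) (W' := insert w (W \ X))
    (.inl (by omega)) (c.adm.mrg hXW hw) ((c.hK_del hXW).trans le_sup_left)
    (by have := c.hE; unfold dd at hd; omega)
    (RM.mrg hXc hw fun x hx hxZ => absurd hxZ (disjoint_left.1 c.adm.1 (hXW hx)))
  have hYX : ∀ y ∈ Y, y ∈ X → y = w := fun y hy hyX =>
    (mem_insert.1 (hYW hy)).resolve_right fun h => (mem_sdiff.1 h).2 hyX
  have hYW' : Y ⊆ W := hYW.trans (insert_subset (hXW hw) sdiff_subset)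
  set N := nb (mrg G X w) Y with hN
  have hNX : ∀ y ∈ N, y ∈ X → y = w := fun y hy hyX => nb_mrg_mem hy hyX
  have hnb : nb G (X ∪ Y) = (N.erase w) ∪ (nb G X \ Y) := nb_union_mrg hw
  have rig : ∀ M, nb G (X ∪ Y) = M → M.card ≤ 3 → ¬ RM M (ind G (X ∪ Y ∪ M)) (cliq M) := by
    intro M hM hM3 hr
    refine c.not_rig (union_subset hXW hYW') (hXc.1.mono subset_union_left)
      (by rw [hM]; exact hM3) ?_
    unfold Rig; rw [hM]; exact hr
  have hMX : Disjoint (nb G (X ∪ Y)) X :=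
    (nb_disj (G := G) (X := X ∪ Y)).symm.mono_right subset_union_left
  by_cases hwY : w ∈ Y
  · have e : nb G (X ∪ Y) = N := nb_union_mrg_of_mem hw hwY
    exact rig N e hY3 (rig_of_mrg hXc hw hYX (e ▸ hMX) (fun y hy _ => hy) subset_rfl hYr)
  have hXY : Disjoint X Y := disjoint_left.2 fun y hyX hyY => hwY (hYX y hyY hyX ▸ hyY)
  have hR : ∀ a b, (star w (nb G X)).Adj a b → a ∈ Y → a ∈ nb G X := by
    rintro a b ⟨-, h | h⟩ ha
    · exact absurd (h.1 ▸ ha) hwY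
    · exact h.2
  by_cases hT0 : Disjoint (nb G X) Y
  · have e : tch (mrg G X w) Y = tch G Y := tch_replace hXY hT0
      fun a b hab ha => disjoint_left.1 hT0 (hR a b hab ha) ha
    rw [hN, nb_eq_of_tch e] at hY3
    rw [dd_eq_of_tch e] at hY1
    have := c.sp Y hYW' hY3
    omega
  obtain ⟨t, htS, htY⟩ := not_disjoint_iff.1 hT0
  have hwN : w ∈ N := mem_nb.2 ⟨hwY, t, htY, .inr ⟨fun e => hwY (e ▸ htY), .inr ⟨rfl, htS⟩⟩⟩
  have hP := card_erase_of_mem hwN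
  have hNpos := card_pos.2 ⟨w, hwN⟩
  have hNsX : N \ X = N.erase w := by
    ext y
    rw [mem_sdiff, mem_erase]
    exact ⟨fun h => ⟨fun e => h.2 (e ▸ hw), h.1⟩, fun h => ⟨h.2, fun h' => h.1 (hNX y h.2 h')⟩⟩
  have hTU := card_sdiff_add_card_inter (nb G X) Y
  rw [hX4, inter_comm] at hTU
  set U := (nb G X \ Y) \ N with hU
  have hUeq : nb G (X ∪ Y) = N.erase w ∪ U := by
    rw [hnb]; ext y
    simp only [hU, mem_union, mem_erase, mem_sdiff]
    have : y ∈ nb G X → y ≠ w := fun h e => (mem_nb.1 h).1 (e ▸ hw)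
    tauto
  have hU2 : 2 ≤ U.card := by
    by_contra hlt
    have hM3 : (nb G (X ∪ Y)).card ≤ 3 := by
      rw [hUeq]
      have := card_union_le (N.erase w) U
      omega
    refine rig _ rfl hM3 ?_
    rcases (show U.card = 0 ∨ U.card = 1 by omega) with h | h
    · rw [card_eq_zero.1 h, union_empty] at hUeq
      rw [hUeq] at hMX ⊢
      exact rig_of_mrg hXc hw hYX hMX (fun y hy hyw => mem_erase.2 ⟨hyw, hy⟩) (erase_subset _ _) hYr
    · obtain ⟨u, hu⟩ := card_eq_one.1 h
      have huU : u ∈ U := hu ▸ mem_singleton_self u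
      rw [hU, mem_sdiff, mem_sdiff] at huU
      refine rig_of_mrg_swap hXc hw hXY hMX huU.1.1 huU.1.2 huU.2 hwN (fun y => ?_) hYr
      rw [hUeq, hu, mem_union, mem_erase, mem_singleton]
      tauto
  have hUle : U.card ≤ (nb G X \ Y).card := card_le_card sdiff_subset
  have hT1 : (Y ∩ nb G X).card ≠ 1 := by
    intro h
    obtain ⟨s, hs⟩ := card_eq_one.1 h
    have := c.sp.dd_one (R := star w (nb G X)) hYW' hXY hR hY3 hs (by
      change (N \ X).card ≤ 2; rw [hNsX]; omega)
    change dd (mrg G X w) Y ≤ 0 at this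
    omega
  have hTpos : 0 < (Y ∩ nb G X).card := card_pos.2 ⟨t, mem_inter.2 ⟨htY, htS⟩⟩
  have hT2 : (Y ∩ nb G X).card = 2 := by omega
  have hN3 : N.card = 3 := by
    by_contra hne
    have := c.sp.dd_two (R := star w (nb G X)) hYW' hXY hR (by
      change N.card ≤ 2; omega) hT2 (by
      change (N \ X).card ≤ 1; rw [hNsX]; omega)
    change dd (mrg G X w) Y ≤ 0 at this
    omega
  have hUS : U = nb G X \ Y := Finset.eq_of_subset_of_card_le sdiff_subset (by omega)
  have hdisj : Disjoint (N.erase w) U := disjoint_left.2 fun y hy hyU =>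
    (mem_sdiff.1 hyU).2 (mem_erase.1 hy).2
  have hM4 : (nb G (X ∪ Y)).card = 4 := by
    rw [hUeq, card_union_of_disjoint hdisj]; omega
  have hYcG : Conn G Y := hYc.mono fun x hx y hy hxy => by
    rcases hxy with h | ⟨-, h | h⟩
    · exact h.1
    · exact absurd (h.1 ▸ hx) hwY
    · exact absurd (h.1 ▸ hy) hwY
  have hall : X ∪ Y = W := by
    by_contra hne
    obtain ⟨-, x, hx, hxt⟩ := mem_nb.1 htS
    exact hmax (X ∪ Y) ⟨subset_union_left, fun h => disjoint_left.1 hXY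
      (h (mem_union_right _ htY)) htY⟩ ⟨union_subset hXW hYW', hne, hXc.union hYcG hx htY hxt,
        hM4, hX2.trans (card_le_card subset_union_left)⟩
  have hZ : nb G W = Z := Finset.eq_of_subset_of_card_le c.adm.nb_sub (by
    rw [c.hZ, ← hall, hM4])
  have hZU : Z = N.erase w ∪ U := by rw [← hZ, ← hall, hUeq]
  obtain ⟨p, q, hpq, hP2⟩ := card_eq_two.1 (show (N.erase w).card = 2 by omega)
  have hpZ : p ∈ Z := by rw [hZU, hP2]; simp
  have hqZ : q ∈ Z := by rw [hZU, hP2]; simp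
  set T := Y ∩ nb G X with hT
  have hTP : Disjoint T (N.erase w) := disjoint_left.2 fun y hy hy' =>
    (mem_nb.1 (mem_erase.1 hy').2).1 (mem_inter.1 hy).1
  have hnbY : nb G (Y \ nb G X) ⊆ T ∪ N.erase w := by
    have := nb_sdiff_sub hXY (show del G X ≤ mrg G X w from le_sup_left)
    rwa [← hN, hNsX] at this
  have hYsub : Y \ nb G X ⊆ W := sdiff_subset.trans hYW'
  have cov : ∀ a b, G.Adj a b → (tch G X).Adj a b ∨ (tch G (Y \ nb G X)).Adj a b ∨
      (a ∈ T ∪ N.erase w ∧ b ∈ T ∪ N.erase w) ∨ a ∈ Z ∧ b ∈ Z := by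
    intro a b hab
    by_cases h1 : a ∈ X ∨ b ∈ X
    · exact .inl ⟨hab, h1⟩
    by_cases h2 : a ∈ Y \ nb G X ∨ b ∈ Y \ nb G X
    · exact .inr (.inl ⟨hab, h2⟩)
    right; right
    rw [not_or] at h1 h2
    have key : ∀ a b, G.Adj a b → a ∉ X → b ∉ X → a ∉ Y \ nb G X → b ∉ Y \ nb G X → a ∈ T →
        b ∈ T ∪ N.erase w := by
      intro a b hab ha hb ha' hb' haT
      by_cases hbY : b ∈ Y
      · exact mem_union_left _ (mem_inter.2 ⟨hbY, by
          by_contra h; exact hb' (mem_sdiff.2 ⟨hbY, h⟩)⟩)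
      · exact mem_union_right _ (mem_erase.2 ⟨fun e => hb (e ▸ hw), mem_nb.2 ⟨hbY, a,
          (mem_inter.1 haT).1, .inl ⟨hab, ha, hb⟩⟩⟩)
    have tz : ∀ a b, G.Adj a b → a ∉ X → a ∉ Y \ nb G X → a ∈ T ∨ a ∈ Z := by
      intro a b hab ha ha'
      rcases c.adm.2 a b hab with h | h
      · rw [← hall] at h
        have haY := (mem_union.1 h).resolve_left ha
        exact .inl (mem_inter.2 ⟨haY, by by_contra h; exact ha' (mem_sdiff.2 ⟨haY, h⟩)⟩)
      · exact .inr h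
    by_cases haT : a ∈ T
    · exact .inl ⟨mem_union_left _ haT, key a b hab h1.1 h1.2 h2.1 h2.2 haT⟩
    by_cases hbT : b ∈ T
    · exact .inl ⟨key b a hab.symm h1.2 h1.1 h2.2 h2.1 hbT, mem_union_left _ hbT⟩
    · exact .inr ⟨(tz a b hab h1.1 h2.1).resolve_left haT,
        (tz b a hab.symm h1.2 h2.2).resolve_left hbT⟩
  have hcard : W.card = X.card + ((Y \ nb G X).card + 2) := by
    rw [← hall, card_union_of_disjoint hXY, ← hT2, card_sdiff_add_card_inter]
  have hE := c.hE
  have hTPc : (T ∪ N.erase w).card = 4 := by rw [card_union_of_disjoint hTP]; omega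
  unfold dd at hd
  by_cases h4 : (nb G (Y \ nb G X)).card = 4
  · have e : nb G (Y \ nb G X) = T ∪ N.erase w :=
      Finset.eq_of_subset_of_card_le hnbY (by omega)
    have h5 := hY _ hYsub (fun h => by
      have : t ∈ Y \ nb G X := h ▸ hYW' htY
      exact (mem_sdiff.1 this).2 htS) h4
    rw [e] at h5
    have h6 := ed_le_of_cover (G := G) (A := tch G X) (B := tch G (Y \ nb G X))
      (C := ind G (T ∪ N.erase w)) (D := cm Z p q) (by
        intro a b hab
        rcases cov a b hab with h | h | h | h
        · exact .inl (.inl (.inl h))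
        · exact .inl (.inl (.inr h))
        · exact .inl (.inr ⟨hab, h⟩)
        · by_cases h' : a ∈ T ∪ N.erase w ∧ b ∈ T ∪ N.erase w
          · exact .inl (.inr ⟨hab, h'⟩)
          · refine .inr ⟨hab.ne, h.1, h.2, ?_, ?_⟩ <;>
            · rintro ⟨rfl, rfl⟩
              exact h' (by rw [hP2]; simp))
    rw [ed_cm c.hZ hpZ hqZ hpq] at h6
    unfold dd rho at h5
    unfold rho at hd
    omega
  · have h5 := c.sp _ hYsub (by have := card_le_card hnbY; omega)
    have h6 := ed_le_of_cover (G := G) (A := tch G X) (B := tch G (Y \ nb G X))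
      (C := cm (T ∪ N.erase w) p q) (D := ind G Z) (by
        intro a b hab
        rcases cov a b hab with h | h | h | h
        · exact .inl (.inl (.inl h))
        · exact .inl (.inl (.inr h))
        · by_cases h' : a ∈ Z ∧ b ∈ Z
          · exact .inr ⟨hab, h'⟩
          · refine .inl (.inr ⟨hab.ne, h.1, h.2, ?_, ?_⟩) <;>
            · rintro ⟨rfl, rfl⟩
              exact h' (by tauto)
        · exact .inr ⟨hab, h⟩)
    rw [ed_cm hTPc (by rw [hP2]; simp) (by rw [hP2]; simp) hpq] at h6
    have h7 := c.hZθ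
    unfold dd rho at h5
    unfold rho at hd
    omega

end

section

variable {V : Type} [Fintype V]
variable {θ : ℤ} {P : SimpleGraph V → Prop} {K G : SimpleGraph V} {W Z : Finset V}

theorem nb_singleton (G : SimpleGraph V) (v : V) : nb G {v} = nbv G v := by
  ext y
  rw [mem_nb, mem_nbv]
  constructor
  · rintro ⟨-, x, hx, h⟩
    exact mem_singleton.1 hx ▸ h
  · exact fun h => ⟨fun e => h.ne (mem_singleton.1 e).symm, v, mem_singleton_self v, h⟩

theorem dd_le_zero_of_card_le_one {Y : Finset V} (h1 : Y.card ≤ 1) (h3 : (nb G Y).card ≤ 3) :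
    dd G Y ≤ 0 := by
  rcases Y.eq_empty_or_nonempty with rfl | hne
  · rw [dd_empty]
  · obtain ⟨y, rfl⟩ := card_eq_one.1 (show Y.card = 1 by have := card_pos.2 hne; omega)
    rw [dd_singleton, ← nb_singleton]; omega

theorem rho_mrg_pair_le {u v : V} {Y : Finset V} (hu : u ∉ Y) (hv : v ∉ Y) (huv : u ≠ v) :
    rho (mrg G {u, v} u) Y ≤ rho G Y := by
  obtain ⟨A, hA⟩ : ∃ A, A = Y ∩ nbv G u := ⟨_, rfl⟩
  obtain ⟨B, hB⟩ : ∃ B, B = (Y ∩ nbv G v) \ A := ⟨_, rfl⟩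
  have hAB : Disjoint A B := hB ▸ disjoint_sdiff
  have hAY : A ⊆ Y := hA ▸ inter_subset_left
  have hBY : B ⊆ Y := hB ▸ sdiff_subset.trans inter_subset_left
  have huA : u ∉ A := fun h => hu (hAY h)
  have hvB : v ∉ B := fun h => hv (hBY h)
  have h1 : rho (mrg G {u, v} u) Y ≤ ed (tch (del G {u, v}) Y ⊔ star u (A ∪ B)) := by
    refine ed_mono fun a b hab => ?_
    have key : ∀ b, b ∈ nb G {u, v} → b ∈ Y → b ∈ A ∪ B := by
      intro b hb hbY
      obtain ⟨-, x, hx, hxb⟩ := mem_nb.1 hb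
      by_cases hbA : b ∈ A
      · exact mem_union_left _ hbA
      rcases mem_insert.1 hx with rfl | hx
      · exact absurd (hA ▸ mem_inter.2 ⟨hbY, mem_nbv.2 hxb⟩) hbA
      · rw [mem_singleton] at hx; subst hx
        exact mem_union_right _ (hB ▸ mem_sdiff.2 ⟨mem_inter.2 ⟨hbY, mem_nbv.2 hxb⟩, hbA⟩)
    obtain ⟨hab | ⟨hne, h | h⟩, ht⟩ := hab
    · exact .inl ⟨hab, ht⟩
    · exact .inr ⟨hne, .inl ⟨h.1, key b h.2 (ht.resolve_left fun h' => hu (h.1 ▸ h'))⟩⟩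
    · exact .inr ⟨hne, .inr ⟨h.1, key a h.2 (ht.resolve_right fun h' => hu (h.1 ▸ h'))⟩⟩
  have h2 := ed_sup_le (tch (del G {u, v}) Y) (star u (A ∪ B))
  rw [ed_star (fun h => hu (union_subset hAY hBY h)), card_union_of_disjoint hAB] at h2
  have h3 : ed (tch (del G {u, v}) Y ⊔ star u A ⊔ star v B) ≤ rho G Y := by
    refine ed_mono fun a b hab => ?_
    obtain (hab | ⟨hne, h | h⟩) | ⟨hne, h | h⟩ := hab
    · exact ⟨hab.1.1, hab.2⟩
    · rw [hA, mem_inter, mem_nbv] at h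
      exact ⟨h.1 ▸ h.2.2, .inr h.2.1⟩
    · rw [hA, mem_inter, mem_nbv] at h
      exact ⟨h.1 ▸ h.2.2.symm, .inl h.2.1⟩
    · rw [hB, mem_sdiff, mem_inter, mem_nbv] at h
      exact ⟨h.1 ▸ h.2.1.2, .inr h.2.1.1⟩
    · rw [hB, mem_sdiff, mem_inter, mem_nbv] at h
      exact ⟨h.1 ▸ h.2.1.2.symm, .inl h.2.1.1⟩
  rw [ed_sup_disj, ed_sup_disj, ed_star huA, ed_star hvB] at h3
  · omega
  · rintro a b hab ⟨-, h | h⟩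
    · exact hab.1.2.1 (by simp [h.1])
    · exact hab.1.2.2 (by simp [h.1])
  · rintro a b hab ⟨-, h | h⟩
    · rcases hab with hab | ⟨-, h' | h'⟩
      · exact hab.1.2.1 (by simp [h.1])
      · exact huv (h'.1.symm.trans h.1)
      · exact huA (h'.1 ▸ absurd (h.1 ▸ h'.2) fun h => hv (hAY h))
    · rcases hab with hab | ⟨-, h' | h'⟩
      · exact hab.1.2.2 (by simp [h.1])
      · exact huA (h'.1 ▸ absurd (h.1 ▸ h'.2) fun h => hv (hAY h))
      · exact huv (h'.1.symm.trans h.1)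

theorem Crit.common (c : Crit θ P K G W Z) (hnc : ∀ X, ¬ Cut G W X) {u v : V} (hv : v ∈ W)
    (huv : G.Adj u v) : 3 ≤ (nbv G u ∩ nbv G v).card := by
  by_contra hlt
  have hne := huv.ne
  have hvZ : v ∉ Z := disjoint_left.1 c.adm.1 hv
  have hU : Conn G {u, v} := (Conn.singleton G v).insert (mem_singleton_self v) huv
  have huU : u ∈ ({u, v} : Finset V) := mem_insert_self _ _
  have hed := ed_mrg (G := G) huU
  have hrho : rho G {u, v} + 1 = (nbv G u).card + (nbv G v).card := by
    have h1 := dd_insert G (v := u) (Y := {v}) (by simpa using hne)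
    rw [dd_singleton] at h1
    have h2 : (nbv G u \ {v}).card + 1 = (nbv G u).card := by
      rw [sdiff_singleton_eq_erase]
      exact card_erase_add_one (mem_nbv.2 huv)
    have h3 : ({u, v} : Finset V).card = 2 := card_pair hne
    unfold dd at h1
    omega
  have hnb : (nb G {u, v}).card + 2 = (nbv G u ∪ nbv G v).card := by
    have : nbv G u ∪ nbv G v = nb G {u, v} ∪ {u, v} := by
      ext y
      simp only [mem_union, mem_nbv, mem_nb, mem_insert, mem_singleton]
      constructor
      · intro h
        by_cases hy : y = u ∨ y = v
        · exact .inr hy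
        · exact .inl ⟨hy, h.elim (fun h => ⟨u, .inl rfl, h⟩) fun h => ⟨v, .inr rfl, h⟩⟩
      · rintro (⟨-, x, rfl | rfl, h⟩ | rfl | rfl)
        exacts [.inl h, .inr h, .inr huv.symm, .inl huv]
    rw [this, card_union_of_disjoint nb_disj.symm, card_pair hne]
  have hui := card_union_add_card_inter (nbv G u) (nbv G v)
  have hcW := card_erase_add_one hv
  have hUW : ∀ x, x ∈ W → x = u ∨ x ∈ ({u, v} : Finset V) ∨ x ∈ W \ {u, v} := by
    intro x hx
    by_cases h : x ∈ ({u, v} : Finset V)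
    · exact .inr (.inl h)
    · exact .inr (.inr (mem_sdiff.2 ⟨hx, h⟩))
  have hadm : Adm (mrg G {u, v} u) (W.erase v) Z := by
    refine ⟨c.adm.1.mono_left (erase_subset _ _), fun a b hab => ?_⟩
    have key : a ≠ v ∧ (a ∈ W ∨ a ∈ Z) := by
      rcases hab with h | ⟨-, h | h⟩
      · exact ⟨fun e => h.2.1 (by simp [e]), c.adm.2 a b h.1⟩
      · rw [h.1]; exact ⟨hne, c.adm.2 u v huv⟩
      · exact ⟨fun e => (mem_nb.1 h.2).1 (by simp [e]), c.adm.nb_mem h.2⟩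
    exact key.2.imp_left fun h => mem_erase.2 ⟨key.1, h⟩
  have hK : K ≤ mrg G {u, v} u := by
    have nv : ∀ a, a ∈ Z → a ≠ u → a ∉ ({u, v} : Finset V) := by
      intro a ha hau h
      rcases mem_insert.1 h with h | h
      · exact hau h
      · exact hvZ (mem_singleton.1 h ▸ ha)
    intro a b hab
    have hz := c.hKZ hab
    by_cases ha : a = u
    · exact .inr ⟨hab.ne, .inl ⟨ha, mem_nb.2 ⟨nv b hz.2.2 fun e => hab.ne (ha.trans e.symm), u, huU,
        ha ▸ c.hK hab⟩⟩⟩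
    by_cases hb : b = u
    · exact .inr ⟨hab.ne, .inr ⟨hb, mem_nb.2 ⟨nv a hz.2.1 ha, u, huU, hb ▸ (c.hK hab).symm⟩⟩⟩
    · exact .inl ⟨c.hK hab, nv a hz.2.1 ha, nv b hz.2.2 hb⟩
  obtain ⟨Y, hYW, hYc, hY3, hY1, hYr⟩ := c.viol (G' := mrg G {u, v} u) (W' := W.erase v)
    (.inl (by omega)) hadm hK (by have := c.hE; omega)
    (RM.mrg hU huU fun x hx hxZ => (mem_insert.1 hx).resolve_right fun h =>
      hvZ (mem_singleton.1 h ▸ hxZ))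
  have hvY : v ∉ Y := fun h => (mem_erase.1 (hYW h)).1 rfl
  have hYW' : Y ⊆ W := hYW.trans (erase_subset _ _)
  by_cases huY : u ∈ Y
  · have e := nb_union_mrg_of_mem (G := G) huU huY
    have h1 : {u, v} ∪ Y ⊆ W := union_subset (by
      intro x hx
      rcases mem_insert.1 hx with rfl | hx
      · exact hYW' huY
      · exact mem_singleton.1 hx ▸ hv) hYW'
    refine c.not_rig h1 ⟨u, mem_union_left _ huU⟩ (by rw [e]; exact hY3) ?_
    unfold Rig
    rw [e]
    refine rig_of_mrg hU huU (fun y hy hyU => ?_) ?_ (fun y hy _ => hy) subset_rfl hYr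
    · exact (mem_insert.1 hyU).resolve_right fun h => hvY (mem_singleton.1 h ▸ hy)
    · rw [← e]
      exact (nb_disj (G := G) (X := {u, v} ∪ Y)).symm.mono_right subset_union_left
  · have hYU : ∀ x ∈ Y, x ∉ ({u, v} : Finset V) := by
      intro x hx h
      rcases mem_insert.1 h with h | h
      · exact huY (h ▸ hx)
      · exact hvY (mem_singleton.1 h ▸ hx)
    have hsub : nb G Y ⊆ insert v (nb (mrg G {u, v} u) Y) := by
      intro y hy
      obtain ⟨h1, x, hx, hxy⟩ := mem_nb.1 hy
      rw [mem_insert]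
      by_cases hyv : y = v
      · exact .inl hyv
      refine .inr (mem_nb.2 ⟨h1, x, hx, ?_⟩)
      by_cases hyu : y = u
      · exact .inr ⟨hxy.ne, .inr ⟨hyu, mem_nb.2 ⟨hYU x hx, u, huU, hyu ▸ hxy.symm⟩⟩⟩
      · exact .inl ⟨hxy, hYU x hx, by simp [hyu, hyv]⟩
    have h4 := (card_le_card hsub).trans (card_insert_le _ _)
    have hr := rho_mrg_pair_le (G := G) huY hvY hne
    have hYG : Conn G Y := hYc.mono fun x hx y hy hxy => by
      rcases hxy with h | ⟨-, h | h⟩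
      · exact h.1
      · exact absurd (h.1 ▸ hx) huY
      · exact absurd (h.1 ▸ hy) huY
    have h5 : ¬ (nb G Y).card ≤ 3 := fun h => by
      have := c.sp Y hYW' h
      unfold dd at this hY1
      omega
    have h6 : ¬ 2 ≤ Y.card := fun h =>
      hnc Y ⟨hYW', fun e => hvY (e ▸ hv), hYG, by omega, h⟩
    have := dd_le_zero_of_card_le_one (by omega) hY3
    omega

theorem Crit.nb_W (c : Crit θ P K G W Z) : nb G W = Z := by
  by_contra hne
  have h1 := card_lt_card (c.adm.nb_sub.ssubset_of_ne hne)
  rw [c.hZ] at h1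
  have h2 := c.sp W subset_rfl (by omega)
  have h3 := c.adm.ed_eq
  have h4 := c.hE
  have h5 := c.hZθ
  omega

/-- Deleting a single edge. -/
theorem Crit.del_false (c : Crit θ P K G W Z) (hnc : ∀ X, ¬ Cut G W X)
    (hE : θ + 1 ≤ ed G - 3 * (W.card : ℤ)) (hdeg : ∀ z ∈ Z, 2 ≤ (nbv G z ∩ W).card) : False := by
  obtain ⟨u, v, hv, huv⟩ : ∃ u v, v ∈ W ∧ G.Adj u v := by
    obtain ⟨z, hz⟩ := card_pos.1 (show 0 < Z.card by rw [c.hZ]; norm_num)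
    obtain ⟨w, hw⟩ := card_pos.1 (show 0 < (nbv G z ∩ W).card by have := hdeg z hz; omega)
    exact ⟨z, w, (mem_inter.1 hw).2, mem_nbv.1 (mem_inter.1 hw).1⟩
  set G' := G.deleteEdges {s(u, v)} with hG'
  have adj : ∀ a b, G'.Adj a b ↔ G.Adj a b ∧ ¬(a = u ∧ b = v) ∧ ¬(a = v ∧ b = u) := by
    intro a b
    simp only [hG', deleteEdges_adj, Set.mem_singleton_iff, Sym2.eq_iff]
    tauto
  have hle : G' ≤ G := fun a b h => ((adj a b).1 h).1
  have hed := ed_delEdge huv adj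
  have hvZ : v ∉ Z := disjoint_left.1 c.adm.1 hv
  obtain ⟨Y, hYW, hYc, hY3, hY1, -⟩ := c.viol (G' := G') (W' := W) (.inr ⟨rfl, by omega⟩)
    ⟨c.adm.1, fun a b h => c.adm.2 a b (hle h)⟩ (fun a b h => (adj a b).2 ⟨c.hK h,
      fun e => hvZ (e.2 ▸ (c.hKZ h).2.2), fun e => hvZ (e.1 ▸ (c.hKZ h).2.1)⟩) (by omega)
    (RM.of_le hle)
  have hr := rho_mono hle (subset_refl Y)
  have h5 : ¬ (nb G Y).card ≤ 3 := fun h => by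
    have := c.sp Y hYW h
    unfold dd at this hY1
    omega
  have h4 : (nb G Y).card ≤ (nb G' Y).card + 1 := by
    have : ∃ w, nb G Y ⊆ insert w (nb G' Y) := by
      refine ⟨if u ∈ Y then v else u, fun y hy => ?_⟩
      obtain ⟨h1, x, hx, hxy⟩ := mem_nb.1 hy
      rw [mem_insert]
      by_cases h : G'.Adj x y
      · exact .inr (mem_nb.2 ⟨h1, x, hx, h⟩)
      · left
        rw [adj] at h
        have h' : (x = u ∧ y = v) ∨ (x = v ∧ y = u) := by tauto
        rcases h' with ⟨rfl, rfl⟩ | ⟨rfl, rfl⟩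
        · rw [if_pos hx]
        · rw [if_neg h1]
    obtain ⟨w, hw⟩ := this
    exact (card_le_card hw).trans (card_insert_le _ _)
  by_cases hYW' : Y = W
  · subst hYW'
    have : Z ⊆ nb G' Y := by
      intro z hz
      have hzY : z ∉ Y := disjoint_right.1 c.adm.1 hz
      obtain ⟨a, ha, b, hb, hab⟩ := one_lt_card.1 (hdeg z hz)
      rw [mem_inter, mem_nbv] at ha hb
      by_cases h : G'.Adj z a
      · exact mem_nb.2 ⟨hzY, a, ha.2, h.symm⟩
      · refine mem_nb.2 ⟨hzY, b, hb.2, ((adj z b).2 ⟨hb.1, ?_⟩).symm⟩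
        rw [adj] at h
        have h' : (z = u ∧ a = v) ∨ (z = v ∧ a = u) := by tauto
        rcases h' with ⟨rfl, rfl⟩ | ⟨rfl, rfl⟩
        · exact ⟨fun e => hab e.2.symm, fun e => huv.ne e.1⟩
        · exact absurd hz hvZ
    have := card_le_card this
    rw [c.hZ] at this
    omega
  · have h6 : ¬ 2 ≤ Y.card := fun h => hnc Y ⟨hYW, hYW', hYc.mono fun x _ y _ h => hle h,
      by omega, h⟩
    have := dd_le_zero_of_card_le_one (by omega) hY3
    omega

end

section

variable {V : Type} [Fintype V]
variable {θ : ℤ} {P : SimpleGraph V → Prop} {K G : SimpleGraph V} {W Z : Finset V}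

theorem RM.of_bags4 {H : SimpleGraph V} {a b c d : V} {A B C D : Finset V}
    (ha : a ∈ A) (hb : b ∈ B) (hc : c ∈ C) (hd : d ∈ D)
    (hA : Conn G A) (hB : Conn G B) (hC : Conn G C) (hD : Conn G D)
    (hAB : Disjoint A B) (hAC : Disjoint A C) (hAD : Disjoint A D) (hBC : Disjoint B C)
    (hBD : Disjoint B D) (hCD : Disjoint C D) (hH : H ≤ cliq {a, b, c, d})
    (tab : H.Adj a b → Tw G A B) (tac : H.Adj a c → Tw G A C) (tad : H.Adj a d → Tw G A D)
    (tbc : H.Adj b c → Tw G B C) (tbd : H.Adj b d → Tw G B D) (tcd : H.Adj c d → Tw G C D) :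
    RM {a, b, c, d} G H := by
  have nab : a ≠ b := fun e => disjoint_left.1 hAB ha (e ▸ hb)
  have nac : a ≠ c := fun e => disjoint_left.1 hAC ha (e ▸ hc)
  have nad : a ≠ d := fun e => disjoint_left.1 hAD ha (e ▸ hd)
  have nbc : b ≠ c := fun e => disjoint_left.1 hBC hb (e ▸ hc)
  have nbd : b ≠ d := fun e => disjoint_left.1 hBD hb (e ▸ hd)
  have ncd : c ≠ d := fun e => disjoint_left.1 hCD hc (e ▸ hd)
  obtain ⟨F, Fa, Fb, Fc, Fd⟩ : ∃ F : V → Finset V, F a = A ∧ F b = B ∧ F c = C ∧ F d = D :=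
    ⟨fun z => if z = a then A else if z = b then B else if z = c then C else D,
      by simp, by simp [nab.symm], by simp [nac.symm, nbc.symm],
      by simp [nad.symm, nbd.symm, ncd.symm]⟩
  have sym : ∀ {S T : Finset V}, Tw G S T → Tw G T S :=
    fun ⟨x, hx, y, hy, h⟩ => ⟨y, hy, x, hx, h.symm⟩
  refine RM.of_bags F ?_ ?_ ?_ hH ?_
  · simp only [mem_insert, mem_singleton]
    rintro z (rfl | rfl | rfl | rfl)
    exacts [Fa ▸ ha, Fb ▸ hb, Fc ▸ hc, Fd ▸ hd]
  · simp only [mem_insert, mem_singleton]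
    rintro z (rfl | rfl | rfl | rfl)
    exacts [Fa ▸ hA, Fb ▸ hB, Fc ▸ hC, Fd ▸ hD]
  · simp only [mem_insert, mem_singleton]
    rw [Finset.disjoint_left] at hAB hAC hAD hBC hBD hCD
    rintro z (rfl | rfl | rfl | rfl) z' (rfl | rfl | rfl | rfl) x hx hx' <;>
      first
      | rfl
      | (exfalso; simp only [Fa, Fb, Fc, Fd] at hx hx'
         first
         | exact hAB hx hx' | exact hAB hx' hx | exact hAC hx hx' | exact hAC hx' hx
         | exact hAD hx hx' | exact hAD hx' hx | exact hBC hx hx' | exact hBC hx' hx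
         | exact hBD hx hx' | exact hBD hx' hx | exact hCD hx hx' | exact hCD hx' hx)
  · intro u v huv
    change Tw G (F u) (F v)
    obtain ⟨hne, hu, hv⟩ := hH huv
    simp only [mem_insert, mem_singleton] at hu hv
    rcases hu with rfl | rfl | rfl | rfl <;> rcases hv with rfl | rfl | rfl | rfl <;>
      first
      | exact absurd rfl hne
      | (simp only [Fa, Fb, Fc, Fd]
         first
         | exact tab huv | exact tac huv | exact tad huv | exact tbc huv | exact tbd huv
         | exact tcd huv | exact sym (tab huv.symm) | exact sym (tac huv.symm)
         | exact sym (tad huv.symm) | exact sym (tbc huv.symm) | exact sym (tbd huv.symm)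
         | exact sym (tcd huv.symm))

theorem Tw.of_adj {a b : V} {A B : Finset V} (ha : a ∈ A) (hb : b ∈ B) (h : G.Adj a b) :
    Tw G A B := ⟨a, ha, b, hb, h⟩

theorem tch_le : tch G W ≤ G := fun _ _ h => h.1

/-- In a neighbourhood of size at most five in which all degrees are at least three, every vertex
has at most one non-neighbour. -/
theorem nonadj_unique {N : Finset V} (hN : N.card ≤ 5) (h3 : ∀ u ∈ N, 3 ≤ (nbv G u ∩ N).card)
    {u a b : V} (hu : u ∈ N) (ha : a ∈ N) (hb : b ∈ N) (hua : u ≠ a) (hub : u ≠ b)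
    (na : ¬ G.Adj u a) (nb : ¬ G.Adj u b) : a = b := by
  by_contra hab
  have h1 : nbv G u ∩ N ⊆ ((N.erase u).erase a).erase b := by
    intro x hx
    obtain ⟨hx, hxN⟩ := mem_inter.1 hx
    rw [mem_nbv] at hx
    exact mem_erase.2 ⟨fun e => nb (e ▸ hx), mem_erase.2 ⟨fun e => na (e ▸ hx),
      mem_erase.2 ⟨hx.ne.symm, hxN⟩⟩⟩
  have h2 := card_le_card h1
  have e1 := card_erase_add_one hu
  have e2 := card_erase_add_one (mem_erase.2 ⟨hua.symm, ha⟩)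
  have e3 := card_erase_add_one (mem_erase.2 ⟨Ne.symm hab, mem_erase.2 ⟨hub.symm, hb⟩⟩)
  have := h3 u hu
  omega

theorem common_nbr_of_not_adj {N : Finset V} (hN : N.card ≤ 5)
    (h3 : ∀ u ∈ N, 3 ≤ (nbv G u ∩ N).card)
    {a b y : V} (ha : a ∈ N) (hb : b ∈ N) (hy : y ∈ N) (hab : a ≠ b) (na : ¬ G.Adj a b)
    (hya : y ≠ a) (hyb : y ≠ b) : G.Adj y a ∧ G.Adj y b := by
  constructor <;> by_contra h
  · exact hyb (nonadj_unique hN h3 ha hb hy hab hya.symm na fun h' => h h'.symm).symm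
  · exact hya (nonadj_unique hN h3 hb ha hy hab.symm hyb.symm (fun h' => na h'.symm)
      fun h' => h h'.symm).symm

theorem tri_of_nbhd {N S : Finset V} {v : V} (hN : N.card ≤ 5)
    (h3 : ∀ u ∈ N, 3 ≤ (nbv G u ∩ N).card) (hS : S ⊆ N) (hS3 : S.card ≤ 3) (hvN : v ∉ N)
    (hv : ∀ u ∈ N, G.Adj v u) : RM S (ind G ({v} ∪ N)) (cliq S) := by
  have inU : ∀ {x}, x ∈ N → x ∈ {v} ∪ N := fun h => mem_union_right _ h
  by_cases hm : ∃ a ∈ S, ∃ b ∈ S, a ≠ b ∧ ¬ G.Adj a b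
  · obtain ⟨a, ha, b, hb, hab, na⟩ := hm
    have hva : (ind G ({v} ∪ N)).Adj v a :=
      ⟨hv a (hS ha), mem_union_left _ (mem_singleton_self v), inU (hS ha)⟩
    have hU : Conn (ind G ({v} ∪ N)) {v, a} :=
      (Conn.singleton _ a).insert (mem_singleton_self a) hva
    have haU : a ∈ ({v, a} : Finset V) := by simp
    refine (RM.mrg hU haU fun x hx hxS => ?_).trans (RM.of_le fun p q hpq => ?_)
    · rcases mem_insert.1 hx with rfl | hx
      · exact absurd (hS hxS) hvN
      · exact mem_singleton.1 hx
    · obtain ⟨hne, hp, hq⟩ := hpq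
      have out : ∀ {x}, x ∈ S → x ≠ a → x ∉ ({v, a} : Finset V) := by
        intro x hx hxa h
        rcases mem_insert.1 h with h | h
        · exact hvN (h ▸ hS hx)
        · exact hxa (mem_singleton.1 h)
      have nbm : ∀ {x}, x ∈ S → x ≠ a → x ∈ nb (ind G ({v} ∪ N)) {v, a} := fun hx hxa =>
        mem_nb.2 ⟨out hx hxa, v, by simp, hv _ (hS hx),
          mem_union_left _ (mem_singleton_self v), inU (hS hx)⟩
      by_cases hpa : p = a
      · exact .inr ⟨hne, .inl ⟨hpa, nbm hq fun h => hne (hpa.trans h.symm)⟩⟩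
      by_cases hqa : q = a
      · exact .inr ⟨hne, .inr ⟨hqa, nbm hp hpa⟩⟩
      refine .inl ⟨⟨?_, inU (hS hp), inU (hS hq)⟩, out hp hpa, out hq hqa⟩
      by_contra hpq
      by_cases hpb : p = b
      · exact hqa (nonadj_unique hN h3 (hS hp) (hS ha) (hS hq) hpa hne
          (fun h => na (hpb ▸ h.symm)) hpq).symm
      by_cases hqb : q = b
      · exact hpa (nonadj_unique hN h3 (hS hq) (hS ha) (hS hp) hqa (Ne.symm hne)
          (fun h => na (hqb ▸ h.symm)) (fun h => hpq h.symm)).symm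
      have h4 : ({a, b, p, q} : Finset V).card ≤ 3 := (card_le_card (by
        intro x hx
        simp only [mem_insert, mem_singleton] at hx
        rcases hx with rfl | rfl | rfl | rfl <;> assumption)).trans hS3
      rw [card_insert_of_notMem (by simp [hab, Ne.symm hpa, Ne.symm hqa]),
        card_insert_of_notMem (by simp [Ne.symm hpb, Ne.symm hqb]), card_pair hne] at h4
      omega
  · push Not at hm
    exact RM.of_le fun a b hab => ⟨hm a hab.2.1 b hab.2.2 hab.1, inU (hS hab.2.1),
      inU (hS hab.2.2)⟩

theorem k4_of_nbhd {N S : Finset V} {A : SimpleGraph V} {v r : V} (hN : N.card ≤ 5)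
    (h3 : ∀ u ∈ N, 3 ≤ (nbv G u ∩ N).card) (hS : S ⊆ N) (hS4 : S.card = 4) (hvN : v ∉ N)
    (hv : ∀ u ∈ N, A.Adj v u) (hr : r ∈ S)
    (hA : ∀ a ∈ N, ∀ b ∈ N, a ≠ r → b ≠ r → G.Adj a b → A.Adj a b) :
    RM S (ind A ({v} ∪ N)) (cliq S) := by
  have inU : ∀ {x}, x ∈ N → x ∈ {v} ∪ N := fun h => mem_union_right _ h
  have vU : v ∈ {v} ∪ N := mem_union_left _ (mem_singleton_self v)
  have hva : ∀ u ∈ N, (ind A ({v} ∪ N)).Adj v u := fun u hu => ⟨hv u hu, vU, inU hu⟩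
  have hadj : ∀ a ∈ N, ∀ b ∈ N, a ≠ r → b ≠ r → G.Adj a b → (ind A ({v} ∪ N)).Adj a b :=
    fun a ha b hb h1 h2 h => ⟨hA a ha b hb h1 h2 h, inU ha, inU hb⟩
  have hE : (S.erase r).card = 3 := by have := card_erase_add_one hr; omega
  obtain ⟨a, b, c, hab, hac, hbc, hSr, hm⟩ : ∃ a b c, a ≠ b ∧ a ≠ c ∧ b ≠ c ∧
      S.erase r = {a, b, c} ∧ ((∃ p ∈ S.erase r, ∃ q ∈ S.erase r, p ≠ q ∧ ¬ G.Adj p q) →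
        ¬ G.Adj a b) := by
    by_cases hm : ∃ p ∈ S.erase r, ∃ q ∈ S.erase r, p ≠ q ∧ ¬ G.Adj p q
    · obtain ⟨p, hp, q, hq, hpq, h⟩ := hm
      have hq' : q ∈ (S.erase r).erase p := mem_erase.2 ⟨hpq.symm, hq⟩
      have e1 := card_erase_add_one hp
      have e2 := card_erase_add_one hq'
      obtain ⟨c, hc⟩ := card_eq_one.1 (show (((S.erase r).erase p).erase q).card = 1 by omega)
      have hcm : c ∈ ((S.erase r).erase p).erase q := hc ▸ mem_singleton_self c
      refine ⟨p, q, c, hpq, ?_, ?_, ?_, fun _ => h⟩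
      · exact fun e => (mem_erase.1 (mem_erase.1 hcm).2).1 e.symm
      · exact fun e => (mem_erase.1 hcm).1 e.symm
      · rw [← insert_erase hp, ← insert_erase hq', hc]
    · obtain ⟨a, b, c, h1, h2, h3, h4⟩ := card_eq_three.1 hE
      exact ⟨a, b, c, h1, h2, h3, h4, fun h => absurd h hm⟩
  have ma : a ∈ S.erase r := hSr ▸ by simp
  have mb : b ∈ S.erase r := hSr ▸ by simp
  have mc : c ∈ S.erase r := hSr ▸ by simp
  obtain ⟨har, haS⟩ := mem_erase.1 ma
  obtain ⟨hbr, hbS⟩ := mem_erase.1 mb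
  obtain ⟨hcr, hcS⟩ := mem_erase.1 mc
  have haN := hS haS
  have hbN := hS hbS
  have hcN := hS hcS
  have hrN := hS hr
  have hSe : S = {r, a, b, c} := by rw [← insert_erase hr, hSr]
  have nv : ∀ {x}, x ∈ N → x ≠ v := fun h e => hvN (e ▸ h)
  have hRc : Conn (ind A ({v} ∪ N)) {v, r} :=
    (Conn.singleton _ r).insert (mem_singleton_self r) (hva r hrN)
  by_cases hm' : ∃ p ∈ S.erase r, ∃ q ∈ S.erase r, p ≠ q ∧ ¬ G.Adj p q
  · have na := hm hm'
    have hac' : G.Adj a c := by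
      by_contra h
      exact hbc (nonadj_unique hN h3 haN hbN hcN hab hac na h)
    have hbc' : G.Adj b c := by
      by_contra h
      exact hac (nonadj_unique hN h3 hbN haN hcN hab.symm hbc (fun h => na h.symm) h)
    obtain ⟨y, hyN, hyS⟩ : ∃ y ∈ N, y ∉ S := by
      by_contra hc
      push Not at hc
      have hNS : N ⊆ S := hc
      have h1 := h3 a haN
      have h2 : nbv G a ∩ N ⊆ (S.erase a).erase b := fun x hx => by
        obtain ⟨hx, hxN⟩ := mem_inter.1 hx
        rw [mem_nbv] at hx
        exact mem_erase.2 ⟨fun e => na (e ▸ hx), mem_erase.2 ⟨hx.ne.symm, hNS hxN⟩⟩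
      have h4 := card_le_card h2
      have e1 := card_erase_add_one haS
      have e2 := card_erase_add_one (mem_erase.2 ⟨hab.symm, hbS⟩)
      omega
    have ny : ∀ {x}, x ∈ S → y ≠ x := fun hx e => hyS (e ▸ hx)
    obtain ⟨hya, hyb⟩ := common_nbr_of_not_adj hN h3 haN hbN hyN hab na (ny haS) (ny hbS)
    have hyr := ny hr
    have hAc : Conn (ind A ({v} ∪ N)) {y, a} :=
      (Conn.singleton _ a).insert (mem_singleton_self a) (hadj y hyN a haN hyr har hya)
    rw [hSe]
    refine RM.of_bags4 (A := {v, r}) (B := {y, a}) (C := {b}) (D := {c}) (by simp) (by simp)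
      (by simp) (by simp) hRc hAc (Conn.singleton _ b) (Conn.singleton _ c) ?_ ?_ ?_ ?_ ?_ ?_ le_rfl
      (fun _ => Tw.of_adj (a := v) (b := a) (by simp) (by simp) (hva a haN))
      (fun _ => Tw.of_adj (a := v) (b := b) (by simp) (by simp) (hva b hbN))
      (fun _ => Tw.of_adj (a := v) (b := c) (by simp) (by simp) (hva c hcN))
      (fun _ => Tw.of_adj (a := y) (b := b) (by simp) (by simp) (hadj y hyN b hbN hyr hbr hyb))
      (fun _ => Tw.of_adj (a := a) (b := c) (by simp) (by simp) (hadj a haN c hcN har hcr hac'))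
      (fun _ => Tw.of_adj (a := b) (b := c) (by simp) (by simp) (hadj b hbN c hcN hbr hcr hbc'))
    · simp [nv haN, nv hyN, har, hyr]
    · simp [nv hbN, hbr]
    · simp [nv hcN, hcr]
    · simp [(ny hbS).symm, hab.symm]
    · simp [(ny hcS).symm, hac.symm]
    · simp [hbc]
  · push Not at hm'
    rw [hSe]
    refine RM.of_bags4 (A := {v, r}) (B := {a}) (C := {b}) (D := {c}) (by simp) (by simp)
      (by simp) (by simp) hRc (Conn.singleton _ a) (Conn.singleton _ b) (Conn.singleton _ c)
      ?_ ?_ ?_ ?_ ?_ ?_ le_rfl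
      (fun _ => Tw.of_adj (a := v) (b := a) (by simp) (by simp) (hva a haN))
      (fun _ => Tw.of_adj (a := v) (b := b) (by simp) (by simp) (hva b hbN))
      (fun _ => Tw.of_adj (a := v) (b := c) (by simp) (by simp) (hva c hcN))
      (fun _ => Tw.of_adj (a := a) (b := b) (by simp) (by simp)
        (hadj a haN b hbN har hbr (hm' a ma b mb hab)))
      (fun _ => Tw.of_adj (a := a) (b := c) (by simp) (by simp)
        (hadj a haN c hcN har hcr (hm' a ma c mc hac)))
      (fun _ => Tw.of_adj (a := b) (b := c) (by simp) (by simp)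
        (hadj b hbN c hcN hbr hcr (hm' b mb c mc hbc)))
    · simp [nv haN, har]
    · simp [nv hbN, hbr]
    · simp [nv hcN, hcr]
    · simp [hab]
    · simp [hac]
    · simp [hbc]

theorem Crit.k4_of_degree_le_five (c : Crit θ P K G W Z) {v r₁ r₂ : V} (hv : v ∈ W)
    (hN : (nbv G v).card ≤ 5) (h3 : ∀ u ∈ nbv G v, 3 ≤ (nbv G u ∩ nbv G v).card)
    {A : SimpleGraph V} (hA : tch G W ≤ A)
    (hr : ∀ a ∈ nbv G v, ∀ b ∈ nbv G v, G.Adj a b → A.Adj a b ∨ a = r₁ ∧ b = r₂ ∨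
      a = r₂ ∧ b = r₁) : RM Z A (cliq Z) := by
  have hvN : v ∉ nbv G v := fun h => (mem_nbv.1 h).ne rfl
  obtain ⟨π, h1, h2⟩ := link_lemma c.adm c.hZ (fun X hX hne h => c.not_rig hX hne h)
    (X := {v}) (by simpa using hv) (singleton_nonempty v) (by
      rw [nb_singleton]
      exact fun S hS hS3 => tri_of_nbhd hN h3 hS hS3 hvN fun u hu => mem_nbv.1 hu)
  rw [nb_singleton] at h1 h2
  obtain ⟨S, hS⟩ : ∃ S, S = Z.image π.symm := ⟨_, rfl⟩
  have hSN : S ⊆ nbv G v := by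
    rw [hS]
    intro x hx
    obtain ⟨z, hz, rfl⟩ := mem_image.1 hx
    exact h1 z hz
  have hS4 : S.card = 4 := by rw [hS, card_image_of_injective _ π.symm.injective, c.hZ]
  obtain ⟨r, hrS, hrA⟩ : ∃ r ∈ S, ∀ a ∈ nbv G v, ∀ b ∈ nbv G v, a ≠ r → b ≠ r →
      G.Adj a b → A.Adj a b := by
    by_cases e1 : r₁ ∈ S
    · refine ⟨r₁, e1, fun a ha b hb h1 h2 h => (hr a ha b hb h).resolve_right ?_⟩
      rintro (h | h)
      exacts [h1 h.1, h2 h.2]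
    by_cases e2 : r₂ ∈ S
    · refine ⟨r₂, e2, fun a ha b hb h1 h2 h => (hr a ha b hb h).resolve_right ?_⟩
      rintro (h | h)
      exacts [h2 h.2, h1 h.1]
    obtain ⟨r, hrS⟩ := card_pos.1 (show 0 < S.card by omega)
    refine ⟨r, hrS, fun a ha b hb _ _ h => (hr a ha b hb h).resolve_right ?_⟩
    have h4 : (nbv G v \ S).card ≤ 1 := by
      have := card_sdiff_add_card_eq_card hSN
      omega
    rw [card_le_one] at h4
    rintro (⟨rfl, rfl⟩ | ⟨rfl, rfl⟩)
    · exact h.ne (h4 _ (mem_sdiff.2 ⟨ha, e1⟩) _ (mem_sdiff.2 ⟨hb, e2⟩))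
    · exact h.ne (h4 _ (mem_sdiff.2 ⟨ha, e2⟩) _ (mem_sdiff.2 ⟨hb, e1⟩))
  have h4 := k4_of_nbhd (A := A) hN h3 hSN hS4 hvN
    (fun u hu => hA ⟨mem_nbv.1 hu, .inl hv⟩) hrS hrA
  have h5 := h4.perm π (Z := Z) fun z hz => hS ▸ mem_image_of_mem _ hz
  rw [hS, pm_cliq] at h5
  exact (h2 A hA).trans h5

end

section

variable {V : Type} [Fintype V]
variable {θ : ℤ} {P : SimpleGraph V → Prop} {K G : SimpleGraph V} {W Z : Finset V}

/-- For some `x ∈ Z`, the graph `G` has rooted minors on `Z` isomorphic to every `K₄` minus an edge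
not containing `x`, and to the triangle on `Z \ {x}`. -/
def PT (G : SimpleGraph V) (Z : Finset V) : Prop :=
  ∃ x ∈ Z, (∀ s ∈ Z, ∀ t ∈ Z, s ≠ x → t ≠ x → s ≠ t → RM Z G (cm Z s t)) ∧
    RM Z G (cliq (Z.erase x))

theorem cliq_mono {S T : Finset V} (h : S ⊆ T) : cliq S ≤ cliq T :=
  fun _ _ hab => ⟨hab.1, h hab.2.1, h hab.2.2⟩

theorem cm_le {S : Finset V} {s t : V} : cm S s t ≤ cliq S := fun _ _ h => ⟨h.1, h.2.1, h.2.2.1⟩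

theorem PT.trans {A B : SimpleGraph V} (hr : RM Z A B) (h : PT B Z) : PT A Z := by
  obtain ⟨x, hx, h1, h2⟩ := h
  exact ⟨x, hx, fun s hs t ht a b c => hr.trans (h1 s hs t ht a b c), hr.trans h2⟩

theorem PT.of_cliq (hne : Z.Nonempty) {A : SimpleGraph V} (h : RM Z A (cliq Z)) : PT A Z := by
  obtain ⟨x, hx⟩ := hne
  exact ⟨x, hx, fun s _ t _ _ _ _ => h.mono le_rfl cm_le subset_rfl,
    h.mono le_rfl (cliq_mono (erase_subset _ _)) subset_rfl⟩

theorem exists_fourth {S : Finset V} (hS : S.card = 4) {x s t : V} (hx : x ∈ S) (hs : s ∈ S)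
    (ht : t ∈ S) (hsx : s ≠ x) (htx : t ≠ x) (hst : s ≠ t) :
    ∃ a, a ≠ x ∧ a ≠ s ∧ a ≠ t ∧ S = {x, a, s, t} := by
  have hs' : s ∈ S.erase x := mem_erase.2 ⟨hsx, hs⟩
  have ht' : t ∈ (S.erase x).erase s := mem_erase.2 ⟨hst.symm, mem_erase.2 ⟨htx, ht⟩⟩
  have e1 := card_erase_add_one hx
  have e2 := card_erase_add_one hs'
  have e3 := card_erase_add_one ht'
  obtain ⟨a, ha⟩ := card_eq_one.1 (show (((S.erase x).erase s).erase t).card = 1 by omega)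
  have hm : a ∈ ((S.erase x).erase s).erase t := ha ▸ mem_singleton_self a
  simp only [mem_erase] at hm
  refine ⟨a, hm.2.2.1, hm.2.1, hm.1, ?_⟩
  rw [← insert_erase hx, ← insert_erase hs', ← insert_erase ht', ha]
  ext y
  simp only [mem_insert, mem_singleton]
  tauto

theorem PT.tri {A : SimpleGraph V} {S T : Finset V} (h : PT A S) (hS : S.card = 4) (hT : T ⊆ S)
    (hT3 : T.card ≤ 3) : RM T A (cliq T) := by
  obtain ⟨x, hx, h1, h2⟩ := h
  by_cases hxT : x ∈ T
  · obtain ⟨s, hs, hsT⟩ : ∃ s ∈ S, s ∉ T := by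
      by_contra hc
      push Not at hc
      have := card_le_card (show S ⊆ T from hc)
      omega
    have hsx : s ≠ x := fun e => hsT (e ▸ hxT)
    have e1 := card_erase_add_one hx
    have e2 := card_erase_add_one (mem_erase.2 ⟨hsx, hs⟩)
    obtain ⟨t, ht⟩ := card_pos.1 (show 0 < ((S.erase x).erase s).card by omega)
    simp only [mem_erase] at ht
    refine (h1 s hs t ht.2.2 hsx ht.2.1 (Ne.symm ht.1)).mono le_rfl (fun a b hab => ?_) hT
    exact ⟨hab.1, hT hab.2.1, hT hab.2.2, fun e => hsT (e.1 ▸ hab.2.1),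
      fun e => hsT (e.2 ▸ hab.2.2)⟩
  · exact h2.mono le_rfl (cliq_mono fun y hy => mem_erase.2 ⟨fun e => hxT (e ▸ hy), hT hy⟩) hT

theorem PT.perm {B : SimpleGraph V} {S : Finset V} (h : PT B S) (hS : S.card ≤ Z.card)
    (π : Equiv.Perm V) (hπ : ∀ z ∈ Z, π.symm z ∈ S) : PT (pm π B) Z := by
  obtain ⟨x, hx, h1, h2⟩ := h
  have e : Z.image π.symm = S := by
    refine eq_of_subset_of_card_le (fun y hy => ?_) ?_
    · obtain ⟨z, hz, rfl⟩ := mem_image.1 hy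
      exact hπ z hz
    · rwa [card_image_of_injective _ π.symm.injective]
  have hm : ∀ y, π.symm y ∈ S ↔ y ∈ Z := fun y => by
    rw [← e, mem_image]
    exact ⟨fun ⟨z, hz, h⟩ => π.symm.injective h ▸ hz, fun h => ⟨y, h, rfl⟩⟩
  refine ⟨π x, (hm _).1 (by simpa using hx), fun s hs t ht hsx htx hst => ?_, ?_⟩
  · refine ((h1 _ (hπ s hs) _ (hπ t ht) (fun e => hsx (by rw [← e]; simp))
      (fun e => htx (by rw [← e]; simp)) (fun e => hst (π.symm.injective e))).perm π hπ).mono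
      le_rfl ?_ subset_rfl
    rintro a b ⟨h1, h2, h3, h4, h5⟩
    refine ⟨fun e => h1 (π.symm.injective e), hπ a h2, hπ b h3, ?_, ?_⟩
    · exact fun e => h4 ⟨π.symm.injective e.1, π.symm.injective e.2⟩
    · exact fun e => h5 ⟨π.symm.injective e.1, π.symm.injective e.2⟩
  · refine (h2.perm π hπ).mono le_rfl ?_ subset_rfl
    rintro a b ⟨h1, h2, h3⟩
    rw [mem_erase] at h2 h3
    exact ⟨fun e => h1 (π.symm.injective e),
      mem_erase.2 ⟨fun e => h2.1 (by rw [← e]; simp), hπ a h2.2⟩,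
      mem_erase.2 ⟨fun e => h3.1 (by rw [← e]; simp), hπ b h3.2⟩⟩

theorem tch_adj_of_mem_nb {C : Finset V} (hC : C ⊆ W) {a : V} (ha : a ∈ nb G C) :
    ∃ y ∈ C, (tch G W).Adj y a := by
  obtain ⟨-, y, hy, h⟩ := mem_nb.1 ha
  exact ⟨y, hy, h, .inl (hC hy)⟩

/-- Two disjoint connected sets, one attaching to all of `Z` and one to all but one vertex. -/
theorem PT.of_conn (hZ : Z.card = 4) (hWZ : Disjoint W Z) {C D : Finset V} (hCW : C ⊆ W)
    (hDW : D ⊆ W) (hC : Conn G C) (hD : Conn G D) (hCD : Disjoint C D) {x : V} (hx : x ∈ Z)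
    (hZC : Z ⊆ nb G C) (hZD : Z.erase x ⊆ nb G D) : PT (tch G W) Z := by
  have nW : ∀ {z}, z ∈ Z → z ∉ W := fun h => Finset.disjoint_right.1 hWZ h
  have cC : ∀ {z}, z ∈ Z → Conn (tch G W) (insert z C) := fun hz => by
    obtain ⟨y, hy, h⟩ := tch_adj_of_mem_nb hCW (hZC hz)
    exact (hC.tch hCW).insert hy h.symm
  have cD : ∀ {z}, z ∈ Z → z ≠ x → Conn (tch G W) (insert z D) := fun hz hzx => by
    obtain ⟨y, hy, h⟩ := tch_adj_of_mem_nb hDW (hZD (mem_erase.2 ⟨hzx, hz⟩))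
    exact (hD.tch hDW).insert hy h.symm
  have tC : ∀ {a b} {B : Finset V}, b ∈ Z → b ∈ B → Tw (tch G W) (insert a C) B :=
    fun hb hB => by
      obtain ⟨y, hy, h⟩ := tch_adj_of_mem_nb hCW (hZC hb)
      exact ⟨y, mem_insert_of_mem hy, _, hB, h⟩
  have tD : ∀ {a b} {B : Finset V}, b ∈ Z → b ≠ x → b ∈ B → Tw (tch G W) (insert a D) B :=
    fun hb hbx hB => by
      obtain ⟨y, hy, h⟩ := tch_adj_of_mem_nb hDW (hZD (mem_erase.2 ⟨hbx, hb⟩))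
      exact ⟨y, mem_insert_of_mem hy, _, hB, h⟩
  have nC : ∀ {z}, z ∈ Z → z ∉ C := fun hz h => nW hz (hCW h)
  have nD : ∀ {z}, z ∈ Z → z ∉ D := fun hz h => nW hz (hDW h)
  refine ⟨x, hx, fun s hs t ht hsx htx hst => ?_, ?_⟩
  · obtain ⟨a, hax, has, hat, hZe⟩ := exists_fourth hZ hx hs ht hsx htx hst
    have ha : a ∈ Z := hZe ▸ by simp
    have hH : cm Z s t ≤ cliq {x, a, s, t} := hZe ▸ cm_le
    have key : RM {x, a, s, t} (tch G W) (cm Z s t) :=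
      RM.of_bags4 (A := insert x C) (B := insert a D) (C := {s}) (D := {t}) (by simp) (by simp)
        (by simp) (by simp) (cC hx) (cD ha hax) (Conn.singleton _ s) (Conn.singleton _ t)
        (by simp [hCD, nC ha, nD hx, hax]) (by simp [nC hs, hsx])
        (by simp [nC ht, htx]) (by simp [nD hs, has.symm]) (by simp [nD ht, hat.symm])
        (by simp [hst])
        hH (fun _ => tC ha (by simp)) (fun _ => tC hs (by simp)) (fun _ => tC ht (by simp))
        (fun _ => tD hs hsx (by simp)) (fun _ => tD ht htx (by simp))
        (fun h => absurd ⟨rfl, rfl⟩ h.2.2.2.1)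
    rwa [← hZe] at key
  · have e1 := card_erase_add_one hx
    obtain ⟨a, b, c, hab, hac, hbc, he⟩ := card_eq_three.1 (show (Z.erase x).card = 3 by omega)
    have hZe : Z = {a, b, c, x} := by
      rw [← insert_erase hx, he]
      ext y
      simp only [mem_insert, mem_singleton]
      tauto
    obtain ⟨hax, ha⟩ := mem_erase.1 (show a ∈ Z.erase x by simp [he])
    obtain ⟨hbx, hb⟩ := mem_erase.1 (show b ∈ Z.erase x by simp [he])
    obtain ⟨hcx, hc⟩ := mem_erase.1 (show c ∈ Z.erase x by simp [he])
    have hH : cliq (Z.erase x) ≤ cliq {a, b, c, x} := by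
      rw [← hZe]; exact cliq_mono (erase_subset _ _)
    have no : ∀ {y}, ¬ (cliq (Z.erase x)).Adj y x := fun h => (mem_erase.1 h.2.2).1 rfl
    have key : RM {a, b, c, x} (tch G W) (cliq (Z.erase x)) :=
      RM.of_bags4 (A := insert a C) (B := insert b D) (C := {c}) (D := {x}) (by simp) (by simp)
        (by simp) (by simp) (cC ha) (cD hb hbx) (Conn.singleton _ c) (Conn.singleton _ x)
        (by simp [hCD, nC hb, nD ha, hab.symm]) (by simp [nC hc, hac.symm])
        (by simp [nC hx, hax.symm]) (by simp [nD hc, hbc.symm]) (by simp [nD hx, hbx.symm])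
        (by simp [hcx]) hH
        (fun _ => tC hb (by simp)) (fun _ => tC hc (by simp)) (fun h => absurd h no)
        (fun _ => tD hc hcx (by simp)) (fun h => absurd h no) (fun h => absurd h no)
    rwa [← hZe] at key

theorem tch_sup_eq {R : SimpleGraph V} {X Y : Finset V} (hR : R ≤ cliq (nb G X)) (hY : Y ⊆ X) :
    tch (tch G X ⊔ R) Y = tch G Y := by
  ext a b
  have h1 : R.Adj a b → a ∉ X ∧ b ∉ X := fun h =>
    ⟨(mem_nb.1 (hR h).2.1).1, (mem_nb.1 (hR h).2.2).1⟩
  have h2 : ∀ {x}, x ∈ Y → x ∈ X := fun h => hY h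
  change ((G.Adj a b ∧ (a ∈ X ∨ b ∈ X) ∨ R.Adj a b) ∧ (a ∈ Y ∨ b ∈ Y)) ↔
    G.Adj a b ∧ (a ∈ Y ∨ b ∈ Y)
  constructor
  · rintro ⟨h | h, h'⟩
    · exact ⟨h.1, h'⟩
    · exact absurd (h'.imp h2 h2) (not_or.2 (h1 h))
  · exact fun h => ⟨.inl ⟨h.1, h.2.imp h2 h2⟩, h.2⟩

theorem adm_tch_sup {R : SimpleGraph V} {X : Finset V} (hR : R ≤ cliq (nb G X)) :
    Adm (tch G X ⊔ R) X (nb G X) := by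
  refine ⟨nb_disj, fun u v huv => ?_⟩
  rcases huv with ⟨h, hu | hv⟩ | h
  · exact .inl hu
  · by_cases hu : u ∈ X
    · exact .inl hu
    · exact .inr (mem_nb.2 ⟨hu, v, hv, h.symm⟩)
  · exact .inr (hR h).2.1

theorem Sp.tch_sup {R : SimpleGraph V} {X : Finset V} (h : Sp G W) (hX : X ⊆ W)
    (hR : R ≤ cliq (nb G X)) : Sp (tch G X ⊔ R) X := fun Y hY hY3 => by
  have e := tch_sup_eq hR hY
  rw [nb_eq_of_tch e] at hY3
  rw [dd_eq_of_tch e]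
  exact h Y (hY.trans hX) hY3

theorem ed_tch_sup {R : SimpleGraph V} {X : Finset V} (hR : R ≤ cliq (nb G X)) :
    ed (tch G X ⊔ R) = rho G X + ed R := by
  rw [ed_sup_disj, rho]
  rintro a b ⟨-, h⟩ hab
  exact h.elim (fun h => (mem_nb.1 (hR hab).2.1).1 h) fun h => (mem_nb.1 (hR hab).2.2).1 h

theorem ed_ind_le_six {S : Finset V} (h : S.card = 4) : ed (ind G S) ≤ 6 := by
  rw [← ed_cliq h]
  exact ed_mono fun a b hab => ⟨hab.1.ne, hab.2.1, hab.2.2⟩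

theorem exists_erase_subset {N : Finset V} (hZ : Z.card = 4) (h : 3 ≤ (N ∩ Z).card) :
    ∃ x ∈ Z, Z.erase x ⊆ N := by
  have h1 := card_sdiff_add_card_inter Z N
  rw [inter_comm] at h1
  by_cases h0 : Z ⊆ N
  · obtain ⟨x, hx⟩ := card_pos.1 (show 0 < Z.card by omega)
    exact ⟨x, hx, (erase_subset _ _).trans h0⟩
  · obtain ⟨x, hx, hxN⟩ := not_subset.1 h0
    refine ⟨x, hx, fun y hy => ?_⟩
    by_contra hyN
    obtain ⟨hyx, hyZ⟩ := mem_erase.1 hy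
    exact hyx (card_le_one.1 (show (Z \ N).card ≤ 1 by omega) y (mem_sdiff.2 ⟨hyZ, hyN⟩) x
      (mem_sdiff.2 ⟨hx, hxN⟩))

end

section

variable {V : Type} [Fintype V]
variable {θ : ℤ} {P : SimpleGraph V → Prop} {K G : SimpleGraph V} {W Z : Finset V}

theorem tch_le_sdiff_cliq (h : Disjoint W Z) : tch G W ≤ G \ cliq Z := fun _ _ hab =>
  ⟨hab.1, fun hc => hab.2.elim (fun ha => Finset.disjoint_left.1 h ha hc.2.1)
    fun hb => Finset.disjoint_left.1 h hb hc.2.2⟩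

theorem tch_mono {X : Finset V} (h : X ⊆ W) : tch G X ≤ tch G W :=
  fun _ _ hab => ⟨hab.1, hab.2.imp (fun x => h x) fun x => h x⟩

theorem tch_le_ind {X : Finset V} : tch G X ≤ ind G (X ∪ nb G X) := by
  have key : ∀ a b, G.Adj a b → a ∈ X → a ∈ X ∪ nb G X ∧ b ∈ X ∪ nb G X := fun a b hab ha => by
    refine ⟨mem_union_left _ ha, ?_⟩
    by_cases hb : b ∈ X
    · exact mem_union_left _ hb
    · exact mem_union_right _ (mem_nb.2 ⟨hb, a, ha, hab⟩)
  rintro a b ⟨hab, h | h⟩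
  · exact ⟨hab, key a b hab h⟩
  · exact ⟨hab, (key b a hab.symm h).symm⟩

/-- The critical configuration for `PT`. -/
abbrev CritPT (G : SimpleGraph V) (W Z : Finset V) : Prop :=
  Crit 8 (fun G' => PT (G' \ cliq Z) Z) (cliq Z) G W Z

theorem CritPT.dd_le_one (c : CritPT G W Z)
    (ih : ∀ (G' : SimpleGraph V) (W' Z' : Finset V), W'.card < W.card → Adm G' W' Z' →
      Z'.card = 4 → Sp G' W' → cliq Z' ≤ G' → 8 ≤ ed G' - 3 * (W'.card : ℤ) →
      PT (G' \ cliq Z') Z')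
    {X : Finset V} (hX : X ⊆ W) (hXW : X ≠ W) (h4 : (nb G X).card = 4) : dd G X ≤ 1 := by
  by_contra h2
  have hed := ed_tch_sup (G := G) (X := X) (R := cliq (nb G X)) le_rfl
  rw [ed_cliq h4] at hed
  have hpt := ih (tch G X ⊔ cliq (nb G X)) X (nb G X) (card_lt_card (hX.ssubset_of_ne hXW))
    (adm_tch_sup le_rfl) h4 (c.sp.tch_sup hX le_rfl) le_sup_right (by unfold dd at h2; omega)
  have hle : (tch G X ⊔ cliq (nb G X)) \ cliq (nb G X) ≤ tch G X := fun a b h =>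
    h.1.resolve_right h.2
  have hpt' : PT (tch G X) (nb G X) := hpt.trans (RM.of_le hle)
  have hne : X.Nonempty := by
    rw [nonempty_iff_ne_empty]
    rintro rfl
    rw [dd_empty] at h2
    omega
  obtain ⟨π, h1, h3⟩ := link_lemma c.adm c.hZ (fun X hX hne h => c.not_rig hX hne h) hX hne
    fun S hS hS3 => (hpt'.tri h4 hS hS3).mono tch_le_ind le_rfl subset_rfl
  have hA := tch_le_sdiff_cliq (G := G) c.adm.1
  refine c.hP (PT.trans (h3 _ hA) (PT.perm (PT.trans (RM.of_le ?_) hpt') (by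
    rw [h4, c.hZ]) π h1))
  exact fun a b hab => ⟨hA (tch_mono hX hab), (tch_le_ind hab).2⟩

theorem CritPT.not_cut (c : CritPT G W Z)
    (hd : ∀ X ⊆ W, X ≠ W → (nb G X).card = 4 → dd G X ≤ 1) (X : Finset V) : ¬ Cut G W X := by
  intro h
  obtain ⟨X, hX, hmax⟩ := h.exists_max
  refine c.star_false (fun Y hY hYW h4 => ?_) hX hmax (hd X hX.1 hX.2.1 hX.2.2.2.1)
  have := hd Y hY hYW h4
  have := ed_ind_le_six (G := G) h4
  omega

theorem CritPT.not_gadget (c : CritPT G W Z) {C D : Finset V} (hCW : C ⊆ W) (hDW : D ⊆ W)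
    (hC : Conn G C) (hD : Conn G D) (hCD : Disjoint C D) {x : V} (hx : x ∈ Z)
    (hZC : Z ⊆ nb G C) (hZD : Z.erase x ⊆ nb G D) : False :=
  c.hP (PT.trans (RM.of_le (tch_le_sdiff_cliq c.adm.1))
    (PT.of_conn c.hZ c.adm.1 hCW hDW hC hD hCD hx hZC hZD))

theorem Sp.four_le (h : Sp G W) {C : Finset V} (hC : C ⊆ W) (h1 : 1 ≤ dd G C) :
    4 ≤ (nb G C).card := by
  by_contra h4
  have := h C hC (by omega)
  omega

theorem CritPT.two_le_dd (c : CritPT G W Z) : 2 ≤ dd G W := by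
  have h1 := c.adm.ed_eq
  have h2 := ed_ind_le_six (G := G) c.hZ
  have h3 := c.hE
  omega

theorem dd_sdiff_of_closed {C S : Finset V} (hCS : C ⊆ S)
    (h : ∀ x ∈ C, ∀ y ∈ S, y ∉ C → ¬ G.Adj x y) : dd G S = dd G C + dd G (S \ C) := by
  rw [← dd_union disjoint_sdiff fun x hx y hy => h x hx y (mem_sdiff.1 hy).1 (mem_sdiff.1 hy).2,
    union_sdiff_of_subset hCS]

theorem Adm.nb_sub_of_closed (h : Adm G W Z) {C S : Finset V}
    (hc : ∀ x ∈ C, ∀ y ∈ S, y ∉ C → ¬ G.Adj x y) : nb G C ⊆ (W \ S) ∪ Z := by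
  intro y hy
  obtain ⟨hyC, x, hx, hxy⟩ := mem_nb.1 hy
  rcases h.2 y x hxy.symm with hyW | hyZ
  · exact mem_union_left _ (mem_sdiff.2 ⟨hyW, fun hyS => hc x hx y hyS hyC hxy⟩)
  · exact mem_union_right _ hyZ

theorem CritPT.conn (c : CritPT G W Z)
    (hd : ∀ X ⊆ W, X ≠ W → (nb G X).card = 4 → dd G X ≤ 1) : Conn G W := by
  obtain ⟨C, hCW, hC, hcl, hC1⟩ := exists_comp_of_dd (G := G) W (by have := c.two_le_dd; omega)
  by_cases hne : C = W
  · exact hne ▸ hC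
  have hZof : ∀ D ⊆ W, nb G D ⊆ (W \ W) ∪ Z → 1 ≤ dd G D → nb G D = Z := by
    intro D hD h h1
    rw [sdiff_self, bot_eq_empty, empty_union] at h
    exact eq_of_subset_of_card_le h (by rw [c.hZ]; exact c.sp.four_le hD h1)
  have hCZ := hZof C hCW (c.adm.nb_sub_of_closed hcl) hC1
  have h1 := hd C hCW hne (by rw [hCZ, c.hZ])
  have h2 := dd_sdiff_of_closed hCW hcl
  have h3 := c.two_le_dd
  obtain ⟨D, hDW, hD, hcl', hD1⟩ := exists_comp_of_dd (G := G) (W \ C) (by omega)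
  have hDZ := hZof D (hDW.trans sdiff_subset) (c.adm.nb_sub_of_closed
    fun x hx y hy hyD hxy => by
      by_cases hyC : y ∈ C
      · exact hcl y hyC x (mem_sdiff.1 (hDW hx)).1 (mem_sdiff.1 (hDW hx)).2 hxy.symm
      · exact hcl' x hx y (mem_sdiff.2 ⟨hy, hyC⟩) hyD hxy) hD1
  obtain ⟨x, hx⟩ := card_pos.1 (show 0 < Z.card by rw [c.hZ]; norm_num)
  exact (c.not_gadget hCW (hDW.trans sdiff_subset) hC hD (disjoint_sdiff.mono_right hDW) hx
    hCZ.symm.subset ((erase_subset _ _).trans hDZ.symm.subset)).elim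

theorem CritPT.card_nbv_inter_le (c : CritPT G W Z)
    (hd : ∀ X ⊆ W, X ≠ W → (nb G X).card = 4 → dd G X ≤ 1) {v : V} (hv : v ∈ W) :
    (nbv G v ∩ Z).card ≤ 2 := by
  by_contra h3
  have hvZ : ∀ {z}, z ∈ nbv G v ∩ Z → G.Adj v z ∧ z ∈ Z := fun h =>
    ⟨mem_nbv.1 (mem_inter.1 h).1, (mem_inter.1 h).2⟩
  have nW : ∀ {z}, z ∈ Z → z ∉ W := fun h => Finset.disjoint_right.1 c.adm.1 h
  have hW := insert_erase hv
  have hdW := dd_insert G (notMem_erase v W)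
  rw [hW] at hdW
  have hsub : nbv G v \ W.erase v ⊆ nbv G v ∩ Z := by
    intro y hy
    obtain ⟨hy, hyW⟩ := mem_sdiff.1 hy
    have hvy := mem_nbv.1 hy
    refine mem_inter.2 ⟨hy, (c.adm.2 y v hvy.symm).resolve_left fun h => hyW ?_⟩
    exact mem_erase.2 ⟨hvy.ne.symm, h⟩
  have h1 := card_le_card hsub
  have h2 : (nbv G v ∩ Z).card ≤ 4 := c.hZ ▸ card_le_card inter_subset_right
  have h5 := c.two_le_dd
  obtain ⟨C, hCv, hC, hcl, hC1⟩ := exists_comp_of_dd (G := G) (W.erase v) (by omega)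
  have hCW : C ⊆ W := hCv.trans (erase_subset _ _)
  have hvC : v ∉ C := fun h => (mem_erase.1 (hCv h)).1 rfl
  have hnbC : nb G C ⊆ insert v Z := by
    refine (c.adm.nb_sub_of_closed hcl).trans fun y hy => ?_
    rcases mem_union.1 hy with hy | hy
    · rw [mem_sdiff, mem_erase] at hy
      exact mem_insert.2 (.inl (by tauto))
    · exact mem_insert_of_mem hy
  have hC4 := c.sp.four_le hCW hC1
  have hCZ : 3 ≤ (nb G C ∩ Z).card := by
    have h : nb G C ⊆ insert v (nb G C ∩ Z) := fun y hy => by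
      rcases mem_insert.1 (hnbC hy) with h | h
      · exact mem_insert.2 (.inl h)
      · exact mem_insert_of_mem (mem_inter.2 ⟨hy, h⟩)
    have := (card_le_card h).trans (card_insert_le _ _)
    omega
  have hD : Conn G (W \ C) := (c.conn hd).sdiff hv hvC fun x hx y hy hyC hyv =>
    hcl x hx y (mem_erase.2 ⟨hyv, hy⟩) hyC
  have hvD : v ∈ W \ C := mem_sdiff.2 ⟨hv, hvC⟩
  have hZD : nbv G v ∩ Z ⊆ nb G (W \ C) := fun z hz =>
    mem_nb.2 ⟨fun h => nW (hvZ hz).2 (mem_sdiff.1 h).1, v, hvD, (hvZ hz).1⟩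
  by_cases hD' : Z ⊆ nb G (W \ C)
  · obtain ⟨x, hx, hxC⟩ := exists_erase_subset c.hZ hCZ
    exact c.not_gadget sdiff_subset hCW hD hC sdiff_disjoint hx hD' hxC
  obtain ⟨z, hz, hzD⟩ := not_subset.1 hD'
  have hvz : nbv G v ∩ Z ⊆ Z.erase z := fun y hy =>
    mem_erase.2 ⟨fun e => hzD (hZD (e ▸ hy)), (hvZ hy).2⟩
  have ez := card_erase_add_one hz
  have hvz' : nbv G v ∩ Z = Z.erase z := eq_of_subset_of_card_le hvz (by rw [c.hZ] at ez; omega)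
  by_cases hC' : Z ⊆ nb G C
  · exact c.not_gadget hCW sdiff_subset hC hD disjoint_sdiff hz hC' (hvz' ▸ hZD)
  obtain ⟨z', hz', hz'C⟩ := not_subset.1 hC'
  have hvnC : v ∈ nb G C := by
    by_contra h
    have h6 : nb G C ⊆ Z.erase z' := fun y hy => mem_erase.2 ⟨fun e => hz'C (e ▸ hy),
      mem_of_mem_insert_of_ne (hnbC hy) fun e => h (e ▸ hy)⟩
    have h7 := card_le_card h6
    have := card_erase_add_one hz'
    rw [c.hZ] at this
    omega
  have hC4' : (nb G C).card = 4 := by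
    have h6 : nb G C ⊆ (insert v Z).erase z' := fun y hy =>
      mem_erase.2 ⟨fun e => hz'C (e ▸ hy), hnbC hy⟩
    have h7 := card_le_card h6
    have := card_erase_add_one (mem_insert_of_mem (b := v) hz')
    rw [card_insert_of_notMem (fun h => nW h hv), c.hZ] at this
    omega
  have hd1 := hd C hCW (fun e => hvC (e ▸ hv)) hC4'
  have hdC := dd_sdiff_of_closed hCv hcl
  have h8 := card_le_card hvz
  rw [c.hZ] at ez
  obtain ⟨E, hEs, hE, hcl', hE1⟩ := exists_comp_of_dd (G := G) (W.erase v \ C) (by omega)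
  have hEv : E ⊆ W.erase v := hEs.trans sdiff_subset
  have hEW : E ⊆ W := hEv.trans (erase_subset _ _)
  have hvE : v ∉ E := fun h => (mem_erase.1 (hEv h)).1 rfl
  have hEn := c.sp.four_le hEW hE1
  have hEz : nb G E ⊆ insert v (Z.erase z) := by
    intro y hy
    have h := c.adm.nb_sub_of_closed (fun x hx w hw hwE hxw => by
      by_cases hwC : w ∈ C
      · exact hcl w hwC x (hEv hx) (mem_sdiff.1 (hEs hx)).2 hxw.symm
      · exact hcl' x hx w (mem_sdiff.2 ⟨hw, hwC⟩) hwE hxw) hy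
    rcases mem_union.1 h with h | h
    · rw [mem_sdiff, mem_erase] at h
      exact mem_insert.2 (.inl (by tauto))
    · refine mem_insert_of_mem (mem_erase.2 ⟨?_, h⟩)
      rintro rfl
      obtain ⟨-, x, hx, hxy⟩ := mem_nb.1 hy
      exact hzD (mem_nb.2 ⟨fun h' => nW h (mem_sdiff.1 h').1, x,
        mem_sdiff.2 ⟨hEW hx, (mem_sdiff.1 (hEs hx)).2⟩, hxy⟩)
  have hEe : nb G E = insert v (Z.erase z) := eq_of_subset_of_card_le hEz
    ((card_insert_le _ _).trans (by omega))
  obtain ⟨-, y, hy, hyv⟩ := mem_nb.1 hvnC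
  refine c.not_gadget (insert_subset hv hCW) hEW (hC.insert hy hyv.symm) hE ?_ hz ?_
    (hEe ▸ subset_insert _ _)
  · rw [disjoint_insert_left]
    exact ⟨hvE, disjoint_sdiff.mono_right hEs⟩
  · intro y hyZ
    have hyn : y ∉ insert v C := fun h => nW hyZ (insert_subset hv hCW h)
    by_cases hyz : y = z
    · subst hyz
      obtain ⟨-, w, hw, hwy⟩ := mem_nb.1 (show y ∈ nb G W from (Crit.nb_W c).symm ▸ hyZ)
      refine mem_nb.2 ⟨hyn, w, mem_insert_of_mem ?_, hwy⟩
      by_contra hwC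
      exact hzD (mem_nb.2 ⟨fun h' => nW hyZ (mem_sdiff.1 h').1, w, mem_sdiff.2 ⟨hw, hwC⟩, hwy⟩)
    · have : y ∈ nbv G v ∩ Z := hvz' ▸ mem_erase.2 ⟨hyz, hyZ⟩
      exact mem_nb.2 ⟨hyn, v, mem_insert_self _ _, (hvZ this).1⟩

theorem exists_subset_pair {S : Finset V} (h : S.card ≤ 2) (v : V) :
    ∃ r₁ r₂, ∀ x ∈ S, x = r₁ ∨ x = r₂ := by
  rcases (show S.card = 0 ∨ S.card = 1 ∨ S.card = 2 by omega) with h | h | h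
  · rw [card_eq_zero] at h
    exact ⟨v, v, by simp [h]⟩
  · obtain ⟨a, rfl⟩ := card_eq_one.1 h
    exact ⟨a, a, by simp⟩
  · obtain ⟨a, b, -, rfl⟩ := card_eq_two.1 h
    exact ⟨a, b, by simp⟩

theorem Crit.exists_degree_le_five (c : Crit θ P K G W Z) {k : ℕ}
    (hz : ∀ z ∈ Z, k ≤ (nbv G z).card) (hE : 2 * (ed G : ℤ) < 6 * (W.card : ℤ) + 4 * k) :
    ∃ v ∈ W, (nbv G v).card ≤ 5 := by
  by_contra h
  push Not at h
  have h1 := c.adm.sum_deg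
  have h2 := card_nsmul_le_sum W (fun v => (nbv G v).card) 6 fun v hv => h v hv
  have h3 := card_nsmul_le_sum Z (fun v => (nbv G v).card) k hz
  rw [c.hZ] at h3
  simp only [smul_eq_mul] at h2 h3
  omega

theorem CritPT.false (c : CritPT G W Z)
    (hd : ∀ X ⊆ W, X ≠ W → (nb G X).card = 4 → dd G X ≤ 1) : False := by
  have hnc := c.not_cut hd
  have h3 : ∀ {u v}, v ∈ W → G.Adj u v → 3 ≤ (nbv G u ∩ nbv G v).card :=
    fun hv h => Crit.common c hnc hv h
  have hzW : ∀ z ∈ Z, 3 ≤ (nbv G z ∩ W).card := by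
    intro z hz
    obtain ⟨-, w, hw, hwz⟩ := mem_nb.1 (show z ∈ nb G W from (Crit.nb_W c).symm ▸ hz)
    have h1 := h3 hw hwz.symm
    have h2 := c.card_nbv_inter_le hd hw
    have h4 := card_erase_add_one (mem_inter.2 ⟨mem_nbv.2 hwz, hz⟩)
    have h5 : nbv G z ∩ nbv G w ⊆ ((nbv G z ∩ W).erase w) ∪ ((nbv G w ∩ Z).erase z) := by
      intro y hy
      obtain ⟨hyz, hyw⟩ := mem_inter.1 hy
      rw [mem_nbv] at hyz hyw
      rcases c.adm.2 y z hyz.symm with h | h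
      · exact mem_union_left _ (mem_erase.2 ⟨hyw.ne.symm, mem_inter.2 ⟨mem_nbv.2 hyz, h⟩⟩)
      · exact mem_union_right _ (mem_erase.2 ⟨hyz.ne.symm, mem_inter.2 ⟨mem_nbv.2 hyw, h⟩⟩)
    have h6 := (card_le_card h5).trans (card_union_le _ _)
    have h7 := card_erase_add_one (mem_inter.2 ⟨mem_nbv.2 hwz.symm, hw⟩)
    omega
  have hE8 : ed G - 3 * (W.card : ℤ) ≤ 8 := by
    by_contra h
    exact Crit.del_false c hnc (by omega) fun z hz => by have := hzW z hz; omega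
  have hzd : ∀ z ∈ Z, 6 ≤ (nbv G z).card := by
    intro z hz
    have h1 : (nbv G z ∩ W) ∪ Z.erase z ⊆ nbv G z := by
      refine union_subset inter_subset_left fun y hy => mem_nbv.2 (c.hK ?_)
      exact ⟨(mem_erase.1 hy).1.symm, hz, (mem_erase.1 hy).2⟩
    have h2 := card_le_card h1
    rw [card_union_of_disjoint (c.adm.1.mono inter_subset_right (erase_subset _ _))] at h2
    have h4 := card_erase_add_one hz
    have := c.hZ
    have := hzW z hz
    omega
  obtain ⟨v, hv, hv5⟩ := Crit.exists_degree_le_five c hzd (by omega)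
  obtain ⟨r₁, r₂, hr⟩ := exists_subset_pair (c.card_nbv_inter_le hd hv) v
  have hk := Crit.k4_of_degree_le_five c (A := G \ cliq Z) (r₁ := r₁) (r₂ := r₂) hv hv5
    (fun u hu => h3 hv (mem_nbv.1 hu).symm) (tch_le_sdiff_cliq c.adm.1)
    fun a ha b hb hab => by
      by_cases h : (cliq Z).Adj a b
      · have h1 := hr a (mem_inter.2 ⟨ha, h.2.1⟩)
        have h2 := hr b (mem_inter.2 ⟨hb, h.2.2⟩)
        have := hab.ne
        right
        rcases h1 with rfl | rfl <;> rcases h2 with rfl | rfl <;> simp_all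
      · exact .inl ⟨hab, h⟩
  exact c.hP (PT.of_cliq (card_pos.1 (by rw [c.hZ]; norm_num)) hk)

/-- A graph with a complete root set and two edges to spare has rooted minors isomorphic to `K₄`
minus an edge, in the sense of `PT`, that do not use the edges between the roots. -/
theorem exists_pt (G : SimpleGraph V) (W Z : Finset V) (hA : Adm G W Z) (hZ : Z.card = 4)
    (hs : Sp G W) (hK : cliq Z ≤ G) (hE : 8 ≤ ed G - 3 * (W.card : ℤ)) :
    PT (G \ cliq Z) Z := by
  induction hn : W.card using Nat.strong_induction_on generalizing G W Z with
  | _ n ih =>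
  induction hm : ed G using Nat.strong_induction_on generalizing G W with
  | _ m ih' =>
  subst hn hm
  by_contra hP
  have c : CritPT G W Z :=
    { adm := hA
      hZ := hZ
      sp := hs
      hK := hK
      hKZ := le_rfl
      hE := hE
      hZθ := by have := ed_ind_le_six (G := G) hZ; omega
      hP := hP
      pull := fun G' hr h => h.trans hr.sdiff_cliq
      ih := fun G' W' hlt hA' hs' hK' hE' => by
        rcases hlt with hlt | ⟨he, hlt⟩
        · exact ih _ hlt G' W' Z hA' hZ hs' hK' hE' rfl
        · exact ih' _ hlt G' W' hA' hs' hK' hE' he rfl }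
  exact c.false fun X hX hXW h4 => c.dd_le_one
    (fun G' W' Z' hlt hA' hZ' hs' hK' hE' => ih _ hlt G' W' Z' hA' hZ' hs' hK' hE' rfl) hX hXW h4

end

section

variable {V : Type} [Fintype V]
variable {θ : ℤ} {P : SimpleGraph V → Prop} {K G : SimpleGraph V} {W Z : Finset V}

/-- The critical configuration for a rooted `K₄`. -/
abbrev CritK4 (G : SimpleGraph V) (W Z : Finset V) : Prop :=
  Crit 6 (fun G' => RM Z G' (cliq Z)) ⊥ G W Z

theorem CritK4.not_rig_four (c : CritK4 G W Z) {X : Finset V} (hX : X ⊆ W) (hne : X.Nonempty)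
    (h4 : (nb G X).card = 4) : ¬ Rig G X := by
  intro hr
  obtain ⟨π, h1, h2⟩ := link_lemma c.adm c.hZ (fun X hX hne h => c.not_rig hX hne h) hX hne
    fun S hS _ => hr.mono le_rfl (cliq_mono hS) hS
  have hS : Z.image π.symm = nb G X := eq_of_subset_of_card_le
    (fun y hy => by obtain ⟨z, hz, rfl⟩ := mem_image.1 hy; exact h1 z hz)
    (by rw [card_image_of_injective _ π.symm.injective, c.hZ, h4])
  have h5 := RM.perm π hr h1
  rw [← hS, pm_cliq] at h5
  rw [hS] at h5
  exact c.hP ((h2 G (tch_le)).trans h5)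

theorem CritK4.dd_add_lt (c : CritK4 G W Z)
    (ih : ∀ (G' : SimpleGraph V) (W' Z' : Finset V), W'.card < W.card → Adm G' W' Z' →
      Z'.card = 4 → Sp G' W' → 6 ≤ ed G' - 3 * (W'.card : ℤ) → RM Z' G' (cliq Z'))
    {X : Finset V} (hX : X ⊆ W) (hXW : X ≠ W) (h4 : (nb G X).card = 4) :
    dd G X + ed (ind G (nb G X)) < 6 := by
  by_contra h6
  have hR : ind G (nb G X) ≤ cliq (nb G X) := fun a b h => ⟨h.1.ne, h.2⟩
  have hed := ed_tch_sup (G := G) (X := X) hR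
  have hr := ih (tch G X ⊔ ind G (nb G X)) X (nb G X) (card_lt_card (hX.ssubset_of_ne hXW))
    (adm_tch_sup hR) h4 (c.sp.tch_sup hX hR) (by unfold dd at h6; omega)
  have hne : X.Nonempty := by
    obtain ⟨y, hy⟩ := card_pos.1 (show 0 < (nb G X).card by omega)
    obtain ⟨-, x, hx, -⟩ := mem_nb.1 hy
    exact ⟨x, hx⟩
  exact c.not_rig_four hX hne h4 (hr.mono (sup_le tch_le_ind fun a b h =>
    ⟨h.1, mem_union_right _ h.2.1, mem_union_right _ h.2.2⟩) le_rfl subset_rfl)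

theorem ed_replace_cm {X : Finset V} {s t : V} (h4 : (nb G X).card = 4) (hs : s ∈ nb G X)
    (ht : t ∈ nb G X) (hst : s ≠ t) :
    ed (del G X) + 5 ≤ ed (del G X ⊔ cm (nb G X) s t) + ed (ind G (nb G X)) := by
  have h1 : ed (del G X) ≤ ed (del G X \ ind G (nb G X)) + ed (ind G (nb G X)) :=
    (ed_mono fun a b h => by
      by_cases h' : (ind G (nb G X)).Adj a b
      · exact .inr h'
      · exact .inl ⟨h, h'⟩).trans (ed_sup_le _ _)
  have h2 := ed_sup_disj (G := del G X \ ind G (nb G X)) (H := cm (nb G X) s t)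
    fun a b h h' => h.2 ⟨h.1.1, h'.2.1, h'.2.2.1⟩
  have h3 := ed_cm h4 hs ht hst
  have h5 := ed_mono (show del G X \ ind G (nb G X) ⊔ cm (nb G X) s t ≤
    del G X ⊔ cm (nb G X) s t from sup_le_sup_right sdiff_le _)
  omega

/-- A violator, after the replacement of a maximal cut, that meets its boundary in one vertex
only and misses another one. -/
theorem CritK4.violator_false (c : CritK4 G W Z) {X : Finset V} (hX : Cut G W X)
    (hmax : ∀ X', X ⊂ X' → ¬ Cut G W X') {x a s t : V} (hS : nb G X = {x, a, s, t})
    (hxa : x ≠ a) (hxs : x ≠ s) (has : a ≠ s) (hst : s ≠ t)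
    (hr : RM (nb G X) (ind G (X ∪ nb G X)) (cm (nb G X) s a)) {Y : Finset V} (hY : Y ⊆ W \ X)
    (hYc : Conn (del G X ⊔ cm (nb G X) s t) Y)
    (h3 : (nb (del G X ⊔ cm (nb G X) s t) Y).card ≤ 3)
    (h1 : 1 ≤ dd (del G X ⊔ cm (nb G X) s t) Y) (hT : Y ∩ nb G X = {s})
    (ht : t ∉ nb (del G X ⊔ cm (nb G X) s t) Y) : False := by
  set G' := del G X ⊔ cm (nb G X) s t with hG'
  set N := nb G' Y with hN
  have hXY : Disjoint X Y := Finset.disjoint_right.2 fun y hy => (mem_sdiff.1 (hY hy)).2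
  have hYW : Y ⊆ W := hY.trans sdiff_subset
  have mS : ∀ y, y ∈ nb G X ↔ y = x ∨ y = a ∨ y = s ∨ y = t := fun y => by rw [hS]; simp
  have mT : ∀ y, y ∈ Y → y ∈ nb G X → y = s := fun y hy hyS =>
    mem_singleton.1 (hT ▸ mem_inter.2 ⟨hy, hyS⟩)
  have hsY : s ∈ Y := (mem_inter.1 (hT ▸ mem_singleton_self s : s ∈ Y ∩ nb G X)).1
  have hxS := (mS x).2 (.inl rfl)
  have haS := (mS a).2 (.inr (.inl rfl))
  have hsS := (mS s).2 (.inr (.inr (.inl rfl)))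
  have htS := (mS t).2 (.inr (.inr (.inr rfl)))
  have hxY : x ∉ Y := fun h => hxs (mT x h hxS)
  have haY : a ∉ Y := fun h => has (mT a h haS)
  have htY : t ∉ Y := fun h => hst (mT t h htS).symm
  have h4 := hX.2.2.2.1
  have hcard4 : ({x, a, s, t} : Finset V).card = 4 := hS ▸ h4
  have hxt : x ≠ t := by
    rintro rfl
    have : ({x, a, s, x} : Finset V) ⊆ {x, a, s} := fun y hy => by
      simp only [mem_insert, mem_singleton] at hy ⊢; tauto
    have h5 := (card_le_card this).trans card_le_three
    omega
  have hat : a ≠ t := by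
    rintro rfl
    have : ({x, a, s, a} : Finset V) ⊆ {x, a, s} := fun y hy => by
      simp only [mem_insert, mem_singleton] at hy ⊢; tauto
    have h5 := (card_le_card this).trans card_le_three
    omega
  have hxN : x ∈ N := mem_nb.2 ⟨hxY, s, hsY, .inr ⟨hxs.symm, hsS, hxS,
    fun h => hxt h.2, fun h => hst h.1⟩⟩
  have haN : a ∈ N := mem_nb.2 ⟨haY, s, hsY, .inr ⟨has.symm, hsS, haS,
    fun h => hat h.2, fun h => hst h.1⟩⟩
  have hRS : ∀ a b, (cm (nb G X) s t).Adj a b → a ∈ Y → a ∈ nb G X := fun a b h _ => h.2.1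
  have hNX : ∀ y ∈ N, y ∉ X := fun y hy hyX => by
    obtain ⟨-, z, hz, h | h⟩ := mem_nb.1 hy
    · exact h.2.2 hyX
    · exact (mem_nb.1 h.2.2.1).1 hyX
  have hN3 : 3 ≤ N.card := by
    by_contra h
    have := c.sp.dd_one hYW hXY hRS h3 hT ((card_le_card sdiff_subset).trans
      (show N.card ≤ 2 by omega))
    rw [← hG'] at this
    omega
  obtain ⟨p, hpN, hp⟩ : ∃ p ∈ N, p ≠ x ∧ p ≠ a := by
    by_contra h
    push Not at h
    have : N ⊆ {x, a} := fun y hy => by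
      rw [mem_insert, mem_singleton]
      by_cases e : y = x
      · exact .inl e
      · exact .inr (h y hy e)
    have := (card_le_card this).trans card_le_two
    omega
  have hNe : N = {x, a, p} := (eq_of_subset_of_card_le (fun y hy => by
    simp only [mem_insert, mem_singleton] at hy
    rcases hy with rfl | rfl | rfl <;> assumption) (by
      rw [card_eq_three.2 ⟨x, a, p, hxa, hp.1.symm, hp.2.symm, rfl⟩]; exact h3)).symm
  have hpY : p ∉ Y := (mem_nb.1 hpN).1
  have hpt : p ≠ t := fun e => ht (e ▸ hpN)
  have hps : p ≠ s := fun e => hpY (e ▸ hsY)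
  have hpX := hNX p hpN
  have hYG : Conn G Y := hYc.mono fun y hy z hz h => h.elim (fun h => h.1) fun h =>
    absurd ((mT y hy h.2.1).trans (mT z hz h.2.2.1).symm) h.1
  have hdelN : ∀ y z, y ∈ Y → z ∉ Y → z ∉ X → G.Adj y z → z ∈ N := fun y z hy hz hzX h =>
    mem_nb.2 ⟨hz, y, hy, .inl ⟨h, Finset.disjoint_right.1 hXY hy, hzX⟩⟩
  have hU : nb G (X ∪ Y) = insert t N := by
    ext y
    rw [mem_insert]
    constructor
    · intro hy
      obtain ⟨hyU, z, hz, hzy⟩ := mem_nb.1 hy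
      rw [mem_union, not_or] at hyU
      rcases mem_union.1 hz with hz | hz
      · have := (mS y).1 (mem_nb.2 ⟨hyU.1, z, hz, hzy⟩)
        rcases this with rfl | rfl | rfl | rfl
        exacts [.inr hxN, .inr haN, absurd hsY hyU.2, .inl rfl]
      · exact .inr (hdelN z y hz hyU.2 hyU.1 hzy)
    · have hSU : ∀ y ∈ nb G X, y ∉ Y → y ∈ nb G (X ∪ Y) := fun y hy hyY => by
        obtain ⟨h1, z, hz, h⟩ := mem_nb.1 hy
        exact mem_nb.2 ⟨fun h' => (mem_union.1 h').elim h1 hyY, z, mem_union_left _ hz, h⟩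
      rintro (rfl | hy)
      · exact hSU _ htS htY
      · obtain ⟨hyY, z, hz, h | h⟩ := mem_nb.1 hy
        · exact mem_nb.2 ⟨fun h' => (mem_union.1 h').elim (hNX y hy) hyY, z,
            mem_union_right _ hz, h.1⟩
        · exact hSU y h.2.2.1 hyY
  have hUW : X ∪ Y = W := by
    by_contra hne
    obtain ⟨hsX, x₀, hx₀, hxs₀⟩ := mem_nb.1 hsS
    refine hmax (X ∪ Y) ⟨subset_union_left, fun h => hsX (h (mem_union_right _ hsY))⟩
      ⟨union_subset hX.1 hYW, hne, hX.2.2.1.union hYG hx₀ hsY hxs₀, ?_,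
        hX.2.2.2.2.trans (card_le_card subset_union_left)⟩
    rw [hU, card_insert_of_notMem ht]
    omega
  have hZ : Z = {p, x, a, t} := by
    rw [← Crit.nb_W c, ← hUW, hU, hNe]
    ext y
    simp only [mem_insert, mem_singleton]
    tauto
  have e : insert s (Y \ nb G X) = Y := by
    rw [insert_eq, ← hT, union_comm, sdiff_union_inter]
  have hd : 1 ≤ dd G (Y \ nb G X) := by
    rw [← dd_replace_sdiff hXY hRS, ← hG']
    have h5 := dd_insert_le G' (v := s) (Y := Y \ nb G X) (N := N)
      (fun h' => (mem_sdiff.1 h').2 hsS) (fun y hy hyY => mem_nb.2 ⟨fun hy' => by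
        rcases mem_insert.1 (show y ∈ insert s (Y \ nb G X) by rw [e]; exact hy') with rfl | h'
        · exact hy.ne rfl
        · exact hyY h', s, hsY, hy⟩)
    rw [e] at h5
    omega
  obtain ⟨C, hCY, hC, hcl, hC1⟩ := exists_comp_of_dd _ hd
  have hCY' : C ⊆ Y := hCY.trans sdiff_subset
  have hCS : ∀ y ∈ C, y ∉ nb G X := fun y hy => (mem_sdiff.1 (hCY hy)).2
  have hCX : ∀ y ∈ C, y ∉ X := fun y hy => Finset.disjoint_right.1 hXY (hCY' hy)
  have hCn : nb G C ⊆ {s, x, a, p} := fun y hy => by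
    have h5 := nb_sdiff_sub hXY (show del G X ≤ G' from le_sup_left)
      (nb_sub_of_closed hCY hcl hy)
    rcases mem_union.1 h5 with h5 | h5
    · rw [hT, mem_singleton] at h5
      rw [h5]; exact mem_insert_self _ _
    · exact mem_insert_of_mem (hNe ▸ (mem_sdiff.1 h5).1)
  have hCe : nb G C = {s, x, a, p} := eq_of_subset_of_card_le hCn
    (card_le_four.trans (c.sp.four_le (hCY'.trans hYW) hC1))
  have hadj : ∀ y ∈ nb G C, y ∉ X → ∃ z ∈ C, (del G X ⊔ cm (nb G X) s a).Adj y z := by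
    intro y hy hyX
    obtain ⟨-, z, hz, h⟩ := mem_nb.1 hy
    exact ⟨z, hz, .inl ⟨h.symm, hyX, hCX z hz⟩⟩
  obtain ⟨z₁, hz₁, hsz⟩ := hadj s (by rw [hCe]; simp) (mem_nb.1 hsS).1
  obtain ⟨z₂, hz₂, hpz⟩ := hadj p (by rw [hCe]; simp) hpX
  obtain ⟨z₃, hz₃, haz⟩ := hadj a (by rw [hCe]; simp) (mem_nb.1 haS).1
  have hCc : Conn (del G X ⊔ cm (nb G X) s a) (insert p (insert s C)) :=
    ((hC.mono (H := del G X ⊔ cm (nb G X) s a) fun y hy z hz h =>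
      .inl ⟨h, hCX y hy, hCX z hz⟩).insert hz₁ hsz).insert
      (mem_insert_of_mem hz₂) hpz
  have hsB : s ∈ insert p (insert s C) := by simp
  have nB : ∀ y ∈ nb G X, y ≠ s → y ≠ p → y ∉ insert p (insert s C) := fun y hy h1 h2 h => by
    rcases mem_insert.1 h with h | h
    · exact h2 h
    · rcases mem_insert.1 h with h | h
      exacts [h1 h, hCS y h hy]
  have hZX : Disjoint Z X := c.adm.1.symm.mono_right hX.1
  refine c.hP ((RM.replace hr cm_le hZX).trans ?_)
  rw [hZ]
  refine RM.of_bags4 (mem_insert_self p _) (mem_singleton_self x) (mem_singleton_self a)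
    (mem_singleton_self t) hCc (Conn.singleton _ _) (Conn.singleton _ _) (Conn.singleton _ _)
    ?_ ?_ ?_ ?_ ?_ ?_ le_rfl ?_ ?_ ?_ ?_ ?_ ?_
  · exact disjoint_singleton_right.2 (nB x hxS hxs hp.1.symm)
  · exact disjoint_singleton_right.2 (nB a haS has hp.2.symm)
  · exact disjoint_singleton_right.2 (nB t htS hst.symm hpt.symm)
  · exact disjoint_singleton.2 hxa
  · exact disjoint_singleton.2 hxt
  · exact disjoint_singleton.2 hat
  · exact fun _ => .of_adj hsB (mem_singleton_self x)
      (.inr ⟨hxs.symm, hsS, hxS, fun h => hxa h.2, fun h => has h.1.symm⟩)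
  · exact fun _ => .of_adj (mem_insert_of_mem (mem_insert_of_mem hz₃)) (mem_singleton_self a)
      haz.symm
  · exact fun _ => .of_adj hsB (mem_singleton_self t)
      (.inr ⟨hst, hsS, htS, fun h => hat h.2.symm, fun h => has h.1.symm⟩)
  · exact fun _ => .of_adj (mem_singleton_self x) (mem_singleton_self a)
      (.inr ⟨hxa, hxS, haS, fun h => hxs h.1, fun h => hxa h.1⟩)
  · exact fun _ => .of_adj (mem_singleton_self x) (mem_singleton_self t)
      (.inr ⟨hxt, hxS, htS, fun h => hxs h.1, fun h => hxa h.1⟩)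
  · exact fun _ => .of_adj (mem_singleton_self a) (mem_singleton_self t)
      (.inr ⟨hat, haS, htS, fun h => has h.1, fun h => hst h.2.symm⟩)

theorem cm_comm (S : Finset V) (s t : V) : cm S s t = cm S t s := by
  ext a b
  simp only [cm]
  tauto

theorem CritK4.not_cut (c : CritK4 G W Z)
    (hd : ∀ X ⊆ W, X ≠ W → (nb G X).card = 4 → dd G X + ed (ind G (nb G X)) < 6)
    (hpt : ∀ X ⊆ W, X ≠ W → (nb G X).card = 4 → 2 ≤ dd G X → PT (tch G X) (nb G X))
    (X : Finset V) : ¬ Cut G W X := by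
  intro h
  obtain ⟨X, hX, hmax⟩ := h.exists_max
  have h4 := hX.2.2.2.1
  have hdX := hd X hX.1 hX.2.1 h4
  have h2 : 2 ≤ dd G X := by
    by_contra h2
    exact Crit.star_false c (fun Y hY hYW h => hd Y hY hYW h) hX hmax (by omega)
  obtain ⟨x, hx, hcm, -⟩ := hpt X hX.1 hX.2.1 h4 h2
  have hcm' : ∀ s ∈ nb G X, ∀ t ∈ nb G X, s ≠ x → t ≠ x → s ≠ t →
      RM (nb G X) (ind G (X ∪ nb G X)) (cm (nb G X) s t) := fun s hs t ht h1 h2 h3 =>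
    (hcm s hs t ht h1 h2 h3).mono tch_le_ind le_rfl subset_rfl
  have he := card_erase_add_one hx
  obtain ⟨s, hs, t, ht, hst⟩ := one_lt_card.1 (show 1 < ((nb G X).erase x).card by omega)
  obtain ⟨hsx, hs⟩ := mem_erase.1 hs
  obtain ⟨htx, ht⟩ := mem_erase.1 ht
  obtain ⟨a, hax, has, hat, hS⟩ := exists_fourth h4 hx hs ht hsx htx hst
  have haS : a ∈ nb G X := by rw [hS]; simp
  have hr := hcm' s hs t ht hsx htx hst
  have hlt : (W \ X).card < W.card := card_lt_card ⟨sdiff_subset, fun h => by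
    obtain ⟨y, hy⟩ := hX.2.2.1.1
    exact (mem_sdiff.1 (h (hX.1 hy))).2 hy⟩
  have h5 := ed_replace_cm h4 hs ht hst
  have h6 := ed_eq_rho_add G X
  have h7 := card_sdiff_add_card_eq_card hX.1
  obtain ⟨Y, hY, hYc, hY3, hY1, hYr⟩ := Crit.viol c (.inl hlt) (c.adm.replace cm_le) bot_le
    (by have := c.hE; unfold dd at hdX; omega)
    (RM.replace hr cm_le (c.adm.1.symm.mono_right hX.1))
  set N := nb (del G X ⊔ cm (nb G X) s t) Y with hN
  have hadj : ∀ y z, y ∈ Y → y ∈ nb G X → z ∈ nb G X → ¬ (y = s ∧ z = t) →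
      ¬ (y = t ∧ z = s) → z ∈ Y ∪ N := by
    intro y z hy hyS hzS h1 h2
    by_cases hz : z ∈ Y
    · exact mem_union_left _ hz
    · exact mem_union_right _ (mem_nb.2 ⟨hz, y, hy, .inr ⟨fun e => hz (e ▸ hy), hyS, hzS, h1, h2⟩⟩)
  have hall : ¬ nb G X ⊆ Y ∪ N := by
    intro hsub
    obtain ⟨e1, e2⟩ := rig_replace hr cm_le rfl hsub hYr
    exact c.not_rig (union_subset hX.1 (hY.trans sdiff_subset))
      (hX.2.2.1.1.mono subset_union_left) (by rw [e1]; exact hY3) e2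
  have mS : ∀ y, y ∈ nb G X ↔ y = x ∨ y = a ∨ y = s ∨ y = t := fun y => by rw [hS]; simp
  have hmid : ∀ y ∈ nb G X, y ∈ Y → y = s ∨ y = t := by
    intro y hyS hy
    by_contra h
    rw [not_or] at h
    exact hall fun z hz => hadj y z hy hyS hz (fun h' => h.1 h'.1) fun h' => h.2 h'.1
  have one : ∀ s t, nb G X = {x, a, s, t} → s ≠ x → t ≠ x → s ≠ t → a ≠ s →
      N = nb (del G X ⊔ cm (nb G X) s t) Y → Conn (del G X ⊔ cm (nb G X) s t) Y →
      1 ≤ dd (del G X ⊔ cm (nb G X) s t) Y →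
      (∀ y ∈ nb G X, y ∈ Y → y = s ∨ y = t) → s ∈ Y → False := by
    intro s t hS hsx htx hst has hNe hYc hY1 hmid hsY
    have mS : ∀ y, y ∈ nb G X ↔ y = x ∨ y = a ∨ y = s ∨ y = t := fun y => by rw [hS]; simp
    have hsS := (mS s).2 (by tauto)
    have haS := (mS a).2 (by tauto)
    have hadj' : ∀ z, z ∈ nb G X → z ≠ t → z ∈ Y ∪ N := by
      intro z hz hzt
      by_cases hzY : z ∈ Y
      · exact mem_union_left _ hzY
      · exact mem_union_right _ (hNe ▸ mem_nb.2 ⟨hzY, s, hsY, .inr ⟨fun e => hzY (e ▸ hsY), hsS,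
          hz, fun h => hzt h.2, fun h => hst h.1⟩⟩)
    have htN : t ∉ Y ∪ N := fun h => hall fun z hz => by
      by_cases e : z = t
      · exact e ▸ h
      · exact hadj' z hz e
    rw [mem_union, not_or] at htN
    refine CritK4.violator_false c hX hmax hS hax.symm hsx.symm has hst
      (hcm' s hsS a haS hsx hax has.symm) hY hYc (hNe ▸ hY3) hY1 ?_ (hNe ▸ htN.2)
    ext y
    rw [mem_inter, mem_singleton]
    constructor
    · rintro ⟨hy, hyS⟩
      exact (hmid y hyS hy).resolve_right fun e => htN.1 (e ▸ hy)
    · rintro rfl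
      exact ⟨hsY, hsS⟩
  by_cases hdis : Disjoint (nb G X) Y
  · exact c.sp.replace_false cm_le hY hdis hY3 hY1
  obtain ⟨y, hyS, hy⟩ := not_disjoint_iff.1 hdis
  rcases hmid y hyS hy with rfl | rfl
  · exact one y t hS hsx htx hst has rfl hYc hY1 hmid hy
  · rw [cm_comm] at hYc hY1
    exact one y s (by rw [hS, pair_comm]) htx hsx hst.symm hat (by rw [hN, cm_comm]) hYc hY1
      (fun z hz hz' => (hmid z hz hz').symm) hy

/-- Deletion of an edge inside `Z` is harmless as long as there is an edge to spare. -/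
theorem CritK4.not_adj (c : CritK4 G W Z) (hE : 7 ≤ ed G - 3 * (W.card : ℤ)) {u v : V}
    (hu : u ∈ Z) (hv : v ∈ Z) : ¬ G.Adj u v := by
  intro huv
  have hW : ∀ {y}, y ∈ W → y ≠ u ∧ y ≠ v := fun hy =>
    ⟨fun e => Finset.disjoint_left.1 c.adm.1 hy (e ▸ hu),
      fun e => Finset.disjoint_left.1 c.adm.1 hy (e ▸ hv)⟩
  set G' := G.deleteEdges {s(u, v)} with hG'
  have adj : ∀ a b, G'.Adj a b ↔ G.Adj a b ∧ ¬(a = u ∧ b = v) ∧ ¬(a = v ∧ b = u) := by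
    intro a b
    simp only [hG', deleteEdges_adj, Set.mem_singleton_iff, Sym2.eq_iff, not_or]
  have hle : G' ≤ G := deleteEdges_le _
  have h1 := ed_delEdge huv adj
  have htch : ∀ X ⊆ W, tch G' X = tch G X := by
    intro X hX
    ext a b
    refine ⟨fun h => ⟨hle h.1, h.2⟩, fun h => ⟨(adj a b).2 ⟨h.1, ?_⟩, h.2⟩⟩
    rcases h.2 with h | h
    · have := hW (hX h); tauto
    · have := hW (hX h); tauto
  exact c.hP (c.pull G' (RM.of_le hle) (c.ih G' W (.inr ⟨rfl, by omega⟩)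
    ⟨c.adm.1, fun a b h => c.adm.2 a b (hle h)⟩
    (fun X hX h3 => by
      rw [dd_eq_of_tch (htch X hX)]
      rw [nb_eq_of_tch (htch X hX)] at h3
      exact c.sp X hX h3) bot_le (by omega)))

theorem CritK4.false (c : CritK4 G W Z)
    (hd : ∀ X ⊆ W, X ≠ W → (nb G X).card = 4 → dd G X + ed (ind G (nb G X)) < 6)
    (hpt : ∀ X ⊆ W, X ≠ W → (nb G X).card = 4 → 2 ≤ dd G X → PT (tch G X) (nb G X)) :
    False := by
  have hnc := c.not_cut hd hpt
  have h3 : ∀ {u v}, v ∈ W → G.Adj u v → 3 ≤ (nbv G u ∩ nbv G v).card :=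
    fun hv h => Crit.common c hnc hv h
  have hzw : ∀ z ∈ Z, ∃ w ∈ W, G.Adj z w := fun z hz => by
    obtain ⟨-, w, hw, h⟩ := mem_nb.1 (show z ∈ nb G W from (Crit.nb_W c).symm ▸ hz)
    exact ⟨w, hw, h.symm⟩
  have hE6 : ed G - 3 * (W.card : ℤ) < 7 := by
    by_contra h
    refine Crit.del_false c hnc (by omega) fun z hz => ?_
    obtain ⟨w, hw, hzw⟩ := hzw z hz
    have h5 := card_le_card (show nbv G z ∩ nbv G w ⊆ nbv G z ∩ W from fun y hy => by
      obtain ⟨hy, -⟩ := mem_inter.1 hy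
      have hzy := mem_nbv.1 hy
      exact mem_inter.2 ⟨hy, (c.adm.2 y z hzy.symm).resolve_right fun h' =>
        c.not_adj (by omega) hz h' hzy⟩)
    have := h3 hw hzw
    omega
  have hzd : ∀ z ∈ Z, 4 ≤ (nbv G z).card := by
    intro z hz
    obtain ⟨w, hw, hzw⟩ := hzw z hz
    have h5 := card_lt_card (show nbv G z ∩ nbv G w ⊂ nbv G z from ⟨inter_subset_left, fun h =>
      (mem_nbv.1 (mem_inter.1 (h (mem_nbv.2 hzw))).2).ne rfl⟩)
    have := h3 hw hzw
    omega
  obtain ⟨v, hv, hv5⟩ := Crit.exists_degree_le_five c hzd (by omega)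
  exact c.hP (Crit.k4_of_degree_le_five c (r₁ := v) (r₂ := v) hv hv5
    (fun u hu => h3 hv (mem_nbv.1 hu).symm) tch_le fun _ _ _ _ hab => .inl hab)

/-- A graph with `6` more edges than thrice the number of non-roots, and no dense part behind at
most three vertices, has a rooted `K₄`. -/
theorem exists_k4 (G : SimpleGraph V) (W Z : Finset V) (hA : Adm G W Z) (hZ : Z.card = 4)
    (hs : Sp G W) (hE : 6 ≤ ed G - 3 * (W.card : ℤ)) : RM Z G (cliq Z) := by
  induction hn : W.card using Nat.strong_induction_on generalizing G W Z with
  | _ n ih =>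
  induction hm : ed G using Nat.strong_induction_on generalizing G W with
  | _ m ih' =>
  subst hn hm
  by_contra hP
  have c : CritK4 G W Z :=
    { adm := hA
      hZ := hZ
      sp := hs
      hK := bot_le
      hKZ := bot_le
      hE := hE
      hZθ := by
        have hle : ind G Z ≤ cliq Z := fun a b h => ⟨h.1.ne, h.2⟩
        obtain ⟨u, v, huv, hn⟩ : ∃ u v, (cliq Z).Adj u v ∧ ¬ G.Adj u v := by
          by_contra h
          push Not at h
          exact hP (RM.of_le h)
        have h1 := ed_cm hZ huv.2.1 huv.2.2 huv.1
        have h2 := ed_mono (show ind G Z ≤ cm Z u v from fun a b h => ⟨h.1.ne, h.2.1, h.2.2,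
          fun e => hn (e.1 ▸ e.2 ▸ h.1), fun e => hn (e.1 ▸ e.2 ▸ h.1.symm)⟩)
        omega
      hP := hP
      pull := fun G' hr h => hr.trans h
      ih := fun G' W' hlt hA' hs' _ hE' => by
        rcases hlt with hlt | ⟨he, hlt⟩
        · exact ih _ hlt G' W' Z hA' hZ hs' hE' rfl
        · exact ih' _ hlt G' W' hA' hs' hE' he rfl }
  refine c.false (fun X hX hXW h4 => c.dd_add_lt (fun G' W' Z' hlt hA' hZ' hs' hE' =>
    ih _ hlt G' W' Z' hA' hZ' hs' hE' rfl) hX hXW h4) fun X hX hXW h4 h2 => ?_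
  have hed := ed_tch_sup (G := G) (X := X) (R := cliq (nb G X)) le_rfl
  rw [ed_cliq h4] at hed
  exact (exists_pt (tch G X ⊔ cliq (nb G X)) X (nb G X) (adm_tch_sup le_rfl) h4
    (hs.tch_sup hX le_rfl) le_sup_right (by unfold dd at h2; omega)).trans
    (RM.of_le (sdiff_le_iff'.2 le_rfl))

theorem sp_of_internallyConnected (hic : InternallyConnected G (Z : Set V) 4) : Sp G Zᶜ := by
  intro X hX h3
  rcases X.eq_empty_or_nonempty with rfl | ⟨x, hx⟩
  · rw [dd_empty]
  have hi : ((X : Set V)ᶜ ∩ ((X : Set V) ∪ (nb G X : Set V))) = (nb G X : Set V) := by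
    ext y
    have : y ∈ nb G X → y ∉ X := fun h => (mem_nb.1 h).1
    simp only [Set.mem_inter_iff, Set.mem_compl_iff, Set.mem_union, mem_coe]
    tauto
  have h4 := hic (X : Set V)ᶜ ((X : Set V) ∪ nb G X) ⟨?_, ?_⟩ ?_ ⟨x, .inl hx, fun h => h hx⟩
  · rw [hi, Set.ncard_coe_finset] at h4
    omega
  · rw [← Set.union_assoc, Set.compl_union_self, Set.univ_union]
  · rintro u v huv ⟨⟨hu, hu'⟩, ⟨-, hv⟩⟩
    exact hu' (.inr (mem_nb.2 ⟨hu, v, not_not.1 hv, huv.symm⟩))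
  · exact fun z hz hzX => (mem_compl.1 (hX hzX)) hz

end

end RootedK4

/-- if `|Z| = 4`, `(G,Z)` is internally 4-connected and `G` has no
`Z`-rooted `K₄`-model, then `|E(G)| ≤ 3|V(G)| - 7`. -/
theorem statement_4 (V : Type) [Fintype V] (G : SimpleGraph V) (Z : Set V)
    (hZ : Z.ncard = 4) (hic : InternallyConnected G Z 4)
    (h : ¬ HasRootedK4Model G Z) :
    (G.edgeSet.ncard : ℤ) ≤ 3 * (Fintype.card V : ℤ) - 7 := by
  classical
  obtain ⟨Z, rfl⟩ := Z.toFinite.exists_finset_coe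
  rw [Set.ncard_coe_finset] at hZ
  by_contra hE
  have h1 := Finset.card_compl_add_card Z
  refine h (RootedK4.RM.hasRootedK4Model hZ (RootedK4.exists_k4 G Zᶜ Z
    ⟨disjoint_compl_left, fun u _ _ => ?_⟩ hZ ?_ ?_))
  · rw [Finset.mem_compl]; tauto
  · convert RootedK4.sp_of_internallyConnected hic
  · have : RootedK4.ed G = G.edgeSet.ncard := rfl
    omega
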